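/- arXiv:1809.02773 — 5 statements merged into one kernel-verified Lean document; each statement's English description precedes it below -/
import Mathlib

section
/- Let n, m be positive integers, let x ∈ ℝⁿ be nonzero with X = xx⊤, let z ∈ ℝⁿ be nonzero with Z = zz⊤, let T_z = {zw⊤ + wz⊤ : w ∈ ℝⁿ} and let P denote the orthogonal projection of symmetric matrices onto T_z with respect to the Frobenius inner product. Let B be a linear map from symmetric n×n matrices to ℝ^m with adjoint B⊤ (with respect to the Frobenius inner product on matrices and the Euclidean inner product on ℝ^m). Let 0 < ϑ_lb ≤ ϑ_up, ρ₄ ≥ 0, ε₀ > 0 and α > 0, and assume: (i) ϑ_lb‖W‖_F² ≤ (1/m)‖B(W)‖² ≤ ϑ_up‖W‖_F² for all W ∈ T_z; (ii) (1/m)‖P(B⊤(B((I − P)(Z − X))))‖_F ≤ √(ρ₄ ϑ_up) ‖Z − X‖_F; (iii) ‖Z − X‖_F ≤ ε₀‖X‖_F. Then the gradient update W' := Z + (α/m)·P(B⊤(B(X − Z))) satisfies ‖W' − X‖_F ≤ (max{|1 − αϑ_lb|, |1 − αϑ_up|} + α√(ρ₄ ϑ_up) + ε₀)·‖Z − X‖_F.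 -/
open Matrix

/-- Euclidean norm on `Fin n → ℝ`. -/
noncomputable def vecNorm {n : ℕ} (v : Fin n → ℝ) : ℝ := Real.sqrt (∑ i, (v i)^2)

/-- Frobenius inner product `⟨A, B⟩ = trace(Aᵀ B) = ∑ᵢⱼ Aᵢⱼ Bᵢⱼ`. -/
def frobInner {n : ℕ} (A B : Matrix (Fin n) (Fin n) ℝ) : ℝ := ∑ i, ∑ j, A i j * B i j

/-- Frobenius norm. -/
noncomputable def frobNorm {n : ℕ} (A : Matrix (Fin n) (Fin n) ℝ) : ℝ :=
  Real.sqrt (∑ i, ∑ j, (A i j)^2)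

/-- The tangent space `T_z = {z wᵀ + w zᵀ : w ∈ ℝⁿ}`. -/
def tangentSet {n : ℕ} (z : Fin n → ℝ) : Set (Matrix (Fin n) (Fin n) ℝ) :=
  {W | ∃ w : Fin n → ℝ, W = vecMulVec z w + vecMulVec w z}


section helpers
variable {n : ℕ}

lemma fi_add_left (A B C : Matrix (Fin n) (Fin n) ℝ) :
    frobInner (A + B) C = frobInner A C + frobInner B C := by
  simp [frobInner, add_mul, Finset.sum_add_distrib]

lemma fi_smul_left (t : ℝ) (A C : Matrix (Fin n) (Fin n) ℝ) :
    frobInner (t • A) C = t * frobInner A C := by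
  simp [frobInner, Finset.mul_sum, mul_assoc]

lemma fi_comm (A C : Matrix (Fin n) (Fin n) ℝ) : frobInner A C = frobInner C A := by
  simp [frobInner, mul_comm]

lemma fi_sub_left (A B C : Matrix (Fin n) (Fin n) ℝ) :
    frobInner (A - B) C = frobInner A C - frobInner B C := by
  simp [frobInner, sub_mul, Finset.sum_sub_distrib]

lemma fi_add_right (A B C : Matrix (Fin n) (Fin n) ℝ) :
    frobInner C (A + B) = frobInner C A + frobInner C B := by
  rw [fi_comm, fi_add_left, fi_comm A, fi_comm B]

lemma fi_sub_right (A B C : Matrix (Fin n) (Fin n) ℝ) :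
    frobInner C (A - B) = frobInner C A - frobInner C B := by
  rw [fi_comm, fi_sub_left, fi_comm A, fi_comm B]

lemma fi_smul_right (t : ℝ) (A C : Matrix (Fin n) (Fin n) ℝ) :
    frobInner C (t • A) = t * frobInner C A := by
  rw [fi_comm, fi_smul_left, fi_comm A]

lemma fi_self_nonneg (A : Matrix (Fin n) (Fin n) ℝ) : 0 ≤ frobInner A A :=
  Finset.sum_nonneg fun _ _ => Finset.sum_nonneg fun _ _ => mul_self_nonneg _

lemma fn_eq (A : Matrix (Fin n) (Fin n) ℝ) : frobNorm A = Real.sqrt (frobInner A A) := by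
  simp [frobNorm, frobInner, sq]

lemma fn_sq (A : Matrix (Fin n) (Fin n) ℝ) : frobNorm A ^ 2 = frobInner A A := by
  rw [fn_eq, Real.sq_sqrt (fi_self_nonneg A)]

lemma fn_nonneg (A : Matrix (Fin n) (Fin n) ℝ) : 0 ≤ frobNorm A := Real.sqrt_nonneg _

lemma fn_smul (t : ℝ) (A : Matrix (Fin n) (Fin n) ℝ) : frobNorm (t • A) = |t| * frobNorm A := by
  rw [fn_eq, fn_eq, fi_smul_left, fi_smul_right, ← mul_assoc, Real.sqrt_mul (mul_self_nonneg t),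
    Real.sqrt_mul_self_eq_abs]

lemma fn_norm (A : Matrix (Fin n) (Fin n) ℝ) :
    frobNorm A = ‖(WithLp.toLp 2 (fun p : Fin n × Fin n => A p.1 p.2) :
      EuclideanSpace ℝ (Fin n × Fin n))‖ := by
  rw [EuclideanSpace.norm_eq, frobNorm, Fintype.sum_prod_type]
  simp

lemma fn_add_le (A C : Matrix (Fin n) (Fin n) ℝ) :
    frobNorm (A + C) ≤ frobNorm A + frobNorm C := by
  rw [fn_norm, fn_norm, fn_norm]
  exact norm_add_le (WithLp.toLp 2 (fun p : Fin n × Fin n => A p.1 p.2) :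
      EuclideanSpace ℝ (Fin n × Fin n))
    (WithLp.toLp 2 (fun p : Fin n × Fin n => C p.1 p.2) :
      EuclideanSpace ℝ (Fin n × Fin n))

lemma ts_add {z : Fin n → ℝ} {U V : Matrix (Fin n) (Fin n) ℝ} (hU : U ∈ tangentSet z)
    (hV : V ∈ tangentSet z) : U + V ∈ tangentSet z := by
  obtain ⟨u, rfl⟩ := hU
  obtain ⟨v, rfl⟩ := hV
  refine ⟨u + v, ?_⟩
  ext i j; simp [vecMulVec_apply]; ring

lemma ts_smul {z : Fin n → ℝ} {U : Matrix (Fin n) (Fin n) ℝ} (t : ℝ) (hU : U ∈ tangentSet z) :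
    t • U ∈ tangentSet z := by
  obtain ⟨u, rfl⟩ := hU
  refine ⟨t • u, ?_⟩
  ext i j; simp [vecMulVec_apply]; ring

lemma ts_sub {z : Fin n → ℝ} {U V : Matrix (Fin n) (Fin n) ℝ} (hU : U ∈ tangentSet z)
    (hV : V ∈ tangentSet z) : U - V ∈ tangentSet z := by
  have := ts_add hU (ts_smul (-1) hV)
  simpa [sub_eq_add_neg] using this

lemma ts_symm {z : Fin n → ℝ} {U : Matrix (Fin n) (Fin n) ℝ} (hU : U ∈ tangentSet z) :
    U.IsSymm := by
  obtain ⟨u, rfl⟩ := hU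
  ext i j; simp [vecMulVec_apply]; ring

lemma fi_vec (a b c d : Fin n → ℝ) :
    frobInner (vecMulVec a b) (vecMulVec c d) = (a ⬝ᵥ c) * (b ⬝ᵥ d) := by
  simp only [frobInner, vecMulVec_apply, dotProduct, Finset.sum_mul_sum]
  exact Finset.sum_congr rfl fun i _ => Finset.sum_congr rfl fun j _ => by ring

/-- There is an element of the tangent space at distance at most `‖Z - X‖² / ‖X‖` from `Z - X`. -/
lemma exists_approx (x z : Fin n → ℝ) (hz : z ≠ 0) :
    ∃ V ∈ tangentSet z,
      frobNorm (vecMulVec z z - vecMulVec x x - V) * frobNorm (vecMulVec x x) ≤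
        frobNorm (vecMulVec z z - vecMulVec x x) ^ 2 := by
  have hb : 0 < z ⬝ᵥ z := by
    have h0 : 0 ≤ z ⬝ᵥ z := Finset.sum_nonneg fun _ _ => mul_self_nonneg _
    exact lt_of_le_of_ne h0 (fun h => hz (dotProduct_self_eq_zero.mp h.symm))
  set c : ℝ := (x ⬝ᵥ z) / (z ⬝ᵥ z) with hc
  set y : Fin n → ℝ := x - c • z with hy
  have hnorm : ∀ a : Fin n → ℝ, frobNorm (vecMulVec a a) = a ⬝ᵥ a := by
    intro a
    rw [fn_eq, fi_vec, Real.sqrt_mul_self]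
    exact Finset.sum_nonneg fun _ _ => mul_self_nonneg _
  refine ⟨vecMulVec z ((1 / 2 : ℝ) • z - c • y - (c ^ 2 / 2) • z) +
    vecMulVec ((1 / 2 : ℝ) • z - c • y - (c ^ 2 / 2) • z) z, ⟨_, rfl⟩, ?_⟩
  have hE : vecMulVec z z - vecMulVec x x - (vecMulVec z ((1 / 2 : ℝ) • z - c • y - (c ^ 2 / 2) • z) +
      vecMulVec ((1 / 2 : ℝ) • z - c • y - (c ^ 2 / 2) • z) z) = (-1 : ℝ) • vecMulVec y y := by
    ext i j
    simp [vecMulVec_apply, hy]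
    ring
  have hyy : y ⬝ᵥ y = x ⬝ᵥ x - (x ⬝ᵥ z) ^ 2 / (z ⬝ᵥ z) := by
    have : y ⬝ᵥ y = x ⬝ᵥ x - 2 * c * (x ⬝ᵥ z) + c ^ 2 * (z ⬝ᵥ z) := by
      simp only [hy, sub_dotProduct, dotProduct_sub, smul_dotProduct, dotProduct_smul, smul_eq_mul,
        dotProduct_comm z x]
      ring
    rw [this, hc]
    field_simp
    ring
  have hy0 : 0 ≤ y ⬝ᵥ y := Finset.sum_nonneg fun _ _ => mul_self_nonneg _
  rw [hE, fn_smul, hnorm, hnorm, fn_sq]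
  simp only [fi_sub_left, fi_sub_right, fi_vec, dotProduct_comm z x]
  generalize hA : x ⬝ᵥ x = a at *
  generalize hB : z ⬝ᵥ z = b at *
  generalize hS : x ⬝ᵥ z = s at *
  rw [hyy] at hy0 ⊢
  generalize hr : s ^ 2 / b = r at *
  have hsr : s * s = r * b := by rw [← hr]; field_simp
  have hr0 : 0 ≤ r := by rw [← hr]; positivity
  rw [hsr]
  norm_num
  nlinarith [mul_nonneg hr0 hy0, sq_nonneg (b - r)]

end helpers

/-- One-step error bound for the truncated Riemannian gradient descent update:
`P` is the orthogonal projection of symmetric matrices onto `T_z` (with respect to the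
Frobenius inner product), `B` is a linear map with adjoint `Bt`, satisfying the restricted
well conditioned property (i) on `T_z` and the restricted weak correlation bound (ii);
then the gradient update `W' = Z + (α/m)·P(Bᵀ(B(X − Z)))` contracts the error. -/
theorem one_step_error_bound
    (n m : ℕ) (hn : 0 < n) (hm : 0 < m)
    (x z : Fin n → ℝ) (hx : x ≠ 0) (hz : z ≠ 0)
    (X Z : Matrix (Fin n) (Fin n) ℝ)
    (hX : X = vecMulVec x x) (hZ : Z = vecMulVec z z)
    (P : Matrix (Fin n) (Fin n) ℝ →ₗ[ℝ] Matrix (Fin n) (Fin n) ℝ)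
    (hPmem : ∀ W : Matrix (Fin n) (Fin n) ℝ, W.IsSymm → P W ∈ tangentSet z)
    (hPorth : ∀ W : Matrix (Fin n) (Fin n) ℝ, W.IsSymm →
      ∀ V ∈ tangentSet z, frobInner (W - P W) V = 0)
    (B : Matrix (Fin n) (Fin n) ℝ →ₗ[ℝ] (Fin m → ℝ))
    (Bt : (Fin m → ℝ) →ₗ[ℝ] Matrix (Fin n) (Fin n) ℝ)
    (hBtSymm : ∀ b : Fin m → ℝ, (Bt b).IsSymm)
    (hAdj : ∀ W : Matrix (Fin n) (Fin n) ℝ, W.IsSymm → ∀ b : Fin m → ℝ,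
      frobInner (Bt b) W = ∑ k, B W k * b k)
    (ϑlb ϑup ρ₄ ε₀ α : ℝ)
    (hϑlb : 0 < ϑlb) (hϑ : ϑlb ≤ ϑup) (hρ₄ : 0 ≤ ρ₄) (hε₀ : 0 < ε₀) (hα : 0 < α)
    (hRWC : ∀ W ∈ tangentSet z,
      ϑlb * frobNorm W ^ 2 ≤ (1 / (m : ℝ)) * ∑ k, (B W k)^2 ∧
      (1 / (m : ℝ)) * ∑ k, (B W k)^2 ≤ ϑup * frobNorm W ^ 2)
    (hWeak : (1 / (m : ℝ)) * frobNorm (P (Bt (B ((Z - X) - P (Z - X)))))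
      ≤ Real.sqrt (ρ₄ * ϑup) * frobNorm (Z - X))
    (hInit : frobNorm (Z - X) ≤ ε₀ * frobNorm X) :
    frobNorm ((Z + (α / (m : ℝ)) • P (Bt (B (X - Z)))) - X)
      ≤ (max |1 - α * ϑlb| |1 - α * ϑup| + α * Real.sqrt (ρ₄ * ϑup) + ε₀)
        * frobNorm (Z - X) := by
  have hm' : (0 : ℝ) < m := by exact_mod_cast hm
  have hXs : X.IsSymm := by
    subst hX; ext i j; simp [vecMulVec_apply, mul_comm]
  have hZs : Z.IsSymm := by
    subst hZ; ext i j; simp [vecMulVec_apply, mul_comm]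
  have hEs : (Z - X).IsSymm := hZs.sub hXs
  have hXpos : 0 < frobNorm X := by
    rw [hX, fn_eq, fi_vec]
    have : x ⬝ᵥ x ≠ 0 := fun h => hx (dotProduct_self_eq_zero.mp h)
    exact Real.sqrt_pos.mpr (mul_self_pos.mpr this)
  set E := Z - X with hE
  set D := P E with hD
  have hDT : D ∈ tangentSet z := hPmem E hEs
  -- Pythagoras
  have pyth : ∀ V ∈ tangentSet z,
      frobInner (E - V) (E - V) = frobInner (E - D) (E - D) + frobInner (D - V) (D - V) := by
    intro V hV
    have h0 := hPorth E hEs (D - V) (ts_sub hDT hV)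
    have e : E - V = (E - D) + (D - V) := by abel
    rw [e, fi_add_left, fi_add_right, fi_add_right, fi_comm (D - V) (E - D)]
    rw [← hD] at h0
    rw [h0]; ring
  have hDE : frobNorm D ≤ frobNorm E := by
    have h := pyth 0 ⟨0, by simp⟩
    simp only [sub_zero] at h
    rw [fn_eq, fn_eq]
    exact Real.sqrt_le_sqrt (by linarith [fi_self_nonneg (E - D)])
  have hN : frobNorm (E - D) ≤ ε₀ * frobNorm E := by
    obtain ⟨V, hV, hle⟩ := exists_approx x z hz
    rw [← hX, ← hZ, ← hE] at hle
    have h1 : frobNorm (E - D) ≤ frobNorm (E - V) := by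
      rw [fn_eq, fn_eq]
      exact Real.sqrt_le_sqrt (by linarith [pyth V hV, fi_self_nonneg (D - V)])
    have h2 : frobNorm (E - D) * frobNorm X ≤ (ε₀ * frobNorm E) * frobNorm X := by
      have := mul_le_mul_of_nonneg_right h1 hXpos.le
      nlinarith [mul_le_mul_of_nonneg_left hInit (fn_nonneg E)]
    exact le_of_mul_le_mul_right h2 hXpos
  set c := max |1 - α * ϑlb| |1 - α * ϑup| with hc
  have hc0 : 0 ≤ c := (abs_nonneg _).trans (le_max_left _ _)
  -- quadratic form bound
  have hQ : ∀ W ∈ tangentSet z,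
      |frobInner W W - (α / m) * ∑ k, (B W k) ^ 2| ≤ c * frobInner W W := by
    intro W hW
    obtain ⟨h1, h2⟩ := hRWC W hW
    rw [fn_sq] at h1 h2
    have hw := fi_self_nonneg W
    have e : (α / m) * ∑ k, (B W k) ^ 2 = α * ((1 / (m : ℝ)) * ∑ k, (B W k) ^ 2) := by ring
    rw [e]
    generalize (1 / (m : ℝ)) * ∑ k, (B W k) ^ 2 = q at *
    have c1 : 1 - α * ϑlb ≤ c := (le_abs_self _).trans (le_max_left _ _)
    have c2 : -(1 - α * ϑup) ≤ c := (neg_le_abs _).trans (le_max_right _ _)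
    have k1 := mul_le_mul_of_nonneg_left h1 hα.le
    have k2 := mul_le_mul_of_nonneg_left h2 hα.le
    have l1 := mul_le_mul_of_nonneg_right c1 hw
    have l2 := mul_le_mul_of_nonneg_right c2 hw
    rw [abs_le]
    constructor <;> linarith
  set v := D - (α / m) • P (Bt (B D)) with hv
  have hvT : v ∈ tangentSet z := ts_sub hDT (ts_smul _ (hPmem _ (hBtSymm _)))
  have hvv : frobInner v v = frobInner D v - (α / m) * ∑ k, B v k * B D k := by
    have h0 := hPorth _ (hBtSymm (B D)) v hvT
    rw [fi_sub_left, hAdj v (ts_symm hvT)] at h0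
    have h1 : frobInner v v = frobInner D v - (α / m) * frobInner (P (Bt (B D))) v := by
      conv_lhs => enter [1]; rw [hv]
      rw [fi_sub_left, fi_smul_left]
    rw [h1, ← sub_eq_zero.mp h0]
  have hpol : ∀ t : ℝ, 4 * t * frobInner v v ≤
      2 * c * (frobInner D D + t ^ 2 * frobInner v v) := by
    intro t
    have p := (abs_le.mp (hQ _ (ts_add hDT (ts_smul t hvT)))).2
    have q := (abs_le.mp (hQ _ (ts_sub hDT (ts_smul t hvT)))).1
    have s1 : ∑ k, (B (D + t • v) k) ^ 2 =
        ∑ k, (B D k) ^ 2 + 2 * t * ∑ k, B v k * B D k + t ^ 2 * ∑ k, (B v k) ^ 2 := by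
      simp only [Finset.mul_sum, ← Finset.sum_add_distrib]
      refine Finset.sum_congr rfl fun k _ => ?_
      simp; ring
    have s2 : ∑ k, (B (D - t • v) k) ^ 2 =
        ∑ k, (B D k) ^ 2 - 2 * t * ∑ k, B v k * B D k + t ^ 2 * ∑ k, (B v k) ^ 2 := by
      simp only [Finset.mul_sum, ← Finset.sum_add_distrib, ← Finset.sum_sub_distrib]
      refine Finset.sum_congr rfl fun k _ => ?_
      simp; ring
    rw [s1] at p
    rw [s2] at q
    simp only [fi_add_left, fi_add_right, fi_sub_left, fi_sub_right, fi_smul_left, fi_smul_right,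
      fi_comm v D] at p q
    have e : 4 * t * frobInner v v =
      4 * t * frobInner D v - 4 * t * ((α / m) * ∑ k, B v k * B D k) := by rw [hvv]; ring
    rw [e]
    linarith
  have hvle : frobNorm v ≤ c * frobNorm D := by
    have hsq : frobInner v v ≤ c ^ 2 * frobInner D D := by
      rcases hc0.eq_or_lt with h | h
      · have := hpol 1
        rw [← h] at this ⊢
        linarith
      · have := hpol (1 / c)
        have e1 : 4 * (1 / c) * frobInner v v = (4 * frobInner v v) / c := by ring
        have e2 : 2 * c * (frobInner D D + (1 / c) ^ 2 * frobInner v v) =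
            (2 * c ^ 2 * frobInner D D + 2 * frobInner v v) / c := by
          field_simp
        rw [e1, e2, div_le_div_iff_of_pos_right h] at this
        linarith
    rw [← fn_sq, ← fn_sq, ← mul_pow] at hsq
    exact (sq_le_sq₀ (fn_nonneg v) (mul_nonneg hc0 (fn_nonneg D))).mp hsq
  have hdecomp : (Z + (α / (m : ℝ)) • P (Bt (B (X - Z)))) - X =
      v + ((-(α / m)) • P (Bt (B (E - D))) + (E - D)) := by
    have : X - Z = -E := by rw [hE]; abel
    rw [this, hv]
    simp only [map_neg, map_sub, smul_sub, smul_neg, neg_smul]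
    rw [hE]
    abel
  have hmid : frobNorm ((-(α / m)) • P (Bt (B (E - D)))) ≤
      α * Real.sqrt (ρ₄ * ϑup) * frobNorm E := by
    rw [fn_smul, abs_neg, abs_of_pos (div_pos hα hm')]
    have := mul_le_mul_of_nonneg_left hWeak hα.le
    calc _ = α * (1 / (m : ℝ) * frobNorm (P (Bt (B (E - D))))) := by ring
      _ ≤ _ := this
      _ = _ := by ring
  rw [hdecomp]
  have t1 := fn_add_le v ((-(α / m)) • P (Bt (B (E - D))) + (E - D))
  have t2 := fn_add_le ((-(α / m)) • P (Bt (B (E - D)))) (E - D)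
  have t3 := mul_le_mul_of_nonneg_left hDE hc0
  linarith
end

section
/- (Restricted well conditioned property.) Fix truncation parameters τ_z ≥ 2, τ_h ≥ 1, τ_x ≥ 1 and let ϑ₁ = E[ξ⁴·1{|ξ| ≤ τ_z}] − E[ξ²·1{|ξ| ≤ τ_z}], ϑ₂ = E[ξ²·1{|ξ| ≤ τ_z}] for ξ a standard normal random variable. For every ε ∈ (0,1) there exist constants c > 0 and C > 0 (depending only on τ_x, τ_z, τ_h, ε) such that the following holds. Let x ∈ ℝⁿ be nonzero, let a₁, …, a_m be independent standard Gaussian vectors in ℝⁿ, and set ρ₁ = 10τ_z³e^{−0.49τ_z²} + ε, ρ₂ = 6τ_z²τ_h e^{−0.64τ_h²} + 4τ_z²τ_x e^{−0.39τ_x²} + ε, ϑ_lb = 2·min{ϑ₁, ϑ₂ − ρ₁ − ρ₂} and ϑ_up = max{ϑ₁ + ϑ₂ + ρ₁, 2(ϑ₂ + ρ₁)}. If m ≥ C·n, then with probability at least 1 − e^{−c·m} the bounds ϑ_lb‖W‖_F² ≤ (1/m)‖A_z(W)‖² ≤ ϑ_up‖W‖_F² hold simultaneously for all z ∈ ℝⁿ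 with ‖zz⊤ − xx⊤‖_F ≤ ‖xx⊤‖_F/13 and all W in the tangent space T_z = {zw⊤ + wz⊤ : w ∈ ℝⁿ}. -/
open Matrix MeasureTheory ProbabilityTheory

attribute [local instance] Classical.propDecidable

/-- Euclidean inner product on `Fin n → ℝ`. -/
def dotp {n : ℕ} (v w : Fin n → ℝ) : ℝ := ∑ i, v i * w i

/-- The truncated sensing operator `A_z`: the `k`-th entry equals
`⟨aₖaₖᵀ, W⟩ · 1{E₁ᵏ(x) ∩ E₁ᵏ(z) ∩ E₂ᵏ(z)}`, with `yₖ = (aₖᵀx)²`. -/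
noncomputable def truncOp {n m : ℕ} (a : Fin m → Fin n → ℝ) (x : Fin n → ℝ)
    (τx τz τh : ℝ) (z : Fin n → ℝ) (W : Matrix (Fin n) (Fin n) ℝ) : Fin m → ℝ :=
  fun k =>
    if (Real.sqrt ((dotp (a k) x)^2)
          ≤ τx * Real.sqrt ((∑ j, (dotp (a j) x)^2) / (m : ℝ))) ∧
       (|dotp (a k) z| ≤ τz * vecNorm z) ∧
       (|(dotp (a k) x)^2 - (dotp (a k) z)^2|
          ≤ (τh / (m : ℝ)) * (∑ j, |(dotp (a j) x)^2 - (dotp (a j) z)^2|)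
              * (|dotp (a k) z| + Real.sqrt ((dotp (a k) x)^2)) / vecNorm z)
    then frobInner (vecMulVec (a k) (a k)) W else 0

/-- Standard Gaussian measure `N(0, Iₙ)` on `ℝⁿ`. -/
noncomputable def stdGaussianVec (n : ℕ) : Measure (Fin n → ℝ) :=
  Measure.pi fun _ => gaussianReal 0 1

/-- The distribution of `m` independent standard Gaussian vectors in `ℝⁿ`. -/
noncomputable def sampleMeasure (m n : ℕ) : Measure (Fin m → Fin n → ℝ) :=
  Measure.pi fun _ => stdGaussianVec n



lemma vecNorm_eq {n : ℕ} (v : Fin n → ℝ) : vecNorm v = ‖WithLp.toLp 2 v‖ := by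
  rw [EuclideanSpace.norm_eq, vecNorm]
  simp

lemma vecNorm_nonneg {n : ℕ} (v : Fin n → ℝ) : 0 ≤ vecNorm v := Real.sqrt_nonneg _

lemma vecNorm_sq {n : ℕ} (v : Fin n → ℝ) : vecNorm v ^ 2 = dotp v v := by
  rw [vecNorm, Real.sq_sqrt (Finset.sum_nonneg fun i _ => sq_nonneg _), dotp]
  simp [sq]

lemma vecNorm_smul {n : ℕ} (c : ℝ) (v : Fin n → ℝ) : vecNorm (c • v) = |c| * vecNorm v := by
  rw [vecNorm_eq, vecNorm_eq, WithLp.toLp_smul, norm_smul, Real.norm_eq_abs]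

lemma vecNorm_eq_zero {n : ℕ} {v : Fin n → ℝ} : vecNorm v = 0 ↔ v = 0 := by
  rw [vecNorm_eq, norm_eq_zero]
  simp

lemma vecNorm_pos {n : ℕ} {v : Fin n → ℝ} (h : v ≠ 0) : 0 < vecNorm v :=
  lt_of_le_of_ne (vecNorm_nonneg v) (fun h' => h (vecNorm_eq_zero.1 h'.symm))

lemma dotp_comm {n : ℕ} (v w : Fin n → ℝ) : dotp v w = dotp w v := by
  simp [dotp, mul_comm]

lemma dotp_add_right {n : ℕ} (u v w : Fin n → ℝ) : dotp u (v + w) = dotp u v + dotp u w := by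
  simp [dotp, mul_add, Finset.sum_add_distrib]

lemma dotp_sub_right {n : ℕ} (u v w : Fin n → ℝ) : dotp u (v - w) = dotp u v - dotp u w := by
  simp [dotp, mul_sub, Finset.sum_sub_distrib]

lemma dotp_smul_right {n : ℕ} (c : ℝ) (u v : Fin n → ℝ) : dotp u (c • v) = c * dotp u v := by
  simp [dotp, Finset.mul_sum, mul_left_comm]

lemma dotp_add_left {n : ℕ} (u v w : Fin n → ℝ) : dotp (u + v) w = dotp u w + dotp v w := by
  simp [dotp, add_mul, Finset.sum_add_distrib]

lemma dotp_sub_left {n : ℕ} (u v w : Fin n → ℝ) : dotp (u - v) w = dotp u w - dotp v w := by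
  simp [dotp, sub_mul, Finset.sum_sub_distrib]

lemma dotp_smul_left {n : ℕ} (c : ℝ) (u v : Fin n → ℝ) : dotp (c • u) v = c * dotp u v := by
  simp [dotp, Finset.mul_sum, mul_assoc]

lemma dotp_sq_le {n : ℕ} (u v : Fin n → ℝ) : dotp u v ^ 2 ≤ vecNorm u ^ 2 * vecNorm v ^ 2 := by
  rw [vecNorm_sq, vecNorm_sq]
  simp only [dotp]
  have := Finset.sum_mul_sq_le_sq_mul_sq Finset.univ u v
  simpa [sq] using this

lemma measurable_dotp {n : ℕ} (u : Fin n → ℝ) : Measurable (fun a : Fin n → ℝ => dotp a u) := by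
  unfold dotp; fun_prop

open Metric Module in
open scoped Function ENNReal in
lemma card_le_of_sep {E : Type*} [NormedAddCommGroup E] [NormedSpace ℝ E] [FiniteDimensional ℝ E]
    (η : ℝ) (hη : 0 < η) (s : Finset E) (hs : ∀ c ∈ s, ‖c‖ ≤ 1)
    (h : ∀ c ∈ s, ∀ d ∈ s, c ≠ d → η ≤ ‖c - d‖) :
    (s.card : ℝ) ≤ (1 + 2 / η) ^ finrank ℝ E := by
  borelize E
  let μ : Measure E := Measure.addHaar
  let δ : ℝ := η / 2
  let ρ : ℝ := 1 + η / 2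
  have δpos : 0 < δ := by positivity
  have ρpos : 0 < ρ := by positivity
  set A := ⋃ c ∈ s, ball (c : E) δ with hA
  have D : Set.Pairwise (s : Set E) (Disjoint on fun c => ball (c : E) δ) := by
    rintro c hc d hd hcd
    apply ball_disjoint_ball
    rw [dist_eq_norm]
    have := h c hc d hd hcd
    simp only [δ]; linarith
  have A_subset : A ⊆ ball (0 : E) ρ := by
    refine Set.iUnion₂_subset fun x hx => ?_
    apply ball_subset_ball'
    have := hs x hx
    rw [dist_zero_right]; simp only [δ, ρ]; linarith
  have I :
    (s.card : ℝ≥0∞) * ENNReal.ofReal (δ ^ finrank ℝ E) * μ (ball 0 1) ≤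
      ENNReal.ofReal (ρ ^ finrank ℝ E) * μ (ball 0 1) :=
    calc
      (s.card : ℝ≥0∞) * ENNReal.ofReal (δ ^ finrank ℝ E) * μ (ball 0 1) = μ A := by
        rw [hA, measure_biUnion_finset D fun c _ => measurableSet_ball]
        simp only [μ.addHaar_ball_of_pos _ δpos]
        simp only [Finset.sum_const, nsmul_eq_mul, mul_assoc]
      _ ≤ μ (ball (0 : E) ρ) := measure_mono A_subset
      _ = ENNReal.ofReal (ρ ^ finrank ℝ E) * μ (ball 0 1) := by
        simp only [μ.addHaar_ball_of_pos _ ρpos]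
  have J : (s.card : ℝ≥0∞) * ENNReal.ofReal (δ ^ finrank ℝ E) ≤ ENNReal.ofReal (ρ ^ finrank ℝ E) :=
    (ENNReal.mul_le_mul_iff_left (measure_ball_pos _ _ zero_lt_one).ne' measure_ball_lt_top.ne).1 I
  have K := ENNReal.toReal_le_of_le_ofReal (pow_nonneg ρpos.le _) J
  rw [ENNReal.toReal_mul, ENNReal.toReal_natCast, ENNReal.toReal_ofReal (by positivity)] at K
  have e : (1 + 2 / η) = ρ / δ := by simp only [ρ, δ]; field_simp; ring
  rw [e, div_pow, le_div_iff₀ (by positivity)]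
  exact K

/-- Nets of the Euclidean unit ball of exponential cardinality. -/
lemma exists_net (η : ℝ) (hη : 0 < η) : ∃ K : ℝ, 1 ≤ K ∧ ∀ n : ℕ, ∃ N : Finset (Fin n → ℝ),
    (N.card : ℝ) ≤ K ^ n ∧ (∀ c ∈ N, vecNorm c ≤ 1) ∧
    ∀ u, vecNorm u ≤ 1 → ∃ c ∈ N, vecNorm (u - c) ≤ η := by
  have hK : (1 : ℝ) ≤ 1 + 2 / η := by have : 0 < 2 / η := by positivity
                                      linarith
  refine ⟨1 + 2 / η, hK, fun n => ?_⟩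
  let P : Finset (Fin n → ℝ) → Prop := fun s => (∀ c ∈ s, vecNorm c ≤ 1) ∧
    ∀ c ∈ s, ∀ d ∈ s, c ≠ d → η ≤ vecNorm (c - d)
  have hcard : ∀ s, P s → (s.card : ℝ) ≤ (1 + 2 / η) ^ n := by
    intro s hs
    have := card_le_of_sep (E := EuclideanSpace ℝ (Fin n)) η hη
      (s.map (WithLp.equiv 2 (Fin n → ℝ)).symm.toEmbedding) ?_ ?_
    · simpa using this
    · intro c hc
      obtain ⟨c, hc', rfl⟩ := Finset.mem_map.1 hc
      have := hs.1 c hc'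
      rwa [vecNorm_eq] at this
    · intro c hc d hd hcd
      obtain ⟨c, hc', rfl⟩ := Finset.mem_map.1 hc
      obtain ⟨d, hd', rfl⟩ := Finset.mem_map.1 hd
      have := hs.2 c hc' d hd' (by rintro rfl; exact hcd rfl)
      rwa [vecNorm_eq] at this
  obtain ⟨B, hB⟩ := exists_nat_ge ((1 + 2 / η) ^ n)
  have hbd : ∀ k, (∃ s, P s ∧ s.card = k) → k ≤ B := by
    rintro k ⟨s, hs, rfl⟩
    exact_mod_cast (hcard s hs).trans hB
  have h0 : ∃ s, P s ∧ s.card = 0 := ⟨∅, by simp [P], rfl⟩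
  obtain ⟨s, hs, hsc⟩ := Nat.findGreatest_spec (P := fun k => ∃ s, P s ∧ s.card = k)
    (Nat.zero_le B) h0
  refine ⟨s, hcard s hs, hs.1, fun u hu => ?_⟩
  by_contra hcon
  push Not at hcon
  have hus : u ∉ s := by
    intro hus
    have := hcon u hus
    rw [sub_self, vecNorm_eq_zero.2 rfl] at this
    linarith
  have hP : P (insert u s) := by
    refine ⟨?_, ?_⟩
    · intro c hc
      rcases Finset.mem_insert.1 hc with rfl | hc
      · exact hu
      · exact hs.1 c hc
    · intro c hc d hd hcd
      rcases Finset.mem_insert.1 hc with h1 | hc' <;> rcases Finset.mem_insert.1 hd with h2 | hd'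
      · exact absurd (h1.trans h2.symm) hcd
      · rw [h1]; exact (hcon d hd').le
      · have := (hcon c hc').le
        rw [h2]
        rwa [vecNorm_eq, ← norm_neg, ← WithLp.toLp_neg, neg_sub, ← vecNorm_eq] at this
      · exact hs.2 c hc' d hd' hcd
  have h1 : ∃ s', P s' ∧ s'.card = s.card + 1 := ⟨_, hP, Finset.card_insert_of_notMem hus⟩
  have := Nat.le_findGreatest (P := fun k => ∃ s, P s ∧ s.card = k) (hbd _ h1) h1
  omega

instance isProb_std (n : ℕ) : IsProbabilityMeasure (stdGaussianVec n) := by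
  unfold stdGaussianVec; infer_instance

instance isProb_sample (m n : ℕ) : IsProbabilityMeasure (sampleMeasure m n) := by
  unfold sampleMeasure; infer_instance

lemma char_gauss (t : ℝ) : ∫ x : ℝ, Complex.exp ((x * t : ℝ) * Complex.I) ∂(gaussianReal 0 1)
    = Complex.exp (-(t ^ 2 : ℝ) / 2) := by
  have := charFun_gaussianReal (μ := 0) (v := 1) t
  rw [charFun_apply_real] at this
  convert this using 1
  · congr 1; ext x; push_cast; ring_nf
  · push_cast; ring_nf

lemma char_std {n : ℕ} (b : Fin n → ℝ) :
    ∫ a, Complex.exp ((dotp a b : ℝ) * Complex.I) ∂(stdGaussianVec n)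
      = Complex.exp (-(dotp b b : ℝ) / 2) := by
  have : ∀ a : Fin n → ℝ, Complex.exp ((dotp a b : ℝ) * Complex.I)
      = ∏ i, Complex.exp ((a i * b i : ℝ) * Complex.I) := by
    intro a
    rw [← Complex.exp_sum, dotp, Complex.ofReal_sum, Finset.sum_mul]
  simp_rw [this]
  unfold stdGaussianVec
  rw [integral_fintype_prod_eq_prod (𝕜 := ℂ)
    (f := fun i (x : ℝ) => Complex.exp ((x * b i : ℝ) * Complex.I))]
  simp_rw [char_gauss]
  rw [← Complex.exp_sum]
  congr 1
  rw [dotp, Complex.ofReal_sum, ← Finset.sum_div, ← Finset.sum_neg_distrib]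
  simp [sq]

lemma char_prod (s t : ℝ) :
    ∫ p : ℝ × ℝ, Complex.exp ((p.1 * s + p.2 * t : ℝ) * Complex.I)
        ∂((gaussianReal 0 1).prod (gaussianReal 0 1))
      = Complex.exp (-(s ^ 2 + t ^ 2 : ℝ) / 2) := by
  have : ∀ p : ℝ × ℝ, Complex.exp ((p.1 * s + p.2 * t : ℝ) * Complex.I)
      = Complex.exp ((p.1 * s : ℝ) * Complex.I) * Complex.exp ((p.2 * t : ℝ) * Complex.I) := by
    intro a
    rw [← Complex.exp_add]; push_cast; ring_nf
  simp_rw [this]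
  rw [integral_prod_mul (fun x : ℝ => Complex.exp ((x * s : ℝ) * Complex.I))
    (fun x : ℝ => Complex.exp ((x * t : ℝ) * Complex.I)), char_gauss, char_gauss,
    ← Complex.exp_add]
  push_cast; ring_nf

/-- The joint law of two projections depends only on the Gram matrix. -/
lemma law_pair {n : ℕ} (u v : Fin n → ℝ) (α β α' β' : ℝ) (h1 : dotp u u = α ^ 2 + β ^ 2)
    (h2 : dotp v v = α' ^ 2 + β' ^ 2) (h3 : dotp u v = α * α' + β * β') :
    (stdGaussianVec n).map (fun a => (dotp a u, dotp a v))
      = ((gaussianReal 0 1).prod (gaussianReal 0 1)).map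
        (fun p : ℝ × ℝ => (α * p.1 + β * p.2, α' * p.1 + β' * p.2)) := by
  have hm : Measurable (fun a : Fin n → ℝ => (dotp a u, dotp a v)) :=
    (measurable_dotp u).prodMk (measurable_dotp v)
  have hm' : Measurable (fun p : ℝ × ℝ => (α * p.1 + β * p.2, α' * p.1 + β' * p.2)) := by fun_prop
  have := Measure.isProbabilityMeasure_map (μ := stdGaussianVec n) hm.aemeasurable
  have := Measure.isProbabilityMeasure_map
    (μ := (gaussianReal 0 1).prod (gaussianReal 0 1)) hm'.aemeasurable
  apply Measure.ext_of_charFunDual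
  funext L
  obtain ⟨s, t, hL⟩ : ∃ s t : ℝ, ∀ p : ℝ × ℝ, L p = p.1 * s + p.2 * t := by
    refine ⟨L (1, 0), L (0, 1), fun p => ?_⟩
    have : p = p.1 • ((1 : ℝ), (0 : ℝ)) + p.2 • ((0 : ℝ), (1 : ℝ)) := by ext <;> simp
    conv_lhs => rw [this]
    simp only [map_add, map_smul, smul_eq_mul]
  rw [charFunDual_apply, charFunDual_apply, integral_map hm.aemeasurable (by fun_prop),
    integral_map hm'.aemeasurable (by fun_prop)]
  simp_rw [hL]
  have e1 : ∀ a : Fin n → ℝ, dotp a u * s + dotp a v * t = dotp a (s • u + t • v) := by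
    intro a; rw [dotp_add_right, dotp_smul_right, dotp_smul_right]; ring
  have e2 : ∀ p : ℝ × ℝ, (α * p.1 + β * p.2) * s + (α' * p.1 + β' * p.2) * t
      = p.1 * (α * s + α' * t) + p.2 * (β * s + β' * t) := by intro p; ring
  simp_rw [e1, e2]
  rw [char_std, char_prod]
  congr 4
  simp only [dotp_add_right, dotp_smul_right, dotp_add_left, dotp_smul_left]
  rw [dotp_comm v u, h1, h2, h3]; ring

lemma law_one {n : ℕ} (u : Fin n → ℝ) (hu : dotp u u = 1) :
    (stdGaussianVec n).map (fun a => dotp a u) = gaussianReal 0 1 := by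
  have h := law_pair u u 1 0 1 0 (by rw [hu]; norm_num) (by rw [hu]; norm_num)
    (by rw [hu]; norm_num)
  have h' := congrArg (Measure.map Prod.fst) h
  rw [Measure.map_map measurable_fst ((measurable_dotp u).prodMk (measurable_dotp u)),
    Measure.map_map measurable_fst (by fun_prop)] at h'
  have e : (Prod.fst ∘ fun p : ℝ × ℝ => ((1 : ℝ) * p.1 + 0 * p.2, (1 : ℝ) * p.1 + 0 * p.2))
    = Prod.fst := by ext p; simp
  rw [e, Measure.map_fst_prod] at h'
  rw [measure_univ, one_smul] at h'
  exact h'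

lemma gauss_integral_pair {n : ℕ} (u v : Fin n → ℝ) (α β α' β' : ℝ) (h1 : dotp u u = α ^ 2 + β ^ 2)
    (h2 : dotp v v = α' ^ 2 + β' ^ 2) (h3 : dotp u v = α * α' + β * β')
    (g : ℝ × ℝ → ℝ) (hg : Measurable g) :
    ∫ a, g (dotp a u, dotp a v) ∂(stdGaussianVec n)
      = ∫ p : ℝ × ℝ, g (α * p.1 + β * p.2, α' * p.1 + β' * p.2)
        ∂((gaussianReal 0 1).prod (gaussianReal 0 1)) := by
  have h := congrArg (fun μ => ∫ p, g p ∂μ) (law_pair u v α β α' β' h1 h2 h3)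
  rwa [integral_map ((measurable_dotp u).prodMk (measurable_dotp v)).aemeasurable
    hg.aestronglyMeasurable, integral_map (by fun_prop) hg.aestronglyMeasurable] at h

lemma exp_sq_integral :
    Integrable (fun x : ℝ => Real.exp (x ^ 2 / 4)) (gaussianReal 0 1) ∧
    ∫ x : ℝ, Real.exp (x ^ 2 / 4) ∂(gaussianReal 0 1) = Real.sqrt 2 := by
  have e : ∀ x : ℝ, gaussianPDFReal 0 1 x * Real.exp (x ^ 2 / 4)
      = (Real.sqrt (2 * Real.pi))⁻¹ * Real.exp (-(1 / 4) * x ^ 2) := by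
    intro x
    rw [gaussianPDFReal]
    simp only [NNReal.coe_one, mul_one, sub_zero]
    rw [mul_assoc, ← Real.exp_add]
    ring_nf
  have hv : ∫ x : ℝ, Real.exp (x ^ 2 / 4) ∂(gaussianReal 0 1) = Real.sqrt 2 := by
    rw [integral_gaussianReal_eq_integral_smul one_ne_zero]
    simp only [smul_eq_mul, e]
    rw [integral_const_mul, integral_gaussian]
    rw [← Real.sqrt_inv, ← Real.sqrt_mul (by positivity)]
    congr 1
    field_simp
    norm_num
  refine ⟨?_, hv⟩
  by_contra h
  rw [integral_undef h] at hv
  have : 0 < Real.sqrt 2 := by positivity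
  linarith

lemma exp_sq_lintegral {n : ℕ} (u : Fin n → ℝ) (hu : vecNorm u ≤ 1) :
    ∫⁻ a, ENNReal.ofReal (Real.exp (dotp a u ^ 2 / 4)) ∂(stdGaussianVec n)
      ≤ ENNReal.ofReal (Real.sqrt 2) := by
  have h1 : ∀ v : Fin n → ℝ, vecNorm v = 1 →
      ∫⁻ a, ENNReal.ofReal (Real.exp (dotp a v ^ 2 / 4)) ∂(stdGaussianVec n)
      = ENNReal.ofReal (Real.sqrt 2) := by
    intro v hv
    have hl := law_one v (by rw [← vecNorm_sq, hv]; norm_num)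
    rw [← lintegral_map (f := fun x : ℝ => ENNReal.ofReal (Real.exp (x ^ 2 / 4)))
      (by fun_prop) (measurable_dotp v), hl, ← exp_sq_integral.2,
      ofReal_integral_eq_lintegral_ofReal exp_sq_integral.1
      (Filter.Eventually.of_forall fun x => (Real.exp_pos _).le)]
  by_cases h0 : u = 0
  · subst h0
    have : ∀ a : Fin n → ℝ, dotp a 0 = 0 := by intro a; simp [dotp]
    simp only [this]
    simp
  · have hp := vecNorm_pos h0
    rw [← h1 ((vecNorm u)⁻¹ • u)
      (by rw [vecNorm_smul, abs_of_pos (by positivity)]; field_simp)]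
    refine lintegral_mono fun a => ENNReal.ofReal_le_ofReal (Real.exp_le_exp.2 ?_)
    rw [dotp_smul_right, mul_pow]
    have : 1 ≤ (vecNorm u)⁻¹ ^ 2 := one_le_pow₀ ((one_le_inv₀ hp).2 hu)
    nlinarith [sq_nonneg (dotp a u)]

lemma tail_lintegral {n : ℕ} (R : ℝ) (u : Fin n → ℝ) (hu : vecNorm u ≤ 1) :
    ∫⁻ a, ENNReal.ofReal (Real.exp (max (dotp a u ^ 2 - R ^ 2) 0 / 4)) ∂(stdGaussianVec n)
      ≤ ENNReal.ofReal (Real.exp (Real.exp (-R ^ 2 / 4) * Real.sqrt 2)) := by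
  have hmd := measurable_dotp u
  calc _ ≤ ∫⁻ a, (1 + ENNReal.ofReal (Real.exp (-R ^ 2 / 4)) *
        ENNReal.ofReal (Real.exp (dotp a u ^ 2 / 4))) ∂(stdGaussianVec n) := by
        refine lintegral_mono fun a => ?_
        rw [← ENNReal.ofReal_mul (Real.exp_pos _).le, ← Real.exp_add, ← ENNReal.ofReal_one,
          ← ENNReal.ofReal_add (by norm_num) (Real.exp_pos _).le]
        refine ENNReal.ofReal_le_ofReal ?_
        rcases le_total (dotp a u ^ 2 - R ^ 2) 0 with h | h
        · rw [max_eq_right h]; simp [(Real.exp_pos _).le]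
        · rw [max_eq_left h]
          have : -R ^ 2 / 4 + dotp a u ^ 2 / 4 = (dotp a u ^ 2 - R ^ 2) / 4 := by ring
          rw [this]; linarith
    _ ≤ 1 + ENNReal.ofReal (Real.exp (-R ^ 2 / 4)) * ENNReal.ofReal (Real.sqrt 2) := by
        rw [lintegral_add_left measurable_const, lintegral_const_mul _ (by fun_prop)]
        simp only [lintegral_const, measure_univ, mul_one]
        gcongr
        exact exp_sq_lintegral u hu
    _ ≤ _ := by
        rw [← ENNReal.ofReal_mul (Real.exp_pos _).le, ← ENNReal.ofReal_one,
          ← ENNReal.ofReal_add (by norm_num) (by positivity)]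
        refine ENNReal.ofReal_le_ofReal ?_
        have := Real.add_one_le_exp (Real.exp (-R ^ 2 / 4) * Real.sqrt 2)
        linarith

lemma mp_eval (m n : ℕ) (k : Fin m) :
    MeasurePreserving (fun a : Fin m → Fin n → ℝ => a k) (sampleMeasure m n) (stdGaussianVec n) :=
  measurePreserving_eval (fun _ : Fin m => stdGaussianVec n) k

lemma chernoff {n : ℕ} (q : (Fin n → ℝ) → ℝ) (hq : Measurable q) (κ t : ℝ)
    (h : ∫⁻ a, ENNReal.ofReal (Real.exp (q a)) ∂(stdGaussianVec n) ≤ ENNReal.ofReal (Real.exp κ))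
    (m : ℕ) :
    sampleMeasure m n {a | m * t ≤ ∑ k, q (a k)} ≤ ENNReal.ofReal (Real.exp (-((t - κ) * m))) := by
  have hF : Measurable (fun x : Fin n → ℝ => ENNReal.ofReal (Real.exp (q x))) := by fun_prop
  have hind := iIndepFun_pi (μ := fun _ : Fin m => stdGaussianVec n)
    (X := fun _ : Fin m => fun x : Fin n → ℝ => ENNReal.ofReal (Real.exp (q x)))
    (fun _ => hF.aemeasurable)
  have hprod := lintegral_prod_eq_prod_lintegral_of_indepFun Finset.univ
    (fun (i : Fin m) (a : Fin m → Fin n → ℝ) => ENNReal.ofReal (Real.exp (q (a i)))) hind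
    (fun i => hF.comp (measurable_pi_apply i))
  have hle : ∫⁻ a, ∏ i, ENNReal.ofReal (Real.exp (q (a i))) ∂(sampleMeasure m n)
      ≤ ENNReal.ofReal (Real.exp (κ * m)) := by
    change ∫⁻ a, ∏ i, ENNReal.ofReal (Real.exp (q (a i)))
      ∂(Measure.pi fun _ : Fin m => stdGaussianVec n) ≤ _
    rw [hprod]
    calc _ ≤ ∏ i : Fin m, ENNReal.ofReal (Real.exp κ) := by
          refine Finset.prod_le_prod' fun i _ => ?_
          have := (mp_eval m n i).lintegral_comp hF
          exact this.le.trans h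
      _ = _ := by
          rw [Finset.prod_const, Finset.card_univ, Fintype.card_fin,
            ← ENNReal.ofReal_pow (Real.exp_pos _).le, ← Real.exp_nat_mul, mul_comm]
  have hmk := mul_meas_ge_le_lintegral (μ := sampleMeasure m n)
    (f := fun a => ∏ i, ENNReal.ofReal (Real.exp (q (a i)))) (by fun_prop)
    (ENNReal.ofReal (Real.exp (m * t)))
  have hsub : {a : Fin m → Fin n → ℝ | m * t ≤ ∑ k, q (a k)} ⊆
      {a | ENNReal.ofReal (Real.exp (m * t)) ≤ ∏ i, ENNReal.ofReal (Real.exp (q (a i)))} := by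
    intro a ha
    simp only [Set.mem_ofPred_eq] at ha ⊢
    rw [← ENNReal.ofReal_prod_of_nonneg (fun i _ => (Real.exp_pos _).le), ← Real.exp_sum]
    exact ENNReal.ofReal_le_ofReal (Real.exp_le_exp.2 ha)
  have h2 : ENNReal.ofReal (Real.exp (m * t)) *
      sampleMeasure m n {a | m * t ≤ ∑ k, q (a k)} ≤ ENNReal.ofReal (Real.exp (κ * m)) :=
    (mul_le_mul_right (measure_mono hsub) _).trans (hmk.trans hle)
  have h3 := mul_le_mul_right h2 (ENNReal.ofReal (Real.exp (-(m * t))))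
  rw [← mul_assoc, ← ENNReal.ofReal_mul (Real.exp_pos _).le,
    ← ENNReal.ofReal_mul (Real.exp_pos _).le, ← Real.exp_add, ← Real.exp_add] at h3
  simp only [neg_add_cancel, Real.exp_zero, ENNReal.ofReal_one, one_mul] at h3
  refine h3.trans (le_of_eq ?_)
  congr 2; ring

lemma hoeffding {n : ℕ} (f : (Fin n → ℝ) → ℝ) (hf : Measurable f) (B : ℝ) (hB : 0 < B)
    (hfB : ∀ a, |f a| ≤ B) (ε : ℝ) (hε : 0 < ε) (m : ℕ) (hm : 0 < m) :
    sampleMeasure m n {a | m * ε ≤ ∑ k, (f (a k) - ∫ x, f x ∂(stdGaussianVec n))}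
      ≤ ENNReal.ofReal (Real.exp (-(ε ^ 2 / (2 * B ^ 2) * m))) := by
  set E := ∫ x, f x ∂(stdGaussianVec n) with hE
  have hind := iIndepFun_pi (μ := fun _ : Fin m => stdGaussianVec n)
    (X := fun _ : Fin m => fun x : Fin n → ℝ => f x - E)
    (fun _ => (hf.sub_const _).aemeasurable)
  have hsg : ∀ i ∈ (Finset.univ : Finset (Fin m)), HasSubgaussianMGF
      (fun a : Fin m → Fin n → ℝ => f (a i) - E) ((‖B - (-B)‖₊ / 2) ^ 2)
      (Measure.pi fun _ : Fin m => stdGaussianVec n) := by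
    intro i _
    have h1 := hasSubgaussianMGF_of_mem_Icc (μ := Measure.pi fun _ : Fin m => stdGaussianVec n)
      (X := fun a : Fin m → Fin n → ℝ => f (a i)) (a := -B) (b := B)
      (hf.comp (measurable_pi_apply i)).aemeasurable
      (Filter.Eventually.of_forall fun a => abs_le.1 (hfB (a i)))
    have h2 : ∫ a : Fin m → Fin n → ℝ, f (a i) ∂(Measure.pi fun _ : Fin m => stdGaussianVec n)
        = E := by
      have hl := (mp_eval m n i).map_eq
      have h3 := integral_map (μ := sampleMeasure m n) (φ := fun a => a i)
        (measurable_pi_apply i).aemeasurable (f := f) hf.aestronglyMeasurable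
      rw [hl] at h3
      exact h3.symm
    rwa [h2] at h1
  have := HasSubgaussianMGF.measure_sum_ge_le_of_iIndepFun hind hsg
    (ε := m * ε) (by positivity)
  have hfin : (Measure.pi fun _ : Fin m => stdGaussianVec n)
    {ω | m * ε ≤ ∑ i, (f (ω i) - E)} ≠ ⊤ := measure_ne_top _ _
  rw [Measure.real, ← ENNReal.le_ofReal_iff_toReal_le hfin (Real.exp_pos _).le] at this
  refine this.trans (ENNReal.ofReal_le_ofReal (Real.exp_le_exp.2 (le_of_eq ?_)))
  have hm' : (m : ℝ) ≠ 0 := by positivity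
  have e : ‖B - -B‖ = 2 * B := by rw [Real.norm_eq_abs, abs_of_pos (by linarith)]; ring
  push_cast
  rw [Finset.sum_const, Finset.card_univ, Fintype.card_fin, nsmul_eq_mul, e]
  field_simp

/-- A property holds with exponentially high probability when `m ≥ C n`. -/
def Whp (P : ∀ m n : ℕ, (Fin m → Fin n → ℝ) → Prop) : Prop :=
  ∃ c C : ℝ, 0 < c ∧ 0 < C ∧ ∀ n m : ℕ, 1 ≤ n → 0 < m → C * (n : ℝ) ≤ (m : ℝ) →
    sampleMeasure m n {a | ¬ P m n a} ≤ ENNReal.ofReal (Real.exp (-(c * m)))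

lemma Whp.mono {P Q : ∀ m n : ℕ, (Fin m → Fin n → ℝ) → Prop} (hP : Whp P)
    (h : ∀ m n a, 0 < m → P m n a → Q m n a) : Whp Q := by
  obtain ⟨c, C, hc, hC, H⟩ := hP
  refine ⟨c, C, hc, hC, fun n m hn hm hCm => (measure_mono ?_).trans (H n m hn hm hCm)⟩
  intro a ha hPa
  exact ha (h m n a hm hPa)

lemma Whp.net {ι : ℕ → Type} (T : ∀ n, Finset (ι n)) (K : ℝ) (hK : 1 ≤ K)
    (hT : ∀ n, ((T n).card : ℝ) ≤ K ^ n) (c : ℝ) (hc : 0 < c)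
    (P : ∀ m n : ℕ, ι n → (Fin m → Fin n → ℝ) → Prop)
    (h : ∀ m n, 0 < m → ∀ t ∈ T n,
      sampleMeasure m n {a | ¬ P m n t a} ≤ ENNReal.ofReal (Real.exp (-(c * m)))) :
    Whp (fun m n a => ∀ t ∈ T n, P m n t a) := by
  have hl : 0 ≤ Real.log K := Real.log_nonneg hK
  refine ⟨c / 2, 2 * Real.log K / c + 1, by positivity, by positivity, fun n m hn hm hCm => ?_⟩
  have hsub : {a : Fin m → Fin n → ℝ | ¬ ∀ t ∈ T n, P m n t a}
      ⊆ ⋃ t ∈ T n, {a | ¬ P m n t a} := by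
    intro a ha
    simp only [Set.mem_ofPred_eq, not_forall] at ha
    obtain ⟨t, ht, hPt⟩ := ha
    exact Set.mem_biUnion (by exact ht) hPt
  refine (measure_mono hsub).trans ((measure_biUnion_finset_le _ _).trans
    ((Finset.sum_le_sum fun t ht => h m n hm t ht).trans ?_))
  rw [Finset.sum_const, nsmul_eq_mul, ← ENNReal.ofReal_natCast,
    ← ENNReal.ofReal_mul (by positivity)]
  refine ENNReal.ofReal_le_ofReal ?_
  have h1 : K ^ n = Real.exp (n * Real.log K) := by
    rw [Real.exp_nat_mul, Real.exp_log (by linarith)]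
  have h2 : n * Real.log K ≤ c / 2 * m := by
    have : (2 * Real.log K / c) * n ≤ m := by
      refine le_trans ?_ hCm
      have : (0 : ℝ) ≤ n := by positivity
      nlinarith
    have h3 : (2 * Real.log K / c) * n * (c / 2) ≤ m * (c / 2) :=
      mul_le_mul_of_nonneg_right this (by positivity)
    have h4 : (2 * Real.log K / c) * n * (c / 2) = n * Real.log K := by field_simp
    linarith
  calc ((T n).card : ℝ) * Real.exp (-(c * m)) ≤ Real.exp (c / 2 * m) * Real.exp (-(c * m)) := by
        gcongr
        exact (hT n).trans (h1.le.trans (Real.exp_le_exp.2 h2))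
    _ = Real.exp (-(c / 2 * m)) := by rw [← Real.exp_add]; ring_nf

lemma Whp.and {P Q : ∀ m n : ℕ, (Fin m → Fin n → ℝ) → Prop} (hP : Whp P) (hQ : Whp Q) :
    Whp (fun m n a => P m n a ∧ Q m n a) := by
  obtain ⟨c, C, hc, hC, H⟩ := hP
  obtain ⟨c', C', hc', hC', H'⟩ := hQ
  set d := min c c' with hd
  have hdp : 0 < d := lt_min hc hc'
  refine ⟨d / 2, C + C' + 2 * Real.log 2 / d, by positivity,
    by have := Real.log_pos one_lt_two; positivity, fun n m hn hm hCm => ?_⟩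
  have hn' : (1 : ℝ) ≤ n := by exact_mod_cast hn
  have hl := Real.log_pos one_lt_two
  have hq : 0 < 2 * Real.log 2 / d := by positivity
  have hm0 : (0 : ℝ) < m := by exact_mod_cast hm
  have i1 : C * (n : ℝ) ≤ m := by nlinarith
  have i2 : C' * (n : ℝ) ≤ m := by nlinarith
  have i3 : 2 * Real.log 2 / d ≤ m := by nlinarith
  have hsub : {a : Fin m → Fin n → ℝ | ¬ (P m n a ∧ Q m n a)}
      ⊆ {a | ¬ P m n a} ∪ {a | ¬ Q m n a} := by
    intro a ha
    simp only [Set.mem_ofPred_eq, not_and_or] at ha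
    exact ha
  refine (measure_mono hsub).trans ((measure_union_le _ _).trans
    ((add_le_add (H n m hn hm i1) (H' n m hn hm i2)).trans ?_))
  rw [← ENNReal.ofReal_add (Real.exp_pos _).le (Real.exp_pos _).le]
  refine ENNReal.ofReal_le_ofReal ?_
  have e1 : Real.exp (-(c * m)) ≤ Real.exp (-(d * m)) := by
    refine Real.exp_le_exp.2 (neg_le_neg ?_)
    exact mul_le_mul_of_nonneg_right (min_le_left _ _) hm0.le
  have e2 : Real.exp (-(c' * m)) ≤ Real.exp (-(d * m)) := by
    refine Real.exp_le_exp.2 (neg_le_neg ?_)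
    exact mul_le_mul_of_nonneg_right (min_le_right _ _) hm0.le
  have i4 : Real.log 2 ≤ d / 2 * m := by
    rw [div_le_iff₀ hdp] at i3; linarith
  have e3 : 2 * Real.exp (-(d * m)) ≤ Real.exp (-(d / 2 * m)) := by
    calc 2 * Real.exp (-(d * m)) = Real.exp (Real.log 2) * Real.exp (-(d * m)) := by
          rw [Real.exp_log (by norm_num)]
      _ = Real.exp (Real.log 2 + -(d * m)) := (Real.exp_add _ _).symm
      _ ≤ _ := Real.exp_le_exp.2 (by linarith)
  linarith

lemma whp_opnorm : Whp (fun m n a => ∀ u : Fin n → ℝ,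
    ∑ k, dotp (a k) u ^ 2 ≤ 32 * m * vecNorm u ^ 2) := by
  obtain ⟨K, hK, hN⟩ := exists_net (1 / 2) (by norm_num)
  choose N hN1 hN2 hN3 using hN
  have hs2 : Real.sqrt 2 ≤ 3 / 2 := by
    rw [Real.sqrt_le_left (by norm_num)]; norm_num
  have key := Whp.net N K hK hN1 (1 / 2) (by norm_num)
    (fun m n t a => ∑ k, dotp (a k) t ^ 2 ≤ 8 * m) (by
      intro m n hm t ht
      have := chernoff (fun a => max (dotp a t ^ 2 - 0 ^ 2) 0 / 4)
        (by have := measurable_dotp t; fun_prop) _ 2 (tail_lintegral 0 t (hN2 n t ht)) m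
      refine (measure_mono ?_).trans (this.trans (ENNReal.ofReal_le_ofReal
        (Real.exp_le_exp.2 ?_)))
      · intro a ha
        simp only [Set.mem_ofPred_eq, not_le] at ha ⊢
        rw [← Finset.sum_div]
        have : ∀ k, max (dotp (a k) t ^ 2 - 0 ^ 2) 0 = dotp (a k) t ^ 2 := by
          intro k; rw [max_eq_left] <;> simp [sq_nonneg]
        simp_rw [this]
        linarith
      · have e : Real.exp (-(0 : ℝ) ^ 2 / 4) = 1 := by norm_num
        rw [e, one_mul]
        have : (0 : ℝ) < m := by exact_mod_cast hm
        nlinarith)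
  refine key.mono ?_
  intro m n a hm ha
  let S : (Fin n → ℝ) → ℝ := fun u => vecNorm (fun k => dotp (a k) u)
  have hS : ∀ u, S u ^ 2 = ∑ k, dotp (a k) u ^ 2 := by
    intro u; simp only [S]; rw [vecNorm_sq]; simp [dotp, sq]
  have hS0 : ∀ u, 0 ≤ S u := fun u => vecNorm_nonneg _
  have hSadd : ∀ u v, S (u + v) ≤ S u + S v := by
    intro u v
    simp only [S, dotp_add_right]
    rw [vecNorm_eq, vecNorm_eq, vecNorm_eq]
    exact norm_add_le (WithLp.toLp 2 fun k => dotp (a k) u : EuclideanSpace ℝ (Fin m))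
      (WithLp.toLp 2 fun k => dotp (a k) v)
  have hSsmul : ∀ (c : ℝ) u, S (c • u) = |c| * S u := by
    intro c u
    simp only [S, dotp_smul_right]
    exact vecNorm_smul c _
  have hbdd : BddAbove (S '' {u | vecNorm u ≤ 1}) := by
    refine ⟨Real.sqrt (∑ k, vecNorm (a k) ^ 2), ?_⟩
    rintro _ ⟨u, hu, rfl⟩
    apply Real.le_sqrt_of_sq_le
    rw [hS]
    refine Finset.sum_le_sum fun k _ => (dotp_sq_le _ _).trans ?_
    have hu' : vecNorm u ≤ 1 := hu
    have : vecNorm u ^ 2 ≤ 1 := pow_le_one₀ (vecNorm_nonneg u) hu'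
    nlinarith [sq_nonneg (vecNorm (a k))]
  set M := sSup (S '' {u | vecNorm u ≤ 1}) with hM
  have hSM : ∀ u, vecNorm u ≤ 1 → S u ≤ M := fun u hu => le_csSup hbdd ⟨u, hu, rfl⟩
  have h1 : ∀ u, vecNorm u ≤ 1 → S u ≤ Real.sqrt (8 * m) + M / 2 := by
    intro u hu
    obtain ⟨c, hc, huc⟩ := hN3 n u hu
    have e : u = c + (1 / 2 : ℝ) • ((2 : ℝ) • (u - c)) := by
      rw [smul_smul]; norm_num
    have i1 : S c ≤ Real.sqrt (8 * m) := by
      apply Real.le_sqrt_of_sq_le; rw [hS]; exact ha c hc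
    have i2 : S ((2 : ℝ) • (u - c)) ≤ M := by
      apply hSM; rw [vecNorm_smul, abs_of_pos (by norm_num)]; linarith
    have i3 := hSadd c ((1 / 2 : ℝ) • ((2 : ℝ) • (u - c)))
    rw [← e, hSsmul, abs_of_pos (by norm_num)] at i3
    linarith
  have hM2 : M ≤ Real.sqrt (8 * m) + M / 2 := by
    refine csSup_le ⟨S 0, 0, ?_, rfl⟩ ?_
    · simp [vecNorm]
    · rintro _ ⟨u, hu, rfl⟩; exact h1 u hu
  have hM3 : M ≤ 2 * Real.sqrt (8 * m) := by linarith
  have hball : ∀ u, vecNorm u ≤ 1 → S u ^ 2 ≤ 32 * m := by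
    intro u hu
    have i1 := (hSM u hu).trans hM3
    have i2 : S u ^ 2 ≤ (2 * Real.sqrt (8 * m)) ^ 2 := pow_le_pow_left₀ (hS0 u) i1 2
    rw [mul_pow, Real.sq_sqrt (by positivity)] at i2
    linarith
  intro u
  rw [← hS]
  by_cases h0 : u = 0
  · subst h0
    rw [hS, vecNorm_eq_zero.2 rfl]
    simp [dotp]
  · have hp := vecNorm_pos h0
    have i1 := hball ((vecNorm u)⁻¹ • u)
      (by rw [vecNorm_smul, abs_of_pos (by positivity)]; field_simp; exact le_rfl)
    rw [hSsmul, abs_of_pos (by positivity), mul_pow, inv_pow, inv_mul_le_iff₀ (by positivity)] at i1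
    linarith

lemma exists_R (ε : ℝ) (hε : 0 < ε) : ∃ R0 : ℝ, 0 < R0 ∧ ∀ R, R0 ≤ R →
    Real.exp (-R ^ 2 / 4) * Real.sqrt 2 ≤ ε := by
  have hs2 : Real.sqrt 2 ≤ 2 := by
    rw [Real.sqrt_le_left (by norm_num)]; norm_num
  refine ⟨8 / ε + 1, by positivity, fun R hR => ?_⟩
  have hp : 0 < 8 / ε := by positivity
  have h1 : 8 / ε ≤ R ^ 2 := by nlinarith
  have h2 : R ^ 2 / 4 + 1 ≤ Real.exp (R ^ 2 / 4) := Real.add_one_le_exp _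
  have h3 : 2 / ε ≤ Real.exp (R ^ 2 / 4) := by
    have : 8 / ε = 4 * (2 / ε) := by ring
    linarith
  rw [neg_div, Real.exp_neg]
  have h4 : (Real.exp (R ^ 2 / 4))⁻¹ ≤ (2 / ε)⁻¹ := inv_anti₀ (by positivity) h3
  rw [inv_div] at h4
  have h5 : 0 < (Real.exp (R ^ 2 / 4))⁻¹ := by positivity
  nlinarith

lemma sum_abs_mul_le {m : ℕ} (p q : Fin m → ℝ) (A B η : ℝ) (hη : 0 < η)
    (hp : ∑ k, p k ^ 2 ≤ A * η ^ 2) (hq : ∑ k, q k ^ 2 ≤ B) :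
    ∑ k, |p k| * |q k| ≤ (A + B) * η / 2 := by
  have h : ∀ k, |p k| * |q k| ≤ (1 / (2 * η)) * p k ^ 2 + (η / 2) * q k ^ 2 := by
    intro k
    have := sq_nonneg (|p k| - η * |q k|)
    rw [sub_sq, mul_pow, sq_abs, sq_abs] at this
    have e : (1 / (2 * η)) * p k ^ 2 + (η / 2) * q k ^ 2 - |p k| * |q k| =
      (p k ^ 2 - 2 * |p k| * (η * |q k|) + η ^ 2 * q k ^ 2) / (2 * η) := by field_simp; ring
    have : 0 ≤ (p k ^ 2 - 2 * |p k| * (η * |q k|) + η ^ 2 * q k ^ 2) / (2 * η) := by positivity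
    linarith
  calc _ ≤ ∑ k, ((1 / (2 * η)) * p k ^ 2 + (η / 2) * q k ^ 2) := Finset.sum_le_sum fun k _ => h k
    _ = (1 / (2 * η)) * ∑ k, p k ^ 2 + (η / 2) * ∑ k, q k ^ 2 := by
        rw [Finset.sum_add_distrib, Finset.mul_sum, Finset.mul_sum]
    _ ≤ (1 / (2 * η)) * (A * η ^ 2) + (η / 2) * B := by gcongr
    _ = _ := by field_simp

lemma vecNorm_add_le {n : ℕ} (u v : Fin n → ℝ) : vecNorm (u + v) ≤ vecNorm u + vecNorm v := by
  rw [vecNorm_eq, vecNorm_eq, vecNorm_eq]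
  exact norm_add_le (WithLp.toLp 2 u : EuclideanSpace ℝ (Fin n)) (WithLp.toLp 2 v)

lemma whp_tail (ε : ℝ) (hε : 0 < ε) : ∃ R0 : ℝ, 0 < R0 ∧ ∀ R, R0 ≤ R →
    Whp (fun m n a => ∀ u : Fin n → ℝ, vecNorm u ≤ 1 →
      ∑ k, max (dotp (a k) u ^ 2 - R ^ 2) 0 ≤ ε * m) := by
  obtain ⟨R0, hR0, hR⟩ := exists_R (ε / 16) (by positivity)
  refine ⟨R0, hR0, fun R hRR => ?_⟩
  have hκ := hR R hRR
  have hη : 0 < ε / 160 := by positivity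
  obtain ⟨K, hK, hN⟩ := exists_net (ε / 160) hη
  choose N hN1 hN2 hN3 using hN
  have key := Whp.net N K hK hN1 (ε / 16) (by positivity)
    (fun m n t a => ∑ k, max (dotp (a k) t ^ 2 - R ^ 2) 0 ≤ ε / 2 * m) (by
      intro m n hm t ht
      have := chernoff (fun a => max (dotp a t ^ 2 - R ^ 2) 0 / 4)
        (by have := measurable_dotp t; fun_prop) _ (ε / 8) (tail_lintegral R t (hN2 n t ht)) m
      refine (measure_mono ?_).trans (this.trans (ENNReal.ofReal_le_ofReal
        (Real.exp_le_exp.2 ?_)))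
      · intro a ha
        simp only [Set.mem_ofPred_eq, not_le] at ha ⊢
        rw [← Finset.sum_div]
        linarith
      · have : (0 : ℝ) < m := by exact_mod_cast hm
        nlinarith)
  refine (key.and whp_opnorm).mono ?_
  rintro m n a hm ⟨ha, hop⟩ u hu
  have hm0 : (0 : ℝ) < m := by exact_mod_cast hm
  obtain ⟨c, hc, huc⟩ := hN3 n u hu
  have h1 := ha c hc
  have hpt : ∀ k, max (dotp (a k) u ^ 2 - R ^ 2) 0 ≤ max (dotp (a k) c ^ 2 - R ^ 2) 0
      + |dotp (a k) (u - c)| * |dotp (a k) (u + c)| := by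
    intro k
    rw [← abs_mul, dotp_sub_right, dotp_add_right]
    have e : (dotp (a k) u - dotp (a k) c) * (dotp (a k) u + dotp (a k) c)
      = dotp (a k) u ^ 2 - dotp (a k) c ^ 2 := by ring
    rw [e]
    apply max_le
    · have := le_abs_self (dotp (a k) u ^ 2 - dotp (a k) c ^ 2)
      have := le_max_left (dotp (a k) c ^ 2 - R ^ 2) 0
      linarith
    · have := abs_nonneg (dotp (a k) u ^ 2 - dotp (a k) c ^ 2)
      have := le_max_right (dotp (a k) c ^ 2 - R ^ 2) 0
      linarith
  have h2 : ∑ k, dotp (a k) (u - c) ^ 2 ≤ (32 * m) * (ε / 160) ^ 2 := by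
    refine (hop (u - c)).trans ?_
    have := pow_le_pow_left₀ (vecNorm_nonneg (u - c)) huc 2
    gcongr
  have h3 : ∑ k, dotp (a k) (u + c) ^ 2 ≤ 128 * m := by
    refine (hop (u + c)).trans ?_
    have i1 := vecNorm_add_le u c
    have i2 := hN2 n c hc
    have i3 : vecNorm (u + c) ≤ 2 := by linarith
    have := pow_le_pow_left₀ (vecNorm_nonneg (u + c)) i3 2
    nlinarith
  have h4 := sum_abs_mul_le _ _ _ _ _ hη h2 h3
  calc _ ≤ ∑ k, (max (dotp (a k) c ^ 2 - R ^ 2) 0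
      + |dotp (a k) (u - c)| * |dotp (a k) (u + c)|) := Finset.sum_le_sum fun k _ => hpt k
    _ ≤ ε / 2 * m + (32 * m + 128 * m) * (ε / 160) / 2 := by
        rw [Finset.sum_add_distrib]; linarith
    _ = ε * m := by ring

lemma exp_sq_integrable {n : ℕ} (u : Fin n → ℝ) (hu : vecNorm u ≤ 1) :
    Integrable (fun a => Real.exp (dotp a u ^ 2 / 4)) (stdGaussianVec n) ∧
    ∫ a, Real.exp (dotp a u ^ 2 / 4) ∂(stdGaussianVec n) ≤ Real.sqrt 2 := by
  have hmd := measurable_dotp u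
  have h := exp_sq_lintegral u hu
  refine ⟨⟨(by fun_prop), ?_⟩, ?_⟩
  · rw [hasFiniteIntegral_iff_ofReal (Filter.Eventually.of_forall fun x => (Real.exp_pos _).le)]
    exact h.trans_lt ENNReal.ofReal_lt_top
  · rw [integral_eq_lintegral_of_nonneg_ae
      (Filter.Eventually.of_forall fun x => (Real.exp_pos _).le) (by fun_prop)]
    exact ENNReal.toReal_le_of_le_ofReal (Real.sqrt_nonneg _) h

lemma tail_integrable {n : ℕ} (R : ℝ) (u : Fin n → ℝ) (hu : vecNorm u ≤ 1) :
    Integrable (fun a => max (dotp a u ^ 2 - R ^ 2) 0) (stdGaussianVec n) ∧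
    ∫ a, max (dotp a u ^ 2 - R ^ 2) 0 ∂(stdGaussianVec n)
      ≤ 4 * (Real.exp (-R ^ 2 / 4) * Real.sqrt 2) := by
  have hmd := measurable_dotp u
  obtain ⟨h1, h2⟩ := exp_sq_integrable u hu
  have hpt : ∀ a : Fin n → ℝ, max (dotp a u ^ 2 - R ^ 2) 0
      ≤ 4 * Real.exp (-R ^ 2 / 4) * Real.exp (dotp a u ^ 2 / 4) := by
    intro a
    rw [mul_assoc, ← Real.exp_add]
    apply max_le
    · have := Real.add_one_le_exp (-R ^ 2 / 4 + dotp a u ^ 2 / 4)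
      linarith
    · positivity
  have hi : Integrable (fun a => max (dotp a u ^ 2 - R ^ 2) 0) (stdGaussianVec n) := by
    refine (h1.const_mul (4 * Real.exp (-R ^ 2 / 4))).mono' (by fun_prop)
      (Filter.Eventually.of_forall fun a => ?_)
    rw [Real.norm_eq_abs, abs_of_nonneg (le_max_right _ _)]
    exact hpt a
  refine ⟨hi, ?_⟩
  calc _ ≤ ∫ a, 4 * Real.exp (-R ^ 2 / 4) * Real.exp (dotp a u ^ 2 / 4) ∂(stdGaussianVec n) :=
        integral_mono hi (h1.const_mul _) hpt
    _ ≤ _ := by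
        rw [integral_const_mul, ← mul_assoc]
        gcongr

lemma sq_integrable {n : ℕ} (u : Fin n → ℝ) :
    Integrable (fun a => dotp a u ^ 2) (stdGaussianVec n) ∧
    ∫ a, dotp a u ^ 2 ∂(stdGaussianVec n) ≤ 8 * vecNorm u ^ 2 := by
  by_cases h0 : u = 0
  · subst h0
    simp [dotp, vecNorm]
  have hp := vecNorm_pos h0
  obtain ⟨h1, h2⟩ := tail_integrable 0 ((vecNorm u)⁻¹ • u)
    (by rw [vecNorm_smul, abs_of_pos (by positivity)]; field_simp; exact le_rfl)
  have e : ∀ a : Fin n → ℝ, dotp a u ^ 2 =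
      vecNorm u ^ 2 * max (dotp a ((vecNorm u)⁻¹ • u) ^ 2 - 0 ^ 2) 0 := by
    intro a
    rw [dotp_smul_right, max_eq_left (by simp; positivity)]
    field_simp; ring
  have hs2 : Real.sqrt 2 ≤ 2 := by
    rw [Real.sqrt_le_left (by norm_num)]; norm_num
  simp_rw [e]
  refine ⟨h1.const_mul _, ?_⟩
  rw [integral_const_mul]
  have e0 : Real.exp (-(0 : ℝ) ^ 2 / 4) = 1 := by norm_num
  rw [e0] at h2
  have : 0 ≤ vecNorm u ^ 2 := sq_nonneg _
  nlinarith

lemma whp_lip_one_side (G : ℝ → ℝ → ℝ) (hG : Measurable (Function.uncurry G)) (B L : ℝ)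
    (hB : 0 < B) (hL : 0 < L)
    (hGB : ∀ s t, |G s t| ≤ B)
    (hGL : ∀ s t s' t', |G s t - G s' t'| ≤ L * (|s - s'| + |t - t'|)) (ε : ℝ) (hε : 0 < ε) :
    Whp (fun m n a => ∀ u v : Fin n → ℝ, vecNorm u ≤ 1 → vecNorm v ≤ 1 →
      ∑ k, G (dotp (a k) u) (dotp (a k) v)
        ≤ m * ∫ x, G (dotp x u) (dotp x v) ∂(stdGaussianVec n) + ε * m) := by
  have hη : 0 < ε / (100 * L) := by positivity
  set η := ε / (100 * L) with hηd
  have hηL : L * η = ε / 100 := by rw [hηd]; field_simp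
  obtain ⟨K, hK, hN⟩ := exists_net η hη
  choose N hN1 hN2 hN3 using hN
  have hmeas : ∀ (n : ℕ) (u v : Fin n → ℝ),
      Measurable (fun x : Fin n → ℝ => G (dotp x u) (dotp x v)) := by
    intro n u v
    exact hG.comp ((measurable_dotp u).prodMk (measurable_dotp v))
  have hint : ∀ (n : ℕ) (u v : Fin n → ℝ),
      Integrable (fun x : Fin n → ℝ => G (dotp x u) (dotp x v)) (stdGaussianVec n) := by
    intro n u v
    refine Integrable.of_bound (hmeas n u v).aestronglyMeasurable B
      (Filter.Eventually.of_forall fun a => hGB _ _)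
  have key := Whp.net (fun n => N n ×ˢ N n) (K * K) (by nlinarith)
    (by
      intro n
      rw [Finset.card_product, mul_pow]
      push_cast
      have := hN1 n
      gcongr) ((ε / 10) ^ 2 / (2 * B ^ 2)) (by positivity)
    (fun m n t a => ∑ k, (G (dotp (a k) t.1) (dotp (a k) t.2)
        - ∫ x, G (dotp x t.1) (dotp x t.2) ∂(stdGaussianVec n)) ≤ m * (ε / 10)) (by
      intro m n hm t ht
      have := hoeffding (fun x => G (dotp x t.1) (dotp x t.2)) (hmeas n t.1 t.2) B hB
        (fun x => hGB _ _) (ε / 10) (by positivity) m hm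
      refine (measure_mono ?_).trans this
      intro a ha
      simp only [Set.mem_ofPred_eq, not_le] at ha ⊢
      exact ha.le)
  refine (key.and whp_opnorm).mono ?_
  rintro m n a hm ⟨ha, hop⟩ u v hu hv
  have hm0 : (0 : ℝ) < m := by exact_mod_cast hm
  obtain ⟨c, hc, huc⟩ := hN3 n u hu
  obtain ⟨d, hd, hvd⟩ := hN3 n v hv
  have h1 := ha (c, d) (Finset.mem_product.2 ⟨hc, hd⟩)
  simp only [Finset.sum_sub_distrib, Finset.sum_const, Finset.card_univ, Fintype.card_fin,
    nsmul_eq_mul] at h1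
  -- empirical discretization
  have hs : ∀ w : Fin n → ℝ, vecNorm w ≤ η → ∑ k, |dotp (a k) w| ≤ (33 * m) * η / 2 := by
    intro w hw
    have i1 : ∑ k, dotp (a k) w ^ 2 ≤ (32 * m) * η ^ 2 := by
      refine (hop w).trans ?_
      have := pow_le_pow_left₀ (vecNorm_nonneg w) hw 2
      gcongr
    have i2 := sum_abs_mul_le (fun k => dotp (a k) w) (fun _ => 1) (32 * m) m η hη i1 (by simp)
    simp only [abs_one, mul_one] at i2
    linarith
  have hE : ∀ w : Fin n → ℝ, vecNorm w ≤ η →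
      Integrable (fun x => |dotp x w|) (stdGaussianVec n) ∧
      ∫ x, |dotp x w| ∂(stdGaussianVec n) ≤ 9 * η / 2 := by
    intro w hw
    obtain ⟨j1, j2⟩ := sq_integrable w
    have hmd := measurable_dotp w
    have hb : ∀ x : Fin n → ℝ, |dotp x w| ≤ 1 / (2 * η) * dotp x w ^ 2 + η / 2 := by
      intro x
      have := sq_nonneg (|dotp x w| - η)
      rw [sub_sq, sq_abs] at this
      have e : 1 / (2 * η) * dotp x w ^ 2 + η / 2 - |dotp x w|
        = (dotp x w ^ 2 - 2 * |dotp x w| * η + η ^ 2) / (2 * η) := by field_simp; ring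
      have : 0 ≤ (dotp x w ^ 2 - 2 * |dotp x w| * η + η ^ 2) / (2 * η) := by positivity
      linarith
    have hi2 : Integrable (fun x => 1 / (2 * η) * dotp x w ^ 2 + η / 2) (stdGaussianVec n) :=
      (j1.const_mul _).add (integrable_const _)
    have hi : Integrable (fun x => |dotp x w|) (stdGaussianVec n) := by
      refine hi2.mono' (by fun_prop) (Filter.Eventually.of_forall fun x => ?_)
      rw [Real.norm_eq_abs, abs_abs]; exact hb x
    refine ⟨hi, (integral_mono hi hi2 hb).trans ?_⟩
    rw [integral_add (j1.const_mul _) (integrable_const _), integral_const_mul]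
    simp only [integral_const, probReal_univ, one_smul]
    have h8 : ∫ a, dotp a w ^ 2 ∂(stdGaussianVec n) ≤ 8 * η ^ 2 := by
      refine j2.trans ?_
      have := pow_le_pow_left₀ (vecNorm_nonneg w) hw 2
      linarith
    have h9 : 1 / (2 * η) * ∫ a, dotp a w ^ 2 ∂(stdGaussianVec n) ≤ 1 / (2 * η) * (8 * η ^ 2) := by
      gcongr
    have e : 1 / (2 * η) * (8 * η ^ 2) = 4 * η := by field_simp; norm_num
    linarith
  have h2 : ∑ k, G (dotp (a k) u) (dotp (a k) v) ≤ ∑ k, G (dotp (a k) c) (dotp (a k) d)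
      + L * (33 * m * η / 2 + 33 * m * η / 2) := by
    have i1 := hs _ huc
    have i2 := hs _ hvd
    calc _ ≤ ∑ k, (G (dotp (a k) c) (dotp (a k) d)
        + L * (|dotp (a k) (u - c)| + |dotp (a k) (v - d)|)) := by
          refine Finset.sum_le_sum fun k _ => ?_
          have := (abs_le.1 (hGL (dotp (a k) u) (dotp (a k) v) (dotp (a k) c) (dotp (a k) d))).2
          rw [← dotp_sub_right, ← dotp_sub_right] at this
          linarith
      _ = ∑ k, G (dotp (a k) c) (dotp (a k) d)
          + L * (∑ k, |dotp (a k) (u - c)| + ∑ k, |dotp (a k) (v - d)|) := by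
          rw [Finset.sum_add_distrib, ← Finset.mul_sum, Finset.sum_add_distrib]
      _ ≤ _ := by gcongr
  have h3 : ∫ x, G (dotp x c) (dotp x d) ∂(stdGaussianVec n)
      ≤ ∫ x, G (dotp x u) (dotp x v) ∂(stdGaussianVec n) + L * (9 * η / 2 + 9 * η / 2) := by
    obtain ⟨i1, i1'⟩ := hE _ huc
    obtain ⟨i2, i2'⟩ := hE _ hvd
    have hi : Integrable (fun x => L * (|dotp x (u - c)| + |dotp x (v - d)|)) (stdGaussianVec n) :=
      (i1.add i2).const_mul L
    calc _ ≤ ∫ x, (G (dotp x u) (dotp x v) + L * (|dotp x (u - c)| + |dotp x (v - d)|))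
            ∂(stdGaussianVec n) := by
          refine integral_mono (hint n c d) ((hint n u v).add hi) fun x => ?_
          have := (abs_le.1 (hGL (dotp x u) (dotp x v) (dotp x c) (dotp x d))).1
          rw [← dotp_sub_right, ← dotp_sub_right] at this
          simp only
          linarith
      _ = ∫ x, G (dotp x u) (dotp x v) ∂(stdGaussianVec n)
          + L * (∫ x, |dotp x (u - c)| ∂(stdGaussianVec n)
            + ∫ x, |dotp x (v - d)| ∂(stdGaussianVec n)) := by
          rw [integral_add (hint n u v) hi, integral_const_mul, integral_add i1 i2]
      _ ≤ _ := by gcongr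
  have e1 : L * (33 * m * η / 2 + 33 * m * η / 2) = 33 * m * (L * η) := by ring
  have e2 : L * (9 * η / 2 + 9 * η / 2) = 9 * (L * η) := by ring
  rw [e1, hηL] at h2
  rw [e2, hηL] at h3
  have h4 := mul_le_mul_of_nonneg_left h3 hm0.le
  nlinarith

lemma whp_lip (G : ℝ → ℝ → ℝ) (hG : Measurable (Function.uncurry G)) (B L : ℝ)
    (hB : 0 < B) (hL : 0 < L)
    (hGB : ∀ s t, |G s t| ≤ B)
    (hGL : ∀ s t s' t', |G s t - G s' t'| ≤ L * (|s - s'| + |t - t'|)) (ε : ℝ) (hε : 0 < ε) :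
    Whp (fun m n a => ∀ u v : Fin n → ℝ, vecNorm u ≤ 1 → vecNorm v ≤ 1 →
      |∑ k, G (dotp (a k) u) (dotp (a k) v)
        - m * ∫ x, G (dotp x u) (dotp x v) ∂(stdGaussianVec n)| ≤ ε * m) := by
  have h1 := whp_lip_one_side G hG B L hB hL hGB hGL ε hε
  have h2 := whp_lip_one_side (fun s t => - G s t) hG.neg B L hB hL
    (fun s t => by rw [abs_neg]; exact hGB s t)
    (fun s t s' t' => by
      have := hGL s t s' t'
      rw [abs_sub_comm] at this
      convert this using 2; ring) ε hε
  refine (h1.and h2).mono ?_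
  rintro m n a hm ⟨ha, hb⟩ u v hu hv
  have i1 := ha u v hu hv
  have i2 := hb u v hu hv
  rw [Finset.sum_neg_distrib, integral_neg] at i2
  rw [abs_le]
  constructor <;> linarith

/-- Clipping to `[-R, R]`. -/
noncomputable def clip (R s : ℝ) : ℝ := max (-R) (min R s)

lemma clip_lip (R s s' : ℝ) : |clip R s - clip R s'| ≤ |s - s'| := by
  unfold clip
  refine (abs_max_sub_max_le_max _ _ _ _).trans ?_
  rw [sub_self, abs_zero]
  refine max_le (abs_nonneg _) ((abs_min_sub_min_le_max _ _ _ _).trans ?_)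
  rw [sub_self, abs_zero]
  exact max_le (abs_nonneg _) le_rfl

lemma clip_abs (R s : ℝ) (hR : 0 ≤ R) : |clip R s| ≤ R := by
  unfold clip
  rw [abs_le]
  exact ⟨le_max_left _ _, max_le (by linarith) (min_le_left _ _)⟩

lemma clip_eq (R s : ℝ) (hs : |s| ≤ R) : clip R s = s := by
  unfold clip
  rw [abs_le] at hs
  rw [min_eq_right hs.2, max_eq_right hs.1]

lemma clip_abs_eq (R s : ℝ) (hR : 0 ≤ R) : |clip R s| = min |s| R := by
  unfold clip
  rcases le_total |s| R with h | h
  · rw [min_eq_left h]; rw [abs_le] at h; rw [min_eq_right h.2, max_eq_right h.1]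
  · rw [min_eq_right h]
    rcases le_abs.1 h with h' | h'
    · rw [min_eq_left h', max_eq_right (by linarith), abs_of_nonneg hR]
    · rw [min_eq_right (by linarith), max_eq_left (by linarith), abs_neg, abs_of_nonneg hR]

lemma measurable_clip (R : ℝ) : Measurable (clip R) := by
  unfold clip; fun_prop

/-- Uniform concentration for functions of quadratic growth. -/
lemma whp_unif (g : ℝ → ℝ → ℝ) (hg : Measurable (Function.uncurry g)) (B R1 : ℝ) (hB : 0 < B)
    (h1 : ∀ R, R1 ≤ R → ∀ s t, |g s t - g (clip R s) (clip R t)|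
      ≤ B * (max (s ^ 2 - R ^ 2) 0 + max (t ^ 2 - R ^ 2) 0))
    (h2 : ∀ R, 0 < R → ∃ L, 0 < L ∧ ∀ s t s' t', |s| ≤ R → |t| ≤ R → |s'| ≤ R → |t'| ≤ R →
      |g s t - g s' t'| ≤ L * (|s - s'| + |t - t'|)) (ε : ℝ) (hε : 0 < ε) :
    Whp (fun m n a => ∀ u v : Fin n → ℝ, vecNorm u ≤ 1 → vecNorm v ≤ 1 →
      |∑ k, g (dotp (a k) u) (dotp (a k) v)
        - m * ∫ x, g (dotp x u) (dotp x v) ∂(stdGaussianVec n)| ≤ ε * m) := by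
  obtain ⟨Ra, hRa, hta⟩ := whp_tail (ε / (5 * B)) (by positivity)
  obtain ⟨Rb, hRb, htb⟩ := exists_R (ε / (5 * B) / 4) (by positivity)
  set R := max (max Ra Rb) R1 with hR
  have iRa : Ra ≤ R := (le_max_left _ _).trans (le_max_left _ _)
  have iRb : Rb ≤ R := (le_max_right _ _).trans (le_max_left _ _)
  have iR1 : R1 ≤ R := le_max_right _ _
  have hRp : 0 < R := by linarith
  obtain ⟨L, hL, hLip⟩ := h2 R hRp
  set G : ℝ → ℝ → ℝ := fun s t => g (clip R s) (clip R t) with hGd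
  have hGm : Measurable (Function.uncurry G) :=
    hg.comp (((measurable_clip R).comp measurable_fst).prodMk
      ((measurable_clip R).comp measurable_snd))
  have hGL : ∀ s t s' t', |G s t - G s' t'| ≤ L * (|s - s'| + |t - t'|) := by
    intro s t s' t'
    refine (hLip _ _ _ _ (clip_abs R s hRp.le) (clip_abs R t hRp.le) (clip_abs R s' hRp.le)
      (clip_abs R t' hRp.le)).trans ?_
    have := clip_lip R s s'
    have := clip_lip R t t'
    gcongr
  have hGB : ∀ s t, |G s t| ≤ |g 0 0| + L * (R + R) := by
    intro s t
    have i1 := hLip (clip R s) (clip R t) 0 0 (clip_abs R s hRp.le) (clip_abs R t hRp.le)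
      (by simpa using hRp.le) (by simpa using hRp.le)
    rw [sub_zero, sub_zero] at i1
    have i2 := clip_abs R s hRp.le
    have i3 := clip_abs R t hRp.le
    have i4 : L * (|clip R s| + |clip R t|) ≤ L * (R + R) := by gcongr
    have i5 := abs_sub_abs_le_abs_sub (g (clip R s) (clip R t)) (g 0 0)
    simp only [hGd]
    linarith
  have key := whp_lip G hGm (|g 0 0| + L * (R + R)) L (by positivity) hL hGB hGL (ε / 5)
    (by positivity)
  refine (key.and (hta R iRa)).mono ?_
  rintro m n a hm ⟨ha, ht⟩ u v hu hv
  have hm0 : (0 : ℝ) < m := by exact_mod_cast hm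
  have k1 := ha u v hu hv
  have k2 := ht u hu
  have k3 := ht v hv
  have eB : B * (ε / (5 * B)) = ε / 5 := by field_simp
  have s1 : |∑ k, g (dotp (a k) u) (dotp (a k) v) - ∑ k, G (dotp (a k) u) (dotp (a k) v)|
      ≤ 2 * (ε / 5) * m := by
    rw [← Finset.sum_sub_distrib]
    refine (Finset.abs_sum_le_sum_abs _ _).trans
      ((Finset.sum_le_sum fun k _ => h1 R iR1 _ _).trans ?_)
    rw [← Finset.mul_sum, Finset.sum_add_distrib, ← eB]
    have := mul_le_mul_of_nonneg_left (add_le_add k2 k3) hB.le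
    refine this.trans (le_of_eq (by ring))
  obtain ⟨j1, j1'⟩ := tail_integrable R u hu
  obtain ⟨j2, j2'⟩ := tail_integrable R v hv
  have hR4 := htb R iRb
  have hGi : Integrable (fun x : Fin n → ℝ => G (dotp x u) (dotp x v)) (stdGaussianVec n) := by
    refine Integrable.of_bound (hGm.comp ((measurable_dotp u).prodMk
      (measurable_dotp v))).aestronglyMeasurable _
      (Filter.Eventually.of_forall fun a => hGB _ _)
  have hti : Integrable (fun x : Fin n → ℝ => B * (max (dotp x u ^ 2 - R ^ 2) 0
      + max (dotp x v ^ 2 - R ^ 2) 0)) (stdGaussianVec n) := (j1.add j2).const_mul B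
  have hdi : Integrable (fun x : Fin n → ℝ => g (dotp x u) (dotp x v) - G (dotp x u) (dotp x v))
      (stdGaussianVec n) := by
    refine hti.mono' (Measurable.aestronglyMeasurable ?_)
      (Filter.Eventually.of_forall fun x => h1 R iR1 _ _)
    exact (hg.comp ((measurable_dotp u).prodMk (measurable_dotp v))).sub
      (hGm.comp ((measurable_dotp u).prodMk (measurable_dotp v)))
  have hgi : Integrable (fun x : Fin n → ℝ => g (dotp x u) (dotp x v)) (stdGaussianVec n) := by
    have := hdi.add hGi
    refine this.congr (Filter.Eventually.of_forall fun x => ?_)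
    simp
  have s2 : |∫ x, g (dotp x u) (dotp x v) ∂(stdGaussianVec n)
      - ∫ x, G (dotp x u) (dotp x v) ∂(stdGaussianVec n)| ≤ 2 * (ε / 5) := by
    rw [← integral_sub hgi hGi]
    refine (abs_integral_le_integral_abs).trans
      ((integral_mono hdi.abs hti fun x => h1 R iR1 _ _).trans ?_)
    rw [integral_const_mul, integral_add j1 j2]
    have := mul_le_mul_of_nonneg_left (add_le_add j1' j2') hB.le
    have h5 := mul_le_mul_of_nonneg_left hR4 hB.le
    rw [mul_div_assoc', eB] at h5
    nlinarith
  have s2' := mul_le_mul_of_nonneg_left s2 hm0.le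
  rw [← abs_of_pos hm0, ← abs_mul, abs_of_pos hm0] at s2'
  rw [abs_le] at *
  constructor <;> nlinarith

lemma clip_sq (R t : ℝ) (hR : 0 ≤ R) : t ^ 2 - clip R t ^ 2 = max (t ^ 2 - R ^ 2) 0 := by
  rw [← sq_abs (clip R t), clip_abs_eq R t hR, ← sq_abs t]
  rcases le_total |t| R with h | h
  · rw [min_eq_left h, max_eq_right]
    · ring
    · have := pow_le_pow_left₀ (abs_nonneg t) h 2
      linarith
  · rw [min_eq_right h, max_eq_left]
    have := pow_le_pow_left₀ hR h 2
    linarith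

lemma whp_mul (f : ℝ → ℝ) (B L R1 : ℝ) (hB : 0 < B) (hL : 0 < L)
    (hfB : ∀ s, |f s| ≤ B) (hfL : ∀ s s', |f s - f s'| ≤ L * |s - s'|)
    (hfm : Measurable f)
    (hfc : ∀ R, R1 ≤ R → ∀ s, f (clip R s) = f s) (ε : ℝ) (hε : 0 < ε) :
    Whp (fun m n a => ∀ u v : Fin n → ℝ, vecNorm u ≤ 1 → vecNorm v ≤ 1 →
      |∑ k, f (dotp (a k) u) * dotp (a k) v ^ 2
        - (m : ℝ) * ∫ x, f (dotp x u) * dotp x v ^ 2 ∂(stdGaussianVec n)| ≤ ε * m) := by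
  refine whp_unif (fun s t => f s * t ^ 2) ?_ B (max R1 0) hB ?_ ?_ ε hε
  · exact (hfm.comp measurable_fst).mul (measurable_snd.pow_const 2)
  · intro R hR s t
    have hR0 : 0 ≤ R := (le_max_right _ _).trans hR
    show |f s * t ^ 2 - f (clip R s) * clip R t ^ 2| ≤ _
    rw [hfc R ((le_max_left _ _).trans hR), ← mul_sub, clip_sq R t hR0, abs_mul,
      abs_of_nonneg (le_max_right (t ^ 2 - R ^ 2) 0)]
    have h1 := hfB s
    have h2 := le_max_right (t ^ 2 - R ^ 2) 0
    have h3 := le_max_right (s ^ 2 - R ^ 2) 0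
    nlinarith [mul_le_mul_of_nonneg_right h1 h2, mul_nonneg hB.le h3]
  · intro R hR
    refine ⟨L * R ^ 2 + B * (2 * R), by positivity, fun s t s' t' hs ht hs' ht' => ?_⟩
    have e : f s * t ^ 2 - f s' * t' ^ 2 = (f s - f s') * t ^ 2 + f s' * ((t - t') * (t + t')) := by
      ring
    show |f s * t ^ 2 - f s' * t' ^ 2| ≤ _
    rw [e]
    have a1 : |(f s - f s') * t ^ 2| ≤ (L * |s - s'|) * R ^ 2 := by
      rw [abs_mul]
      refine mul_le_mul (hfL s s') ?_ (abs_nonneg _) (by positivity)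
      rw [abs_pow]
      exact pow_le_pow_left₀ (abs_nonneg _) ht 2
    have a2 : |f s' * ((t - t') * (t + t'))| ≤ B * (|t - t'| * (2 * R)) := by
      rw [abs_mul, abs_mul]
      refine mul_le_mul (hfB s') ?_ (by positivity) hB.le
      refine mul_le_mul_of_nonneg_left ?_ (abs_nonneg _)
      exact (abs_add_le t t').trans (by linarith)
    have a3 := abs_add_le ((f s - f s') * t ^ 2) (f s' * ((t - t') * (t + t')))
    have p1 : 0 ≤ L * R ^ 2 * |t - t'| := by positivity
    have p2 : 0 ≤ B * (2 * R) * |s - s'| := by positivity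
    nlinarith

lemma whp_abs (ε : ℝ) (hε : 0 < ε) :
    Whp (fun m n a => ∀ u v : Fin n → ℝ, vecNorm u ≤ 1 → vecNorm v ≤ 1 →
      |∑ k, |dotp (a k) u| * |dotp (a k) v|
        - (m : ℝ) * ∫ x, |dotp x u| * |dotp x v| ∂(stdGaussianVec n)| ≤ ε * m) := by
  refine whp_unif (fun s t => |s| * |t|) ?_ 1 0 one_pos ?_ ?_ ε hε
  · have : Measurable fun p : ℝ × ℝ => |p.1| * |p.2| := by fun_prop
    exact this
  · intro R hR s t
    show abs (|s| * |t| - |clip R s| * |clip R t|) ≤ _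
    rw [clip_abs_eq R t hR, clip_abs_eq R s hR, one_mul, ← sq_abs s, ← sq_abs t]
    generalize hS : |s| = S
    generalize hT : |t| = T
    have hS0 : 0 ≤ S := hS ▸ abs_nonneg s
    have hT0 : 0 ≤ T := hT ▸ abs_nonneg t
    have hm : min S R * min T R ≤ S * T :=
      mul_le_mul (min_le_left _ _) (min_le_left _ _) (le_min hT0 hR) hS0
    rw [abs_of_nonneg (by linarith)]
    have q1 := le_max_right (S ^ 2 - R ^ 2) 0
    have q2 := le_max_right (T ^ 2 - R ^ 2) 0
    have q3 := le_max_left (S ^ 2 - R ^ 2) 0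
    have q4 := le_max_left (T ^ 2 - R ^ 2) 0
    rcases le_total S R with h | h <;> rcases le_total T R with h' | h'
    · rw [min_eq_left h, min_eq_left h']; linarith
    · rw [min_eq_left h, min_eq_right h']
      nlinarith [mul_le_mul_of_nonneg_right h (sub_nonneg.2 h')]
    · rw [min_eq_right h, min_eq_left h']
      nlinarith [mul_le_mul_of_nonneg_right h' (sub_nonneg.2 h)]
    · rw [min_eq_right h, min_eq_right h']
      nlinarith [sq_nonneg (S - T)]
  · intro R hR
    refine ⟨R, hR, fun s t s' t' hs ht hs' ht' => ?_⟩
    have e : |s| * |t| - |s'| * |t'| = (|s| - |s'|) * |t| + |s'| * (|t| - |t'|) := by ring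
    show abs (|s| * |t| - |s'| * |t'|) ≤ _
    rw [e]
    refine (abs_add_le _ _).trans ?_
    rw [abs_mul, abs_mul, abs_abs, abs_abs]
    have a1 := abs_abs_sub_abs_le_abs_sub s s'
    have a2 := abs_abs_sub_abs_le_abs_sub t t'
    have a3 := mul_le_mul a1 ht (abs_nonneg _) (abs_nonneg _)
    have a4 := mul_le_mul hs' a2 (abs_nonneg _) hR.le
    linarith

/-- the ramp -/
noncomputable def ramp (a b s : ℝ) : ℝ := max 0 (min 1 ((b - |s|) / (b - a)))

lemma ramp_nonneg (a b s : ℝ) : 0 ≤ ramp a b s := le_max_left _ _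

lemma ramp_le_one (a b s : ℝ) : ramp a b s ≤ 1 := max_le zero_le_one (min_le_left _ _)

lemma ramp_one (a b s : ℝ) (hab : a < b) (hs : |s| ≤ a) : ramp a b s = 1 := by
  unfold ramp
  have : 1 ≤ (b - |s|) / (b - a) := by rw [le_div_iff₀ (by linarith)]; linarith
  rw [min_eq_left this]; simp

lemma ramp_zero (a b s : ℝ) (hab : a < b) (hs : b ≤ |s|) : ramp a b s = 0 := by
  unfold ramp
  have : (b - |s|) / (b - a) ≤ 0 := div_nonpos_of_nonpos_of_nonneg (by linarith) (by linarith)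
  rw [min_eq_right (by linarith), max_eq_left this]

lemma ramp_lip (a b s s' : ℝ) (hab : a < b) :
    |ramp a b s - ramp a b s'| ≤ 1 / (b - a) * |s - s'| := by
  unfold ramp
  have h1 := abs_max_sub_max_le_abs (min 1 ((b - |s|) / (b - a))) (min 1 ((b - |s'|) / (b - a))) 0
  rw [max_comm _ 0, max_comm _ 0] at h1
  refine h1.trans ?_
  have h2 := abs_min_sub_min_le_max 1 ((b - |s|) / (b - a)) 1 ((b - |s'|) / (b - a))
  refine h2.trans ?_
  rw [sub_self, abs_zero, max_eq_right (abs_nonneg _), ← sub_div, abs_div,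
    abs_of_pos (show 0 < b - a by linarith), div_mul_eq_mul_div, one_mul]
  have := abs_abs_sub_abs_le_abs_sub s' s
  have e : b - |s| - (b - |s'|) = |s'| - |s| := by ring
  rw [e, abs_sub_comm s s']
  have : 0 < b - a := by linarith
  gcongr

lemma ramp_clip (a b R s : ℝ) (hab : a < b) (hb : 0 ≤ b) (hR : b ≤ R) :
    ramp a b (clip R s) = ramp a b s := by
  rcases le_total |s| R with h | h
  · rw [clip_eq R s h]
  · rw [ramp_zero a b s hab (hR.trans h), ramp_zero a b _ hab]
    rw [clip_abs_eq R s (hb.trans hR), min_eq_right h]; exact hR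

lemma measurable_ramp (a b : ℝ) : Measurable (ramp a b) := by
  unfold ramp; fun_prop

/-- truncated square -/
noncomputable def phi (a b s : ℝ) : ℝ := clip b s ^ 2 * ramp a b s

lemma phi_eq (a b s : ℝ) (hab : a < b) : phi a b s = s ^ 2 * ramp a b s := by
  unfold phi
  rcases le_total |s| b with h | h
  · rw [clip_eq b s h]
  · rw [ramp_zero a b s hab h]; simp

lemma whp_phi (a b : ℝ) (hab : a < b) (hb : 0 < b) (ε : ℝ) (hε : 0 < ε) :
    Whp (fun m n A => ∀ u v : Fin n → ℝ, vecNorm u ≤ 1 → vecNorm v ≤ 1 →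
      |∑ k, phi a b (dotp (A k) u) * dotp (A k) v ^ 2
        - (m : ℝ) * ∫ x, phi a b (dotp x u) * dotp x v ^ 2 ∂(stdGaussianVec n)| ≤ ε * m) := by
  have hd : 0 < b - a := by linarith
  have hc : ∀ s, clip b s ^ 2 ≤ b ^ 2 := fun s => by
    rw [← sq_abs]; exact pow_le_pow_left₀ (abs_nonneg _) (clip_abs b s hb.le) 2
  refine whp_mul (phi a b) (b ^ 2) (2 * b + b ^ 2 * (1 / (b - a))) b (by positivity) (by positivity)
    ?_ ?_ ?_ ?_ ε hε
  · intro s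
    unfold phi
    rw [abs_of_nonneg (mul_nonneg (sq_nonneg _) (ramp_nonneg _ _ _))]
    have := mul_le_mul (hc s) (ramp_le_one a b s) (ramp_nonneg _ _ _) (by positivity)
    linarith
  · intro s s'
    unfold phi
    have e : clip b s ^ 2 * ramp a b s - clip b s' ^ 2 * ramp a b s'
      = ((clip b s - clip b s') * (clip b s + clip b s')) * ramp a b s
        + clip b s' ^ 2 * (ramp a b s - ramp a b s') := by ring
    rw [e]
    refine (abs_add_le _ _).trans ?_
    rw [abs_mul, abs_mul, abs_mul, abs_of_nonneg (ramp_nonneg a b s), abs_of_nonneg (sq_nonneg (clip b s'))]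
    have a1 := clip_lip b s s'
    have a2 : |clip b s + clip b s'| ≤ 2 * b :=
      (abs_add_le _ _).trans (by linarith [clip_abs b s hb.le, clip_abs b s' hb.le])
    have a3 := mul_le_mul a1 a2 (abs_nonneg _) (abs_nonneg _)
    have a4 := mul_le_mul a3 (ramp_le_one a b s) (ramp_nonneg _ _ _) (by positivity)
    have a5 := mul_le_mul (hc s') (ramp_lip a b s s' hab) (abs_nonneg _) (by positivity)
    linarith
  · exact ((measurable_clip b).pow_const 2).mul (measurable_ramp a b)
  · intro R hR s
    rw [phi_eq _ _ _ hab, phi_eq _ _ _ hab, ramp_clip a b R s hab hb.le hR]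
    rcases le_total |s| R with h | h
    · rw [clip_eq R s h]
    · rw [ramp_zero a b s hab (hR.trans h)]; simp

lemma whp_psi (a b : ℝ) (hab : a < b) (hb : 0 < b) (ε : ℝ) (hε : 0 < ε) :
    Whp (fun m n A => ∀ u v : Fin n → ℝ, vecNorm u ≤ 1 → vecNorm v ≤ 1 →
      |∑ k, (1 - ramp a b (dotp (A k) u)) * dotp (A k) v ^ 2
        - (m : ℝ) * ∫ x, (1 - ramp a b (dotp x u)) * dotp x v ^ 2 ∂(stdGaussianVec n)| ≤ ε * m) := by
  have hd : 0 < b - a := by linarith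
  refine whp_mul (fun s => 1 - ramp a b s) 1 (1 / (b - a)) b one_pos (by positivity)
    ?_ ?_ ?_ ?_ ε hε
  · intro s
    rw [abs_le]; constructor <;> linarith [ramp_nonneg a b s, ramp_le_one a b s]
  · intro s s'
    have := ramp_lip a b s s' hab
    rw [abs_sub_comm] at this
    have e : 1 - ramp a b s - (1 - ramp a b s') = ramp a b s' - ramp a b s := by ring
    show |1 - ramp a b s - (1 - ramp a b s')| ≤ _
    rw [e]; exact this
  · exact (measurable_const).sub (measurable_ramp a b)
  · intro R hR s
    show 1 - ramp a b (clip R s) = _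
    rw [ramp_clip a b R s hab hb.le hR]

lemma whp_one (ε : ℝ) (hε : 0 < ε) :
    Whp (fun m n A => ∀ v : Fin n → ℝ, vecNorm v ≤ 1 →
      |∑ k, dotp (A k) v ^ 2
        - (m : ℝ) * ∫ x, dotp x v ^ 2 ∂(stdGaussianVec n)| ≤ ε * m) := by
  have := whp_mul (fun _ => 1) 1 1 0 one_pos one_pos (by simp) (by intro s s'; simp)
    measurable_const (by simp) ε hε
  refine this.mono fun m n a hm h v hv => ?_
  simpa using h v v hv hv

lemma gauss_pow_integrable (k : ℕ) : Integrable (fun x : ℝ => x ^ k) (gaussianReal 0 1) := by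
  have h : MemLp id (k : ENNReal) (gaussianReal 0 1) := by
    have := memLp_id_gaussianReal (μ := 0) (v := 1) (k : NNReal)
    simpa using this
  have h2 := h.integrable_norm_pow'
  refine h2.mono' (by fun_prop) (Filter.Eventually.of_forall fun x => ?_)
  simp

lemma gauss_mean : ∫ x, x ∂(gaussianReal 0 1) = 0 := integral_id_gaussianReal

lemma gauss_second : ∫ x, x ^ 2 ∂(gaussianReal 0 1) = 1 := by
  have h := variance_id_gaussianReal (μ := 0) (v := 1)
  rw [variance_eq_integral aemeasurable_id] at h
  simpa [integral_id_gaussianReal] using h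

lemma exp_mul {n : ℕ} (f : ℝ → ℝ) (hf : Measurable f) (B : ℝ) (hB : ∀ s, |f s| ≤ B)
    (u v : Fin n → ℝ) (hu : dotp u u = 1) (hv : dotp v v = 1) :
    ∫ x, f (dotp x u) * dotp x v ^ 2 ∂(stdGaussianVec n)
      = dotp u v ^ 2 * ∫ x, f x * x ^ 2 ∂(gaussianReal 0 1)
        + (1 - dotp u v ^ 2) * ∫ x, f x ∂(gaussianReal 0 1) := by
  have hr : dotp u v ^ 2 ≤ 1 := by
    have := dotp_sq_le u v
    rw [vecNorm_sq, vecNorm_sq, hu, hv] at this; linarith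
  set r := dotp u v with hrd
  set b := Real.sqrt (1 - r ^ 2) with hb
  have hb2 : b ^ 2 = 1 - r ^ 2 := Real.sq_sqrt (by linarith)
  have hm : Measurable (fun p : ℝ × ℝ => f p.1 * p.2 ^ 2) :=
    (hf.comp measurable_fst).mul (measurable_snd.pow_const 2)
  have key := gauss_integral_pair u v 1 0 r b (by rw [hu]; ring) (by rw [hv, hb2]; ring)
    (by rw [← hrd]; ring) (fun p : ℝ × ℝ => f p.1 * p.2 ^ 2) hm
  simp only at key
  rw [key]
  have hfk : ∀ k : ℕ, Integrable (fun x => f x * x ^ k) (gaussianReal 0 1) := fun k =>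
    (gauss_pow_integrable k).bdd_mul hf.aestronglyMeasurable
      (Filter.Eventually.of_forall fun x => by rw [Real.norm_eq_abs]; exact hB x)
  have e : ∀ p : ℝ × ℝ, f (1 * p.1 + 0 * p.2) * (r * p.1 + b * p.2) ^ 2
      = r ^ 2 * ((f p.1 * p.1 ^ 2) * 1) + 2 * r * b * ((f p.1 * p.1 ^ 1) * p.2 ^ 1)
        + b ^ 2 * ((f p.1 * p.1 ^ 0) * p.2 ^ 2) := by
    intro p; simp only [one_mul, zero_mul, add_zero, pow_zero, pow_one, mul_one]; ring
  simp_rw [e]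
  have i1 : Integrable (fun p : ℝ × ℝ => (f p.1 * p.1 ^ 2) * (1 : ℝ))
      ((gaussianReal 0 1).prod (gaussianReal 0 1)) :=
    (hfk 2).mul_prod (integrable_const (1 : ℝ))
  have i2 : Integrable (fun p : ℝ × ℝ => (f p.1 * p.1 ^ 1) * p.2 ^ 1)
      ((gaussianReal 0 1).prod (gaussianReal 0 1)) :=
    (hfk 1).mul_prod (gauss_pow_integrable 1)
  have i3 : Integrable (fun p : ℝ × ℝ => (f p.1 * p.1 ^ 0) * p.2 ^ 2)
      ((gaussianReal 0 1).prod (gaussianReal 0 1)) :=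
    (hfk 0).mul_prod (gauss_pow_integrable 2)
  have i12 : Integrable (fun p : ℝ × ℝ => r ^ 2 * ((f p.1 * p.1 ^ 2) * 1)
      + 2 * r * b * ((f p.1 * p.1 ^ 1) * p.2 ^ 1)) ((gaussianReal 0 1).prod (gaussianReal 0 1)) :=
    (i1.const_mul _).add (i2.const_mul _)
  rw [integral_add i12 (i3.const_mul _),
    integral_add (i1.const_mul _) (i2.const_mul _), integral_const_mul, integral_const_mul,
    integral_const_mul]
  have j1 := integral_prod_mul (μ := gaussianReal 0 1) (ν := gaussianReal 0 1)
    (fun x : ℝ => f x * x ^ 2) (fun _ : ℝ => (1 : ℝ))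
  have j2 := integral_prod_mul (μ := gaussianReal 0 1) (ν := gaussianReal 0 1)
    (fun x : ℝ => f x * x ^ 1) (fun x : ℝ => x ^ 1)
  have j3 := integral_prod_mul (μ := gaussianReal 0 1) (ν := gaussianReal 0 1)
    (fun x : ℝ => f x * x ^ 0) (fun x : ℝ => x ^ 2)
  rw [j1, j2, j3, gauss_second, hb2]
  simp [gauss_mean]

lemma exp_one {n : ℕ} (v : Fin n → ℝ) (hv : dotp v v = 1) :
    ∫ x, dotp x v ^ 2 ∂(stdGaussianVec n) = 1 := by
  have := exp_mul (fun _ => 1) measurable_const 1 (by simp) v v hv hv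
  simpa [hv, gauss_second] using this

lemma pdf_eq (x : ℝ) : gaussianPDFReal 0 1 x = (Real.sqrt (2 * Real.pi))⁻¹ * Real.exp (-x ^ 2 / 2) := by
  simp [gaussianPDFReal]

lemma tail_deriv (x : ℝ) (hx : 0 < x) :
    HasDerivAt (fun y : ℝ => -((y + 1 / y) * Real.exp (-y ^ 2 / 2)))
      ((x ^ 2 + 1 / x ^ 2) * Real.exp (-x ^ 2 / 2)) x := by
  have h1 : HasDerivAt (fun y : ℝ => Real.exp (-y ^ 2 / 2)) (Real.exp (-x ^ 2 / 2) * (-x)) x := by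
    have : HasDerivAt (fun y : ℝ => -y ^ 2 / 2) (-x) x := by
      have h := ((hasDerivAt_pow 2 x).neg.div_const 2)
      exact HasDerivAt.congr_deriv h (by norm_num; ring)
    exact this.exp
  have h2 : HasDerivAt (fun y : ℝ => y + 1 / y) (1 - 1 / x ^ 2) x := by
    have h := (hasDerivAt_id' x).add ((hasDerivAt_const x (1 : ℝ)).div (hasDerivAt_id' x) hx.ne')
    exact HasDerivAt.congr_deriv h (by ring)
  refine HasDerivAt.congr_deriv (h2.mul h1).neg ?_
  field_simp; ring

lemma tail_tendsto : Filter.Tendsto (fun y : ℝ => -((y + 1 / y) * Real.exp (-y ^ 2 / 2)))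
    Filter.atTop (nhds 0) := by
  have h4 : Filter.Tendsto (fun y : ℝ => -(4 / y)) Filter.atTop (nhds 0) := by
    have := (tendsto_const_nhds (x := (4 : ℝ))).div_atTop Filter.tendsto_id
    simpa using this.neg
  refine tendsto_of_tendsto_of_tendsto_of_le_of_le' h4 tendsto_const_nhds ?_ ?_
  · filter_upwards [Filter.eventually_ge_atTop 1] with y hy
    have hy0 : 0 < y := by linarith
    have h1 : Real.exp (-y ^ 2 / 2) ≤ 2 / y ^ 2 := by
      have e : -y ^ 2 / 2 = -(y ^ 2 / 2) := by ring
      rw [e, Real.exp_neg, inv_le_comm₀ (Real.exp_pos _) (by positivity), inv_div]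
      linarith [Real.add_one_le_exp (y ^ 2 / 2)]
    have h2 : y + 1 / y ≤ 2 * y := by
      have : 1 / y ≤ 1 := by rw [div_le_one hy0]; exact hy
      linarith
    have := mul_le_mul h2 h1 (Real.exp_pos _).le (by positivity)
    have e : 2 * y * (2 / y ^ 2) = 4 / y := by field_simp; norm_num
    linarith
  · filter_upwards [Filter.eventually_ge_atTop 1] with y hy
    have hy0 : 0 < y := by linarith
    have : 0 ≤ (y + 1 / y) * Real.exp (-y ^ 2 / 2) := by positivity
    linarith

lemma tail_Ioi (T : ℝ) (hT : 0 < T) :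
    IntegrableOn (fun x : ℝ => (x ^ 2 + 1 / x ^ 2) * Real.exp (-x ^ 2 / 2)) (Set.Ioi T) ∧
    ∫ x in Set.Ioi T, (x ^ 2 + 1 / x ^ 2) * Real.exp (-x ^ 2 / 2)
      = (T + 1 / T) * Real.exp (-T ^ 2 / 2) := by
  have hd : ∀ x ∈ Set.Ici T, HasDerivAt (fun y : ℝ => -((y + 1 / y) * Real.exp (-y ^ 2 / 2)))
      ((x ^ 2 + 1 / x ^ 2) * Real.exp (-x ^ 2 / 2)) x := fun x hx =>
    tail_deriv x (lt_of_lt_of_le hT hx)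
  have hp : ∀ x ∈ Set.Ioi T, 0 ≤ (x ^ 2 + 1 / x ^ 2) * Real.exp (-x ^ 2 / 2) := fun x hx => by
    positivity
  refine ⟨integrableOn_Ioi_deriv_of_nonneg' hd hp tail_tendsto, ?_⟩
  rw [integral_Ioi_of_hasDerivAt_of_nonneg' hd hp tail_tendsto]; ring

lemma tail_gauss (f : ℝ → ℝ) (hf : Measurable f) (T : ℝ) (hT : 0 < T) (h0 : ∀ x, 0 ≤ f x)
    (h1 : ∀ x, f x ≤ 1) (h2 : ∀ x, |x| ≤ T → f x = 0) :
    ∫ x, f x * x ^ 2 ∂(gaussianReal 0 1) ≤ 0.8 * (T + 1 / T) * Real.exp (-T ^ 2 / 2) := by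
  set H : ℝ → ℝ := fun y => (Set.Ioi T).indicator
    (fun x => (Real.sqrt (2 * Real.pi))⁻¹ * ((x ^ 2 + 1 / x ^ 2) * Real.exp (-x ^ 2 / 2))) y with hH
  obtain ⟨hi, hv⟩ := tail_Ioi T hT
  have hHi : Integrable H := by
    rw [hH, integrable_indicator_iff measurableSet_Ioi]
    exact hi.const_mul _
  have hHi0 : IntegrableOn H (Set.Ioi 0) := hHi.integrableOn
  have hHa : Integrable (fun x => H |x|) := by
    have e1 : IntegrableOn (fun x => H |x|) (Set.Ioi 0) :=
      hHi0.congr_fun (fun x hx => by rw [abs_of_pos hx]) measurableSet_Ioi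
    have e2 : IntegrableOn (fun x => H |x|) (Set.Iic 0) := by
      have : IntegrableOn (fun x => H (-x)) (Set.Iic 0) := hHi.comp_neg.integrableOn
      exact this.congr_fun (fun x hx => by rw [abs_of_nonpos hx]) measurableSet_Iic
    have := e2.union e1
    rwa [Set.Iic_union_Ioi, integrableOn_univ] at this
  rw [integral_gaussianReal_eq_integral_smul (by norm_num)]
  have hle : ∀ x, gaussianPDFReal 0 1 x • (f x * x ^ 2) ≤ H |x| := by
    intro x
    rcases le_or_gt |x| T with h | h
    · rw [h2 x h]; simp only [zero_mul, smul_zero, hH]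
      rw [Set.indicator_of_notMem (by simpa using h)]
    · simp only [hH]
      rw [Set.indicator_of_mem (by simpa using h), pdf_eq, smul_eq_mul, sq_abs, mul_assoc]
      have p : 0 ≤ 1 / x ^ 2 := by positivity
      have q : f x * x ^ 2 ≤ x ^ 2 := by nlinarith [h1 x, sq_nonneg x]
      refine mul_le_mul_of_nonneg_left ?_ (by positivity)
      rw [mul_comm]
      refine mul_le_mul_of_nonneg_right ?_ (Real.exp_pos _).le
      linarith
  have hge : ∀ x, 0 ≤ gaussianPDFReal 0 1 x • (f x * x ^ 2) := fun x => by
    have := gaussianPDFReal_nonneg 0 1 x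
    have := h0 x
    rw [smul_eq_mul]; positivity
  refine (integral_mono_of_nonneg (Filter.Eventually.of_forall hge) hHa
    (Filter.Eventually.of_forall hle)).trans ?_
  rw [integral_comp_abs (f := H), hH, setIntegral_indicator measurableSet_Ioi]
  have e : Set.Ioi (0 : ℝ) ∩ Set.Ioi T = Set.Ioi T := by
    rw [Set.inter_eq_right]; exact Set.Ioi_subset_Ioi hT.le
  rw [e, integral_const_mul, hv, ← mul_assoc, ← mul_assoc, mul_assoc _ _ (Real.exp _), mul_assoc 0.8]
  refine mul_le_mul_of_nonneg_right ?_ (by positivity)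
  have hs : (2.5 : ℝ) ≤ Real.sqrt (2 * Real.pi) := by
    apply Real.le_sqrt_of_sq_le
    have := Real.pi_gt_d2
    norm_num at this ⊢; linarith
  have : (Real.sqrt (2 * Real.pi))⁻¹ ≤ (2.5 : ℝ)⁻¹ := inv_anti₀ (by norm_num) hs
  norm_num at this ⊢; linarith

lemma tail_gauss0 (f : ℝ → ℝ) (hf : Measurable f) (T : ℝ) (hT : 0 < T) (h0 : ∀ x, 0 ≤ f x)
    (h1 : ∀ x, f x ≤ 1) (h2 : ∀ x, |x| ≤ T → f x = 0) :
    ∫ x, f x ∂(gaussianReal 0 1) ≤ 0.8 * (T + 1 / T) * Real.exp (-T ^ 2 / 2) / T ^ 2 := by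
  rw [le_div_iff₀ (by positivity)]
  refine le_trans ?_ (tail_gauss f hf T hT h0 h1 h2)
  rw [← integral_mul_const]
  refine integral_mono_of_nonneg (Filter.Eventually.of_forall fun x => ?_) ?_
    (Filter.Eventually.of_forall fun x => ?_)
  · have := h0 x; positivity
  · exact (gauss_pow_integrable 2).bdd_mul (c := 1) hf.aestronglyMeasurable
      (Filter.Eventually.of_forall fun x => by
        rw [Real.norm_eq_abs, abs_of_nonneg (h0 x)]; exact h1 x)
  · rcases le_or_gt |x| T with h | h
    · simp [h2 x h]
    · refine mul_le_mul_of_nonneg_left ?_ (h0 x)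
      rw [← sq_abs x]
      exact pow_le_pow_left₀ hT.le h.le 2

lemma exp_psi {n : ℕ} (T b : ℝ) (hT : 0 < T) (hTb : T < b) (u v : Fin n → ℝ)
    (hu : dotp u u = 1) (hv : dotp v v = 1) :
    ∫ x, (1 - ramp T b (dotp x u)) * dotp x v ^ 2 ∂(stdGaussianVec n)
      ≤ max 1 (1 / T ^ 2) * (0.8 * (T + 1 / T) * Real.exp (-T ^ 2 / 2)) := by
  have hm : Measurable (fun s => 1 - ramp T b s) := measurable_const.sub (measurable_ramp T b)
  have k0 : ∀ x, 0 ≤ 1 - ramp T b x := fun x => by linarith [ramp_le_one T b x]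
  have k1 : ∀ x, 1 - ramp T b x ≤ 1 := fun x => by linarith [ramp_nonneg T b x]
  have k2 : ∀ x, |x| ≤ T → 1 - ramp T b x = 0 := fun x hx => by rw [ramp_one T b x hTb hx]; simp
  have hr : dotp u v ^ 2 ≤ 1 := by
    have := dotp_sq_le u v
    rw [vecNorm_sq, vecNorm_sq, hu, hv] at this; linarith
  rw [exp_mul (fun s => 1 - ramp T b s) hm 1 (fun s => by
    rw [abs_of_nonneg (k0 s)]; exact k1 s) u v hu hv]
  have t1 := tail_gauss _ hm T hT k0 k1 k2
  have t2 := tail_gauss0 _ hm T hT k0 k1 k2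
  set Q := 0.8 * (T + 1 / T) * Real.exp (-T ^ 2 / 2) with hQ
  have hQ0 : 0 ≤ Q := by positivity
  have m1 : Q ≤ max 1 (1 / T ^ 2) * Q := by nlinarith [le_max_left 1 (1 / T ^ 2)]
  have m2 : Q / T ^ 2 ≤ max 1 (1 / T ^ 2) * Q := by
    have := mul_le_mul_of_nonneg_right (le_max_right 1 (1 / T ^ 2)) hQ0
    rw [one_div_mul_eq_div] at this; exact this
  have := mul_le_mul_of_nonneg_left (t1.trans m1) (sq_nonneg (dotp u v))
  have := mul_le_mul_of_nonneg_left (t2.trans m2) (show 0 ≤ 1 - dotp u v ^ 2 by linarith)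
  linarith

lemma exp_psi_x {n : ℕ} (τ : ℝ) (hτ : 1 ≤ τ) (u v : Fin n → ℝ)
    (hu : dotp u u = 1) (hv : dotp v v = 1) :
    ∫ x, (1 - ramp (0.9 * τ) (0.97 * τ) (dotp x u)) * dotp x v ^ 2 ∂(stdGaussianVec n)
      ≤ 4 * τ * Real.exp (-(0.39 * τ ^ 2)) := by
  refine (exp_psi _ _ (by linarith) (by linarith) u v hu hv).trans ?_
  have h1 : max 1 (1 / (0.9 * τ) ^ 2) ≤ 1.25 := by
    refine max_le (by norm_num) ?_
    rw [div_le_iff₀ (by positivity)]; nlinarith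
  have h2 : 1 / (0.9 * τ) ≤ 1.2 * τ := by
    rw [div_le_iff₀ (by positivity)]; nlinarith
  have h3 : Real.exp (-(0.9 * τ) ^ 2 / 2) ≤ Real.exp (-(0.39 * τ ^ 2)) := by
    apply Real.exp_le_exp.2; nlinarith
  have h4 : 0.8 * (0.9 * τ + 1 / (0.9 * τ)) ≤ 2 * τ := by linarith
  have h5 := mul_le_mul h4 h3 (Real.exp_pos _).le (by positivity)
  have h6 := mul_le_mul h1 h5 (by positivity) (by norm_num)
  refine h6.trans ?_
  have : 0 ≤ τ * Real.exp (-(0.39 * τ ^ 2)) := by positivity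
  linarith

lemma exp_psi_h {n : ℕ} (τ : ℝ) (hτ : 1 ≤ τ) (u v : Fin n → ℝ)
    (hu : dotp u u = 1) (hv : dotp v v = 1) :
    ∫ x, (1 - ramp (1.14 * τ) (1.2 * τ) (dotp x u)) * dotp x v ^ 2 ∂(stdGaussianVec n)
      ≤ 6 * τ * Real.exp (-(0.64 * τ ^ 2)) := by
  refine (exp_psi _ _ (by linarith) (by linarith) u v hu hv).trans ?_
  have h1 : max 1 (1 / (1.14 * τ) ^ 2) ≤ 1.25 := by
    refine max_le (by norm_num) ?_
    rw [div_le_iff₀ (by positivity)]; nlinarith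
  have h2 : 1 / (1.14 * τ) ≤ 1.2 * τ := by
    rw [div_le_iff₀ (by positivity)]; nlinarith
  have h3 : Real.exp (-(1.14 * τ) ^ 2 / 2) ≤ Real.exp (-(0.64 * τ ^ 2)) := by
    apply Real.exp_le_exp.2; nlinarith
  have h4 : 0.8 * (1.14 * τ + 1 / (1.14 * τ)) ≤ 2 * τ := by linarith
  have h5 := mul_le_mul h4 h3 (Real.exp_pos _).le (by positivity)
  have h6 := mul_le_mul h1 h5 (by positivity) (by norm_num)
  refine h6.trans ?_
  have : 0 ≤ τ * Real.exp (-(0.64 * τ ^ 2)) := by positivity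
  linarith

lemma gauss_le_volume : gaussianReal 0 1 ≤ volume := by
  rw [gaussianReal_of_var_ne_zero 0 one_ne_zero]
  conv_rhs => rw [← withDensity_one (μ := (volume : Measure ℝ))]
  refine withDensity_mono (Filter.Eventually.of_forall fun x => ?_)
  unfold gaussianPDF
  rw [pdf_eq]
  refine ENNReal.ofReal_le_one.2 ?_
  have h1 : (1 : ℝ) ≤ Real.sqrt (2 * Real.pi) := by
    apply Real.le_sqrt_of_sq_le
    have := Real.pi_gt_three; linarith
  have h2 := inv_le_one_of_one_le₀ h1
  have h3 : Real.exp (-x ^ 2 / 2) ≤ 1 := Real.exp_le_one_iff.2 (by nlinarith [sq_nonneg x])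
  have h4 : 0 ≤ (Real.sqrt (2 * Real.pi))⁻¹ := by positivity
  nlinarith [Real.exp_pos (-x ^ 2 / 2)]

lemma band_measure (a b : ℝ) (hab : a ≤ b) :
    (gaussianReal 0 1).real {s | a ≤ |s| ∧ |s| ≤ b} ≤ 2 * (b - a) := by
  have hsub : {s : ℝ | a ≤ |s| ∧ |s| ≤ b} ⊆ Set.Icc a b ∪ Set.Icc (-b) (-a) := by
    rintro s ⟨h1, h2⟩
    rcases abs_cases s with ⟨h, _⟩ | ⟨h, _⟩
    · left; exact ⟨by linarith, by linarith⟩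
    · right; exact ⟨by linarith, by linarith⟩
  have : gaussianReal 0 1 {s | a ≤ |s| ∧ |s| ≤ b} ≤ ENNReal.ofReal (2 * (b - a)) := by
    calc gaussianReal 0 1 {s | a ≤ |s| ∧ |s| ≤ b}
        ≤ volume {s | a ≤ |s| ∧ |s| ≤ b} := gauss_le_volume _
      _ ≤ volume (Set.Icc a b ∪ Set.Icc (-b) (-a)) := measure_mono hsub
      _ ≤ volume (Set.Icc a b) + volume (Set.Icc (-b) (-a)) := measure_union_le _ _
      _ = ENNReal.ofReal (2 * (b - a)) := by
        rw [Real.volume_Icc, Real.volume_Icc, ← ENNReal.ofReal_add (by linarith) (by linarith)]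
        congr 1; ring
  exact ENNReal.toReal_le_of_le_ofReal (by linarith) this

lemma phi_band (a b τ : ℝ) (ha : 0 ≤ a) (hab : a < b) (h1 : a ≤ τ) (h2 : τ ≤ b) (k : ℕ) :
    |∫ x, phi a b x * x ^ k ∂(gaussianReal 0 1)
      - ∫ x in {s : ℝ | |s| ≤ τ}, x ^ (2 + k) ∂(gaussianReal 0 1)| ≤ b ^ (2 + k) * (2 * (b - a)) := by
  have hb : 0 < b := by linarith
  have hmS : MeasurableSet {s : ℝ | |s| ≤ τ} := measurableSet_le (by fun_prop) (by fun_prop)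
  have hmB : MeasurableSet {s : ℝ | a ≤ |s| ∧ |s| ≤ b} := by
    have hA : MeasurableSet {s : ℝ | a ≤ |s|} := measurableSet_le (by fun_prop) (by fun_prop)
    have hB : MeasurableSet {s : ℝ | |s| ≤ b} := measurableSet_le (by fun_prop) (by fun_prop)
    exact hA.inter hB
  have hmp : Measurable (phi a b) := ((measurable_clip b).pow_const 2).mul (measurable_ramp a b)
  have i1 : Integrable (fun x => phi a b x * x ^ k) (gaussianReal 0 1) := by
    refine (gauss_pow_integrable k).bdd_mul (c := b ^ 2) hmp.aestronglyMeasurable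
      (Filter.Eventually.of_forall fun x => ?_)
    unfold phi
    rw [Real.norm_eq_abs, abs_of_nonneg (mul_nonneg (sq_nonneg _) (ramp_nonneg _ _ _))]
    have hc : clip b x ^ 2 ≤ b ^ 2 := by
      rw [← sq_abs]; exact pow_le_pow_left₀ (abs_nonneg _) (clip_abs b x hb.le) 2
    have := mul_le_mul hc (ramp_le_one a b x) (ramp_nonneg _ _ _) (by positivity)
    linarith
  have i2 : Integrable (({s : ℝ | |s| ≤ τ}).indicator fun x => x ^ (2 + k)) (gaussianReal 0 1) :=
    (gauss_pow_integrable (2 + k)).indicator hmS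
  rw [← integral_indicator hmS, ← integral_sub i1 i2]
  refine (abs_integral_le_integral_abs).trans ?_
  have i3 : Integrable (({s : ℝ | a ≤ |s| ∧ |s| ≤ b}).indicator fun _ => b ^ (2 + k))
      (gaussianReal 0 1) := (integrable_const _).indicator hmB
  calc ∫ x, |phi a b x * x ^ k - ({s : ℝ | |s| ≤ τ}).indicator (fun x => x ^ (2 + k)) x|
        ∂(gaussianReal 0 1)
      ≤ ∫ x, ({s : ℝ | a ≤ |s| ∧ |s| ≤ b}).indicator (fun _ => b ^ (2 + k)) x
        ∂(gaussianReal 0 1) := by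
        refine integral_mono (i1.sub i2).abs i3 fun x => ?_
        simp only [Set.indicator_apply, Set.mem_ofPred_eq]
        rw [phi_eq a b x hab]
        rcases lt_or_ge |x| a with h | h
        · rw [ramp_one a b x hab h.le, if_pos (by linarith), if_neg (by intro h'; linarith [h'.1]),
            pow_add]
          simp
        · rcases lt_or_ge b |x| with h' | h'
          · rw [ramp_zero a b x hab h'.le, if_neg (by linarith), if_neg (by intro h''; linarith [h''.2])]
            simp
          · rw [if_pos (show a ≤ |x| ∧ |x| ≤ b from ⟨h, h'⟩)]
            have hx : |x ^ (2 + k)| ≤ b ^ (2 + k) := by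
              rw [abs_pow]; exact pow_le_pow_left₀ (abs_nonneg _) h' _
            have e : x ^ 2 * ramp a b x * x ^ k = ramp a b x * x ^ (2 + k) := by rw [pow_add]; ring
            rw [e]
            have r0 := ramp_nonneg a b x
            have r1 := ramp_le_one a b x
            split_ifs
            · have e2 : ramp a b x * x ^ (2 + k) - x ^ (2 + k) = (ramp a b x - 1) * x ^ (2 + k) := by
                ring
              rw [e2, abs_mul]
              have : |ramp a b x - 1| ≤ 1 := by rw [abs_le]; constructor <;> linarith
              have := mul_le_mul this hx (abs_nonneg _) zero_le_one
              linarith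
            · rw [sub_zero, abs_mul, abs_of_nonneg r0]
              have := mul_le_mul r1 hx (abs_nonneg _) zero_le_one
              linarith
    _ = b ^ (2 + k) * (gaussianReal 0 1).real {s : ℝ | a ≤ |s| ∧ |s| ≤ b} := by
        rw [integral_indicator hmB, setIntegral_const, smul_eq_mul, mul_comm]
    _ ≤ b ^ (2 + k) * (2 * (b - a)) :=
        mul_le_mul_of_nonneg_left (band_measure a b hab.le) (by positivity)

lemma exp_phi {n : ℕ} (a b τ : ℝ) (ha : 0 ≤ a) (hab : a < b) (h1 : a ≤ τ) (h2 : τ ≤ b)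
    (hb1 : 1 ≤ b) (u v : Fin n → ℝ) (hu : dotp u u = 1) (hv : dotp v v = 1) :
    |∫ x, phi a b (dotp x u) * dotp x v ^ 2 ∂(stdGaussianVec n)
      - (dotp u v ^ 2 * ∫ x in {s : ℝ | |s| ≤ τ}, x ^ 4 ∂(gaussianReal 0 1)
        + (1 - dotp u v ^ 2) * ∫ x in {s : ℝ | |s| ≤ τ}, x ^ 2 ∂(gaussianReal 0 1))|
      ≤ b ^ 4 * (2 * (b - a)) := by
  have hb : 0 < b := by linarith
  have hmp : Measurable (phi a b) := ((measurable_clip b).pow_const 2).mul (measurable_ramp a b)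
  have hr : dotp u v ^ 2 ≤ 1 := by
    have := dotp_sq_le u v
    rw [vecNorm_sq, vecNorm_sq, hu, hv] at this; linarith
  rw [exp_mul (phi a b) hmp (b ^ 2) (fun x => by
    unfold phi
    rw [abs_of_nonneg (mul_nonneg (sq_nonneg _) (ramp_nonneg _ _ _))]
    have hc : clip b x ^ 2 ≤ b ^ 2 := by
      rw [← sq_abs]; exact pow_le_pow_left₀ (abs_nonneg _) (clip_abs b x hb.le) 2
    have := mul_le_mul hc (ramp_le_one a b x) (ramp_nonneg _ _ _) (by positivity)
    linarith) u v hu hv]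
  have t1 := phi_band a b τ ha hab h1 h2 2
  have t2 := phi_band a b τ ha hab h1 h2 0
  simp only [pow_zero, mul_one, add_zero] at t2
  norm_num at t1
  have t3 : b ^ 2 * (2 * (b - a)) ≤ b ^ 4 * (2 * (b - a)) :=
    mul_le_mul_of_nonneg_right (pow_le_pow_right₀ hb1 (by norm_num)) (by linarith)
  have r0 := sq_nonneg (dotp u v)
  rw [abs_le] at t1 t2 ⊢
  generalize dotp u v ^ 2 = R at *
  have p1 := mul_le_mul_of_nonneg_left t1.1 r0
  have p2 := mul_le_mul_of_nonneg_left t1.2 r0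
  have p3 := mul_le_mul_of_nonneg_left (show -(b ^ 4 * (2 * (b - a))) ≤ _ by linarith [t2.1]) (show 0 ≤ 1 - R by linarith)
  have p4 := mul_le_mul_of_nonneg_left (t2.2.trans t3) (show 0 ≤ 1 - R by linarith)
  constructor <;> nlinarith

lemma gauss_abs : 0.794 ≤ ∫ x, |x| ∂(gaussianReal 0 1) := by
  rw [integral_gaussianReal_eq_integral_smul (by norm_num)]
  have e : ∀ x : ℝ, gaussianPDFReal 0 1 x • |x|
      = (fun y : ℝ => (Real.sqrt (2 * Real.pi))⁻¹ * (y * Real.exp (-y ^ 2 / 2))) |x| := by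
    intro x
    simp only [sq_abs]
    rw [pdf_eq, smul_eq_mul]; ring
  simp_rw [e]
  rw [integral_comp_abs (f := fun y : ℝ => (Real.sqrt (2 * Real.pi))⁻¹ * (y * Real.exp (-y ^ 2 / 2))),
    integral_const_mul]
  have hd : ∀ x ∈ Set.Ici (0 : ℝ), HasDerivAt (fun y : ℝ => -Real.exp (-y ^ 2 / 2))
      (x * Real.exp (-x ^ 2 / 2)) x := by
    intro x _
    have : HasDerivAt (fun y : ℝ => -y ^ 2 / 2) (-x) x := by
      have h := ((hasDerivAt_pow 2 x).neg.div_const 2)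
      exact HasDerivAt.congr_deriv h (by norm_num; ring)
    exact HasDerivAt.congr_deriv this.exp.neg (by ring)
  have ht : Filter.Tendsto (fun y : ℝ => -Real.exp (-y ^ 2 / 2)) Filter.atTop (nhds 0) := by
    have : Filter.Tendsto (fun y : ℝ => y ^ 2 / 2) Filter.atTop Filter.atTop :=
      (Filter.tendsto_pow_atTop (by norm_num)).atTop_div_const (by norm_num)
    have := (Real.tendsto_exp_neg_atTop_nhds_zero.comp this).neg
    rw [neg_zero] at this
    refine this.congr fun y => ?_
    simp only [Function.comp]
    rw [neg_div]
  have hp : ∀ x ∈ Set.Ioi (0 : ℝ), 0 ≤ x * Real.exp (-x ^ 2 / 2) := fun x hx =>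
    mul_nonneg (le_of_lt hx) (Real.exp_pos _).le
  rw [integral_Ioi_of_hasDerivAt_of_nonneg' hd hp ht]
  have hs : Real.sqrt (2 * Real.pi) ≤ 2.508 := by
    apply Real.sqrt_le_iff.2
    have := Real.pi_lt_d4
    constructor
    · norm_num
    · norm_num at this ⊢; linarith
  have hpos : 0 < Real.sqrt (2 * Real.pi) := Real.sqrt_pos.2 (by positivity)
  have := inv_anti₀ hpos hs
  norm_num at this ⊢; linarith

lemma gauss_rot : ∫ p : ℝ × ℝ, |p.1 ^ 2 - p.2 ^ 2| ∂((gaussianReal 0 1).prod (gaussianReal 0 1))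
    = 2 * ∫ p : ℝ × ℝ, |p.1| * |p.2| ∂((gaussianReal 0 1).prod (gaussianReal 0 1)) := by
  have hm : Measurable (fun p : ℝ × ℝ => |p.1| * |p.2|) := by fun_prop
  have d1 : dotp ![(1 : ℝ), 0] ![(1 : ℝ), 0] = 1 := by simp [dotp]
  have d2 : dotp ![(0 : ℝ), 1] ![(0 : ℝ), 1] = 1 := by simp [dotp]
  have d3 : dotp ![(1 : ℝ), 0] ![(0 : ℝ), 1] = 0 := by simp [dotp]
  have hc : Real.sqrt (1 / 2) ^ 2 = 1 / 2 := Real.sq_sqrt (by norm_num)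
  set c := Real.sqrt (1 / 2)
  have k1 := gauss_integral_pair ![(1 : ℝ), 0] ![(0 : ℝ), 1] 1 0 0 1 (by rw [d1]; ring)
    (by rw [d2]; ring) (by rw [d3]; ring) _ hm
  have k2 := gauss_integral_pair ![(1 : ℝ), 0] ![(0 : ℝ), 1] c c c (-c) (by rw [d1, hc]; ring)
    (by rw [d2, neg_sq, hc]; ring) (by rw [d3]; ring) _ hm
  rw [k1] at k2
  simp only [one_mul, zero_mul, add_zero, zero_add] at k2
  rw [k2, ← integral_const_mul]
  refine integral_congr_ae (Filter.Eventually.of_forall fun p => ?_)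
  simp only
  rw [← abs_mul]
  have : (c * p.1 + c * p.2) * (c * p.1 + -c * p.2) = 1 / 2 * (p.1 ^ 2 - p.2 ^ 2) := by
    rw [← hc]; ring
  rw [this, abs_mul, abs_of_pos (by norm_num : (0 : ℝ) < 1 / 2)]; ring

lemma exp_abs {n : ℕ} (u v : Fin n → ℝ) (hu : dotp u u = 1) (hv : dotp v v = 1) :
    0.63 ≤ ∫ x, |dotp x u| * |dotp x v| ∂(stdGaussianVec n) := by
  have hr : dotp u v ^ 2 ≤ 1 := by
    have := dotp_sq_le u v
    rw [vecNorm_sq, vecNorm_sq, hu, hv] at this; linarith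
  obtain ⟨hr1, hr2⟩ := abs_le.1 ((sq_le_one_iff_abs_le_one _).1 hr)
  have hc : Real.sqrt ((1 + dotp u v) / 2) ^ 2 = (1 + dotp u v) / 2 := Real.sq_sqrt (by linarith)
  have hd : Real.sqrt ((1 - dotp u v) / 2) ^ 2 = (1 - dotp u v) / 2 := Real.sq_sqrt (by linarith)
  set c := Real.sqrt ((1 + dotp u v) / 2)
  set d := Real.sqrt ((1 - dotp u v) / 2)
  have hm : Measurable (fun p : ℝ × ℝ => |p.1| * |p.2|) := by fun_prop
  have key := gauss_integral_pair u v c d c (-d) (by rw [hu, hc, hd]; ring)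
    (by rw [hv, neg_sq, hc, hd]; ring)
    (by have : c * c + d * -d = c ^ 2 - d ^ 2 := by ring
        rw [this, hc, hd]; ring) _ hm
  simp only at key
  rw [key]
  have e : ∀ p : ℝ × ℝ, |c * p.1 + d * p.2| * |c * p.1 + -d * p.2|
      = |c ^ 2 * p.1 ^ 2 - d ^ 2 * p.2 ^ 2| := fun p => by
    rw [← abs_mul]; congr 1; ring
  simp_rw [e]
  have isq1 : Integrable (fun p : ℝ × ℝ => p.1 ^ 2) ((gaussianReal 0 1).prod (gaussianReal 0 1)) :=
    (gauss_pow_integrable 2).comp_fst _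
  have isq2 : Integrable (fun p : ℝ × ℝ => p.2 ^ 2) ((gaussianReal 0 1).prod (gaussianReal 0 1)) :=
    (gauss_pow_integrable 2).comp_snd _
  have sw := integral_prod_swap (μ := gaussianReal 0 1) (ν := gaussianReal 0 1)
    (fun p : ℝ × ℝ => |c ^ 2 * p.1 ^ 2 - d ^ 2 * p.2 ^ 2|)
  simp only [Prod.fst_swap, Prod.snd_swap] at sw
  have j1 : Integrable (fun p : ℝ × ℝ => |c ^ 2 * p.1 ^ 2 - d ^ 2 * p.2 ^ 2|)
      ((gaussianReal 0 1).prod (gaussianReal 0 1)) :=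
    ((isq1.const_mul _).sub (isq2.const_mul _)).abs
  have j2 : Integrable (fun p : ℝ × ℝ => |c ^ 2 * p.2 ^ 2 - d ^ 2 * p.1 ^ 2|)
      ((gaussianReal 0 1).prod (gaussianReal 0 1)) :=
    ((isq2.const_mul _).sub (isq1.const_mul _)).abs
  have j3 : Integrable (fun p : ℝ × ℝ => |p.1 ^ 2 - p.2 ^ 2|)
      ((gaussianReal 0 1).prod (gaussianReal 0 1)) := (isq1.sub isq2).abs
  have hle : ∫ p : ℝ × ℝ, |p.1 ^ 2 - p.2 ^ 2| ∂((gaussianReal 0 1).prod (gaussianReal 0 1))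
      ≤ ∫ p : ℝ × ℝ, (|c ^ 2 * p.1 ^ 2 - d ^ 2 * p.2 ^ 2| + |c ^ 2 * p.2 ^ 2 - d ^ 2 * p.1 ^ 2|)
        ∂((gaussianReal 0 1).prod (gaussianReal 0 1)) := by
    refine integral_mono j3 (j1.add j2) fun p => ?_
    have := abs_sub (c ^ 2 * p.1 ^ 2 - d ^ 2 * p.2 ^ 2) (c ^ 2 * p.2 ^ 2 - d ^ 2 * p.1 ^ 2)
    have e2 : c ^ 2 * p.1 ^ 2 - d ^ 2 * p.2 ^ 2 - (c ^ 2 * p.2 ^ 2 - d ^ 2 * p.1 ^ 2)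
      = p.1 ^ 2 - p.2 ^ 2 := by rw [hc, hd]; ring
    rw [e2] at this
    exact this
  rw [integral_add j1 j2, sw, gauss_rot] at hle
  have hpm := integral_prod_mul (μ := gaussianReal 0 1) (ν := gaussianReal 0 1)
    (fun x : ℝ => |x|) (fun x : ℝ => |x|)
  rw [hpm] at hle
  have := gauss_abs
  norm_num at this ⊢
  nlinarith

lemma sum_outer {n : ℕ} (a b c d : Fin n → ℝ) :
    ∑ i, ∑ j, (a i * b j) * (c i * d j) = dotp a c * dotp b d := by
  unfold dotp
  rw [Finset.sum_mul_sum]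
  refine Finset.sum_congr rfl fun i _ => Finset.sum_congr rfl fun j _ => by ring

lemma frobInner_tangent {n : ℕ} (a z w : Fin n → ℝ) :
    frobInner (vecMulVec a a) (vecMulVec z w + vecMulVec w z) = 2 * (dotp a z * dotp a w) := by
  unfold frobInner
  have : ∀ i j, vecMulVec a a i j * (vecMulVec z w + vecMulVec w z) i j
      = (a i * a j) * (z i * w j) + (a i * a j) * (w i * z j) := by
    intro i j; simp only [Matrix.add_apply, vecMulVec_apply]; ring
  simp_rw [this, Finset.sum_add_distrib, sum_outer]; ring

lemma frobNorm_sq {n : ℕ} (A : Matrix (Fin n) (Fin n) ℝ) :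
    frobNorm A ^ 2 = ∑ i, ∑ j, (A i j) ^ 2 :=
  Real.sq_sqrt (Finset.sum_nonneg fun i _ => Finset.sum_nonneg fun j _ => sq_nonneg _)

lemma frobNorm_tangent {n : ℕ} (z w : Fin n → ℝ) :
    frobNorm (vecMulVec z w + vecMulVec w z) ^ 2 = 2 * (dotp z z * dotp w w + dotp z w ^ 2) := by
  rw [frobNorm_sq]
  have : ∀ i j, (vecMulVec z w + vecMulVec w z) i j ^ 2
      = (z i * w j) * (z i * w j) + (z i * w j) * (w i * z j)
        + ((w i * z j) * (z i * w j) + (w i * z j) * (w i * z j)) := by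
    intro i j; simp only [Matrix.add_apply, vecMulVec_apply]; ring
  simp_rw [this, Finset.sum_add_distrib, sum_outer, dotp_comm w z]; ring

lemma frobNorm_self_sq {n : ℕ} (x : Fin n → ℝ) :
    frobNorm (vecMulVec x x) ^ 2 = dotp x x ^ 2 := by
  rw [frobNorm_sq]
  have : ∀ i j, (vecMulVec x x) i j ^ 2 = (x i * x j) * (x i * x j) := by
    intro i j; simp only [vecMulVec_apply]; ring
  simp_rw [this, sum_outer]; ring

lemma frobNorm_diff_sq {n : ℕ} (z x : Fin n → ℝ) :
    frobNorm (vecMulVec z z - vecMulVec x x) ^ 2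
      = dotp z z ^ 2 + dotp x x ^ 2 - 2 * dotp z x ^ 2 := by
  rw [frobNorm_sq]
  have : ∀ i j, (vecMulVec z z - vecMulVec x x) i j ^ 2
      = (z i * z j) * (z i * z j) - (z i * z j) * (x i * x j)
        - ((x i * x j) * (z i * z j) - (x i * x j) * (x i * x j)) := by
    intro i j; simp only [Matrix.sub_apply, vecMulVec_apply]; ring
  simp_rw [this, Finset.sum_sub_distrib, sum_outer, dotp_comm x z]; ring

lemma exists_unit {n : ℕ} (z : Fin n → ℝ) (hz : z ≠ 0) :
    ∃ u : Fin n → ℝ, dotp u u = 1 ∧ z = vecNorm z • u := by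
  have hp := vecNorm_pos hz
  refine ⟨(vecNorm z)⁻¹ • z, ?_, ?_⟩
  · rw [dotp_smul_left, dotp_smul_right, ← vecNorm_sq]; field_simp
  · rw [smul_smul, mul_inv_cancel₀ hp.ne', one_smul]

lemma close_facts {n : ℕ} (x z : Fin n → ℝ) (hx : x ≠ 0)
    (h : frobNorm (vecMulVec z z - vecMulVec x x) ≤ frobNorm (vecMulVec x x) / 13) :
    z ≠ 0 ∧ 2.75 * dotp z z ≤ dotp x x + 2 * |dotp z x| := by
  have h0 : 0 ≤ frobNorm (vecMulVec z z - vecMulVec x x) := Real.sqrt_nonneg _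
  have h2 := pow_le_pow_left₀ h0 h 2
  rw [div_pow, frobNorm_self_sq, frobNorm_diff_sq] at h2
  have hX : 0 < dotp x x := by rw [← vecNorm_sq]; exact pow_pos (vecNorm_pos hx) 2
  have hZ : 0 ≤ dotp z z := by rw [← vecNorm_sq]; exact sq_nonneg _
  have hY : dotp z x ^ 2 ≤ dotp z z * dotp x x := by
    have := dotp_sq_le z x
    rwa [vecNorm_sq, vecNorm_sq] at this
  constructor
  · rintro rfl
    have e1 : dotp (0 : Fin n → ℝ) 0 = 0 := by simp [dotp]
    have e2 : dotp (0 : Fin n → ℝ) x = 0 := by simp [dotp]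
    rw [e1, e2] at h2
    nlinarith
  · rw [← sq_abs (dotp z x)] at h2 hY
    have hy := abs_nonneg (dotp z x)
    generalize |dotp z x| = Y at *
    generalize dotp z z = Z at *
    generalize dotp x x = X at *
    have a1 : (X - Z) ^ 2 ≤ (X / 13) ^ 2 := by nlinarith
    have a2 := abs_le.1 (abs_le_of_sq_le_sq a1 (by positivity))
    have a3 : 13 * Z ≤ 14 * X := by linarith [a2.1]
    have a4 : (0.96 * Z) ^ 2 ≤ Y ^ 2 := by nlinarith
    have a5 := abs_le_of_sq_le_sq a4 hy
    rw [abs_of_nonneg (by positivity)] at a5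
    linarith

lemma dir_aux {m n : ℕ} (hm : 0 < m) (a : Fin m → Fin n → ℝ) (x z p q : Fin n → ℝ) (τh : ℝ)
    (hτh : 0 < τh) (hz : z ≠ 0)
    (G5 : ∀ u v : Fin n → ℝ, dotp u u = 1 → dotp v v = 1 →
      0.62 * (m : ℝ) ≤ ∑ k, |dotp (a k) u| * |dotp (a k) v|)
    (heq : ∀ k, |dotp (a k) x ^ 2 - dotp (a k) z ^ 2| = |dotp (a k) p| * |dotp (a k) q|)
    (hle : ∀ k, |dotp (a k) q| ≤ |dotp (a k) z| + |dotp (a k) x|)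
    (hq : 3.75 * dotp z z ≤ dotp q q) (k : Fin m)
    (hk : (τh / (m : ℝ)) * (∑ j, |dotp (a j) x ^ 2 - dotp (a j) z ^ 2|)
              * (|dotp (a k) z| + Real.sqrt (dotp (a k) x ^ 2)) / vecNorm z
        < |dotp (a k) x ^ 2 - dotp (a k) z ^ 2|) :
    1.2 * τh * vecNorm p < |dotp (a k) p| := by
  have hm' : (0 : ℝ) < m := by exact_mod_cast hm
  have hN := vecNorm_pos hz
  simp_rw [heq, Real.sqrt_sq_eq_abs] at hk
  set S := ∑ j, |dotp (a j) p| * |dotp (a j) q| with hS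
  have hS0 : 0 ≤ S := Finset.sum_nonneg fun j _ => by positivity
  have hpos : 0 < |dotp (a k) p| * |dotp (a k) q| := lt_of_le_of_lt (by positivity) hk
  have hp0 : 0 < |dotp (a k) p| := pos_of_mul_pos_left hpos (abs_nonneg _)
  have hq0 : 0 < |dotp (a k) q| := pos_of_mul_pos_right hpos (abs_nonneg _)
  have hpne : p ≠ 0 := by
    rintro rfl; simp [dotp] at hp0
  have hqne : q ≠ 0 := by
    rintro rfl; simp [dotp] at hq0
  obtain ⟨pu, hpu, hpe⟩ := exists_unit p hpne
  obtain ⟨qu, hqu, hqe⟩ := exists_unit q hqne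
  have hP := vecNorm_pos hpne
  have hQ := vecNorm_pos hqne
  have hSe : S = vecNorm p * vecNorm q * ∑ j, |dotp (a j) pu| * |dotp (a j) qu| := by
    rw [hS, Finset.mul_sum]
    refine Finset.sum_congr rfl fun j _ => ?_
    conv_lhs => rw [hpe, hqe, dotp_smul_right, dotp_smul_right, abs_mul, abs_mul, abs_of_pos hP,
      abs_of_pos hQ]
    ring
  have hSl : vecNorm p * vecNorm q * (0.62 * m) ≤ S := by
    rw [hSe]; exact mul_le_mul_of_nonneg_left (G5 pu qu hpu hqu) (by positivity)
  have hqN : 1.936 * vecNorm z ≤ vecNorm q := by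
    rw [← vecNorm_sq, ← vecNorm_sq] at hq
    have : (1.936 * vecNorm z) ^ 2 ≤ vecNorm q ^ 2 := by nlinarith [sq_nonneg (vecNorm z)]
    exact (abs_le_of_sq_le_sq this hQ.le).trans' (le_abs_self _)
  have h1 : τh / m * S * |dotp (a k) q| / vecNorm z < |dotp (a k) p| * |dotp (a k) q| := by
    refine lt_of_le_of_lt ?_ hk
    have := hle k
    gcongr
  have h2 : τh / m * S / vecNorm z < |dotp (a k) p| := by
    refine lt_of_mul_lt_mul_right ?_ hq0.le
    calc _ = τh / m * S * |dotp (a k) q| / vecNorm z := by ring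
      _ < _ := h1
  refine lt_of_le_of_lt ?_ h2
  rw [le_div_iff₀ hN]
  have h3 : τh / m * (vecNorm p * vecNorm q * (0.62 * m)) ≤ τh / m * S :=
    mul_le_mul_of_nonneg_left hSl (by positivity)
  have h4 : τh / m * (vecNorm p * vecNorm q * (0.62 * m)) = 0.62 * τh * vecNorm p * vecNorm q := by
    field_simp
  have h5 := mul_le_mul_of_nonneg_left hqN (show 0 ≤ 0.62 * τh * vecNorm p by positivity)
  have h6 : 0 ≤ τh * vecNorm p * vecNorm z := by positivity
  nlinarith

lemma exists_dir {m n : ℕ} (hm : 0 < m) (a : Fin m → Fin n → ℝ) (x z : Fin n → ℝ) (τh : ℝ)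
    (hτh : 0 < τh) (hx : x ≠ 0)
    (h : frobNorm (vecMulVec z z - vecMulVec x x) ≤ frobNorm (vecMulVec x x) / 13)
    (G5 : ∀ u v : Fin n → ℝ, dotp u u = 1 → dotp v v = 1 →
      0.62 * (m : ℝ) ≤ ∑ k, |dotp (a k) u| * |dotp (a k) v|) :
    ∃ d : Fin n → ℝ, dotp d d = 1 ∧ ∀ k : Fin m,
      (τh / (m : ℝ)) * (∑ j, |dotp (a j) x ^ 2 - dotp (a j) z ^ 2|)
              * (|dotp (a k) z| + Real.sqrt (dotp (a k) x ^ 2)) / vecNorm z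
        < |dotp (a k) x ^ 2 - dotp (a k) z ^ 2| → 1.2 * τh ≤ |dotp (a k) d| := by
  obtain ⟨hz, hc⟩ := close_facts x z hx h
  obtain ⟨p, q, heq, hle, hq⟩ : ∃ p q : Fin n → ℝ,
      (∀ k, |dotp (a k) x ^ 2 - dotp (a k) z ^ 2| = |dotp (a k) p| * |dotp (a k) q|) ∧
      (∀ k, |dotp (a k) q| ≤ |dotp (a k) z| + |dotp (a k) x|) ∧
      3.75 * dotp z z ≤ dotp q q := by
    rcases le_total 0 (dotp z x) with hy | hy
    · refine ⟨x - z, x + z, fun k => ?_, fun k => ?_, ?_⟩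
      · rw [← abs_mul, dotp_sub_right, dotp_add_right]; congr 1; ring
      · rw [dotp_add_right, add_comm]; exact abs_add_le _ _
      · rw [dotp_add_right, dotp_add_left, dotp_add_left, dotp_comm x z]
        rw [abs_of_nonneg hy] at hc; linarith
    · refine ⟨x + z, x - z, fun k => ?_, fun k => ?_, ?_⟩
      · rw [← abs_mul, dotp_sub_right, dotp_add_right]; congr 1; ring
      · rw [dotp_sub_right, add_comm]; exact abs_sub _ _
      · rw [dotp_sub_right, dotp_sub_left, dotp_sub_left, dotp_comm x z]
        rw [abs_of_nonpos hy] at hc; linarith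
  have key := dir_aux hm a x z p q τh hτh hz G5 heq hle hq
  by_cases hp : p = 0
  · obtain ⟨u, hu, _⟩ := exists_unit x hx
    refine ⟨u, hu, fun k hk => ?_⟩
    have := key k hk
    rw [hp] at this
    simp [dotp, vecNorm] at this
  · obtain ⟨u, hu, hpe⟩ := exists_unit p hp
    refine ⟨u, hu, fun k hk => ?_⟩
    have h1 := key k hk
    have hP := vecNorm_pos hp
    have e : |dotp (a k) p| = vecNorm p * |dotp (a k) u| := by
      conv_lhs => rw [hpe, dotp_smul_right, abs_mul, abs_of_pos hP]
    rw [e] at h1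
    refine le_of_mul_le_mul_left ?_ hP
    linarith

/-- The good event. -/
def Good (τx τz τh V1 V2 ε δ : ℝ) (m n : ℕ) (a : Fin m → Fin n → ℝ) : Prop :=
  (∀ u v : Fin n → ℝ, dotp u u = 1 → dotp v v = 1 →
    ∑ k, phi τz (τz + δ) (dotp (a k) u) * dotp (a k) v ^ 2
      ≤ (m : ℝ) * (dotp u v ^ 2 * V1 + V2 + ε)) ∧
  (∀ u v : Fin n → ℝ, dotp u u = 1 → dotp v v = 1 →
    (m : ℝ) * (dotp u v ^ 2 * V1 + V2 - ε)
      ≤ ∑ k, phi (τz - δ) τz (dotp (a k) u) * dotp (a k) v ^ 2) ∧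
  (∀ u v : Fin n → ℝ, dotp u u = 1 → dotp v v = 1 →
    ∑ k, (1 - ramp (1.14 * τh) (1.2 * τh) (dotp (a k) u)) * dotp (a k) v ^ 2
      ≤ (m : ℝ) * (6 * τh * Real.exp (-(0.64 * τh ^ 2)) + ε / (2 * τz ^ 2))) ∧
  (∀ u v : Fin n → ℝ, dotp u u = 1 → dotp v v = 1 →
    ∑ k, (1 - ramp (0.9 * τx) (0.97 * τx) (dotp (a k) u)) * dotp (a k) v ^ 2
      ≤ (m : ℝ) * (4 * τx * Real.exp (-(0.39 * τx ^ 2)) + ε / (2 * τz ^ 2))) ∧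
  (∀ u v : Fin n → ℝ, dotp u u = 1 → dotp v v = 1 →
      0.62 * (m : ℝ) ≤ ∑ k, |dotp (a k) u| * |dotp (a k) v|) ∧
  (∀ v : Fin n → ℝ, dotp v v = 1 → 0.95 * (m : ℝ) ≤ ∑ k, dotp (a k) v ^ 2)

lemma unit_norm {n : ℕ} {u : Fin n → ℝ} (hu : dotp u u = 1) : vecNorm u ≤ 1 := by
  have := vecNorm_sq u
  rw [hu] at this
  nlinarith [vecNorm_nonneg u]

lemma whp_good (τx τz τh V1 V2 ε δ : ℝ) (hτz : 2 ≤ τz) (hτh : 1 ≤ τh) (hτx : 1 ≤ τx)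
    (hV1 : V1 = (∫ t in {s : ℝ | |s| ≤ τz}, t ^ 4 ∂(gaussianReal 0 1))
      - ∫ t in {s : ℝ | |s| ≤ τz}, t ^ 2 ∂(gaussianReal 0 1))
    (hV2 : V2 = ∫ t in {s : ℝ | |s| ≤ τz}, t ^ 2 ∂(gaussianReal 0 1))
    (hε : 0 < ε) (hδ : 0 < δ) (hδ1 : δ ≤ 1) (hδε : (τz + 1) ^ 4 * (2 * δ) ≤ ε / 2) :
    Whp (Good τx τz τh V1 V2 ε δ) := by
  have W1 := whp_phi τz (τz + δ) (by linarith) (by linarith) (ε / 2) (by positivity)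
  have W2 := whp_phi (τz - δ) τz (by linarith) (by linarith) (ε / 2) (by positivity)
  have hη : 0 < ε / (2 * τz ^ 2) := by positivity
  have W3 := whp_psi (1.14 * τh) (1.2 * τh) (by linarith) (by linarith) _ hη
  have W4 := whp_psi (0.9 * τx) (0.97 * τx) (by linarith) (by linarith) _ hη
  have W5 := whp_abs 0.01 (by norm_num)
  have W6 := whp_one 0.05 (by norm_num)
  refine (W1.and (W2.and (W3.and (W4.and (W5.and W6))))).mono ?_
  rintro m n a hm ⟨h1, h2, h3, h4, h5, h6⟩
  have hm' : (0 : ℝ) < m := by exact_mod_cast hm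
  refine ⟨fun u v hu hv => ?_, fun u v hu hv => ?_, fun u v hu hv => ?_, fun u v hu hv => ?_,
    fun u v hu hv => ?_, fun v hv => ?_⟩
  · have c := (abs_le.1 (h1 u v (unit_norm hu) (unit_norm hv))).2
    have e := (abs_le.1 (exp_phi τz (τz + δ) τz (by linarith) (by linarith) le_rfl (by linarith)
      (by linarith) u v hu hv)).2
    have hb : (τz + δ) ^ 4 * (2 * (τz + δ - τz)) ≤ ε / 2 := by
      refine le_trans ?_ hδε
      have : (τz + δ) ^ 4 ≤ (τz + 1) ^ 4 := pow_le_pow_left₀ (by linarith) (by linarith) 4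
      rw [show τz + δ - τz = δ by ring]
      gcongr
    have e' := mul_le_mul_of_nonneg_left (e.trans hb) hm'.le
    have e4 : ∫ t in {s : ℝ | |s| ≤ τz}, t ^ 4 ∂(gaussianReal 0 1) = V1 + V2 := by
      rw [hV1, hV2]; ring
    rw [← hV2, e4] at e'
    linarith
  · have c := (abs_le.1 (h2 u v (unit_norm hu) (unit_norm hv))).1
    have e := (abs_le.1 (exp_phi (τz - δ) τz τz (by linarith) (by linarith) (by linarith) le_rfl
      (by linarith) u v hu hv)).1
    have hb : τz ^ 4 * (2 * (τz - (τz - δ))) ≤ ε / 2 := by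
      refine le_trans ?_ hδε
      have : τz ^ 4 ≤ (τz + 1) ^ 4 := pow_le_pow_left₀ (by linarith) (by linarith) 4
      rw [show τz - (τz - δ) = δ by ring]
      gcongr
    have e' := mul_le_mul_of_nonneg_left ((neg_le_neg hb).trans e) hm'.le
    have e4 : ∫ t in {s : ℝ | |s| ≤ τz}, t ^ 4 ∂(gaussianReal 0 1) = V1 + V2 := by
      rw [hV1, hV2]; ring
    rw [← hV2, e4] at e'
    linarith
  · have c := (abs_le.1 (h3 u v (unit_norm hu) (unit_norm hv))).2
    have e := mul_le_mul_of_nonneg_left (exp_psi_h τh hτh u v hu hv) hm'.le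
    linarith
  · have c := (abs_le.1 (h4 u v (unit_norm hu) (unit_norm hv))).2
    have e := mul_le_mul_of_nonneg_left (exp_psi_x τx hτx u v hu hv) hm'.le
    linarith
  · have c := (abs_le.1 (h5 u v (unit_norm hu) (unit_norm hv))).1
    have e := mul_le_mul_of_nonneg_left (exp_abs u v hu hv) hm'.le
    linarith
  · have c := (abs_le.1 (h6 v (unit_norm hv))).1
    rw [exp_one v hv] at c
    linarith

lemma good_bounds (τx τz τh V1 V2 ε δ R1 : ℝ) (hτz : 2 ≤ τz) (hτh : 1 ≤ τh) (hτx : 1 ≤ τx)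
    (hδ : 0 < δ) (hR1 : ε ≤ R1) {m n : ℕ} (hm : 0 < m)
    (a : Fin m → Fin n → ℝ) (hG : Good τx τz τh V1 V2 ε δ m n a) (x : Fin n → ℝ) (hx : x ≠ 0)
    (z : Fin n → ℝ)
    (hzx : frobNorm (vecMulVec z z - vecMulVec x x) ≤ frobNorm (vecMulVec x x) / 13)
    (W : Matrix (Fin n) (Fin n) ℝ) (hW : W ∈ tangentSet z) :
    (2 * min V1 (V2 - R1 - (6 * τz ^ 2 * τh * Real.exp (-(0.64 * τh ^ 2))
                   + 4 * τz ^ 2 * τx * Real.exp (-(0.39 * τx ^ 2)) + ε))) * frobNorm W ^ 2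
      ≤ (1 / (m : ℝ)) * ∑ k, (truncOp a x τx τz τh z W k) ^ 2 ∧
    (1 / (m : ℝ)) * ∑ k, (truncOp a x τx τz τh z W k) ^ 2
      ≤ (max (V1 + V2 + R1) (2 * (V2 + R1))) * frobNorm W ^ 2 := by
  obtain ⟨G1, G2, G3, G4, G5, G6⟩ := hG
  have hm' : (0 : ℝ) < m := by exact_mod_cast hm
  obtain ⟨w, rfl⟩ := hW
  obtain ⟨hz, -⟩ := close_facts x z hx hzx
  obtain ⟨d, hd, hdk⟩ := exists_dir hm a x z τh (by linarith) hx hzx G5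
  have hsum : ∀ k, (truncOp a x τx τz τh z (vecMulVec z w + vecMulVec w z) k) ^ 2 =
    if (Real.sqrt ((dotp (a k) x)^2)
          ≤ τx * Real.sqrt ((∑ j, (dotp (a j) x)^2) / (m : ℝ))) ∧
       (|dotp (a k) z| ≤ τz * vecNorm z) ∧
       (|(dotp (a k) x)^2 - (dotp (a k) z)^2|
          ≤ (τh / (m : ℝ)) * (∑ j, |(dotp (a j) x)^2 - (dotp (a j) z)^2|)
              * (|dotp (a k) z| + Real.sqrt ((dotp (a k) x)^2)) / vecNorm z)
    then 4 * (dotp (a k) z ^ 2 * dotp (a k) w ^ 2) else 0 := by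
    intro k
    unfold truncOp
    rw [frobInner_tangent]
    split_ifs
    · ring
    · ring
  simp_rw [hsum]
  rw [frobNorm_tangent]
  by_cases hw : w = 0
  · subst hw
    have e1 : ∀ v : Fin n → ℝ, dotp v 0 = 0 := fun v => by simp [dotp]
    simp [e1]
  obtain ⟨zu, hzu, hze⟩ := exists_unit z hz
  obtain ⟨wu, hwu, hwe⟩ := exists_unit w hw
  obtain ⟨xu, hxu, hxe⟩ := exists_unit x hx
  have hN := vecNorm_pos hz
  have hM := vecNorm_pos hw
  have hXn := vecNorm_pos hx
  set N := vecNorm z with hNd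
  set M := vecNorm w with hMd
  set X := vecNorm x with hXd
  have ez : ∀ v, dotp v z = N * dotp v zu := fun v => by
    conv_lhs => rw [hze, dotp_smul_right]
  have ew : ∀ v, dotp v w = M * dotp v wu := fun v => by
    conv_lhs => rw [hwe, dotp_smul_right]
  have ex : ∀ v, dotp v x = X * dotp v xu := fun v => by
    conv_lhs => rw [hxe, dotp_smul_right]
  have hx0 : ∀ k, ¬ (Real.sqrt ((dotp (a k) x)^2)
          ≤ τx * Real.sqrt ((∑ j, (dotp (a j) x)^2) / (m : ℝ))) → 0.97 * τx ≤ |dotp (a k) xu| := by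
    intro k hk
    push Not at hk
    have s1 : (0.97 * X) ≤ Real.sqrt ((∑ j, (dotp (a j) x)^2) / (m : ℝ)) := by
      apply Real.le_sqrt_of_sq_le
      rw [le_div_iff₀ hm']
      have : ∑ j, (dotp (a j) x)^2 = X ^ 2 * ∑ j, dotp (a j) xu ^ 2 := by
        rw [Finset.mul_sum]
        exact Finset.sum_congr rfl fun j _ => by rw [ex]; ring
      rw [this]
      have := mul_le_mul_of_nonneg_left (G6 xu hxu) (sq_nonneg X)
      have : 0 ≤ X ^ 2 * m := by positivity
      nlinarith
    rw [Real.sqrt_sq_eq_abs, ex, abs_mul, abs_of_pos hXn] at hk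
    have s2 := mul_le_mul_of_nonneg_left s1 (show 0 ≤ τx by linarith)
    refine le_of_mul_le_mul_left ?_ hXn
    linarith
  set P : Fin m → Prop := fun k => (Real.sqrt ((dotp (a k) x)^2)
          ≤ τx * Real.sqrt ((∑ j, (dotp (a j) x)^2) / (m : ℝ))) ∧
       (|dotp (a k) z| ≤ τz * N) ∧
       (|(dotp (a k) x)^2 - (dotp (a k) z)^2|
          ≤ (τh / (m : ℝ)) * (∑ j, |(dotp (a j) x)^2 - (dotp (a j) z)^2|)
              * (|dotp (a k) z| + Real.sqrt ((dotp (a k) x)^2)) / N) with hP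
  have hPz : ∀ k, |dotp (a k) z| ≤ τz * N ↔ |dotp (a k) zu| ≤ τz := by
    intro k
    rw [ez, abs_mul, abs_of_pos hN, mul_comm τz]
    exact mul_le_mul_iff_right₀ hN
  set r := dotp zu wu with hr
  have hr1 : r ^ 2 ≤ 1 := by
    have := dotp_sq_le zu wu
    rw [vecNorm_sq, vecNorm_sq, hzu, hwu] at this; linarith
  have hsum2 : ∀ k, (if P k then 4 * (dotp (a k) z ^ 2 * dotp (a k) w ^ 2) else 0)
      = 4 * N ^ 2 * M ^ 2 * ((if P k then dotp (a k) zu ^ 2 else 0) * dotp (a k) wu ^ 2) := by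
    intro k
    split_ifs
    · rw [ez, ew]; ring
    · ring
  have hup : ∀ k, (if P k then dotp (a k) zu ^ 2 else 0) ≤ phi τz (τz + δ) (dotp (a k) zu) := by
    intro k
    rw [phi_eq _ _ _ (by linarith)]
    split_ifs with h
    · rw [ramp_one _ _ _ (by linarith) ((hPz k).1 h.2.1), mul_one]
    · exact mul_nonneg (sq_nonneg _) (ramp_nonneg _ _ _)
  have hlow : ∀ k, phi (τz - δ) τz (dotp (a k) zu)
      - τz ^ 2 * (1 - ramp (0.9 * τx) (0.97 * τx) (dotp (a k) xu))
      - τz ^ 2 * (1 - ramp (1.14 * τh) (1.2 * τh) (dotp (a k) d))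
      ≤ (if P k then dotp (a k) zu ^ 2 else 0) := by
    intro k
    have p1 : 0 ≤ τz ^ 2 * (1 - ramp (0.9 * τx) (0.97 * τx) (dotp (a k) xu)) :=
      mul_nonneg (sq_nonneg _) (by linarith [ramp_le_one (0.9 * τx) (0.97 * τx) (dotp (a k) xu)])
    have p2 : 0 ≤ τz ^ 2 * (1 - ramp (1.14 * τh) (1.2 * τh) (dotp (a k) d)) :=
      mul_nonneg (sq_nonneg _) (by linarith [ramp_le_one (1.14 * τh) (1.2 * τh) (dotp (a k) d)])
    rw [phi_eq _ _ _ (by linarith)]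
    have p3 : dotp (a k) zu ^ 2 * ramp (τz - δ) τz (dotp (a k) zu) ≤ dotp (a k) zu ^ 2 :=
      mul_le_of_le_one_right (sq_nonneg _) (ramp_le_one _ _ _)
    split_ifs with h
    · linarith
    · rcases lt_or_ge τz |dotp (a k) zu| with h' | h'
      · rw [ramp_zero (τz - δ) τz _ (by linarith) h'.le]; linarith
      · have p4 : dotp (a k) zu ^ 2 ≤ τz ^ 2 := by
          rw [← sq_abs]; exact pow_le_pow_left₀ (abs_nonneg _) h' 2
        by_cases hE : Real.sqrt ((dotp (a k) x)^2)
          ≤ τx * Real.sqrt ((∑ j, (dotp (a j) x)^2) / (m : ℝ))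
        · have h3 : 1.2 * τh ≤ |dotp (a k) d| := by
            apply hdk k
            by_contra hcon
            exact h ⟨hE, (hPz k).2 h', not_lt.1 hcon⟩
          rw [ramp_zero (1.14 * τh) (1.2 * τh) _ (by linarith) h3] at p2 ⊢
          linarith
        · rw [ramp_zero (0.9 * τx) (0.97 * τx) _ (by linarith) (hx0 k hE)] at p1 ⊢
          linarith
  set A := ∑ k, (if P k then dotp (a k) zu ^ 2 else 0) * dotp (a k) wu ^ 2 with hA
  have hAup : A ≤ m * (r ^ 2 * V1 + V2 + ε) := by
    refine le_trans ?_ (G1 zu wu hzu hwu)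
    exact Finset.sum_le_sum fun k _ => mul_le_mul_of_nonneg_right (hup k) (sq_nonneg _)
  set E1 := Real.exp (-(0.64 * τh ^ 2)) with hE1
  set E2 := Real.exp (-(0.39 * τx ^ 2)) with hE2
  have hAlow : m * (r ^ 2 * V1 + V2 - ε - (6 * τz ^ 2 * τh * E1 + 4 * τz ^ 2 * τx * E2 + ε)) ≤ A := by
    have s1 : ∑ k, (phi (τz - δ) τz (dotp (a k) zu)
      - τz ^ 2 * (1 - ramp (0.9 * τx) (0.97 * τx) (dotp (a k) xu))
      - τz ^ 2 * (1 - ramp (1.14 * τh) (1.2 * τh) (dotp (a k) d))) * dotp (a k) wu ^ 2 ≤ A :=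
      Finset.sum_le_sum fun k _ => mul_le_mul_of_nonneg_right (hlow k) (sq_nonneg _)
    simp_rw [sub_mul (_ - _), sub_mul (phi _ _ _), Finset.sum_sub_distrib, mul_assoc (τz ^ 2),
      ← Finset.mul_sum] at s1
    have g2 := G2 zu wu hzu hwu
    have g3 := mul_le_mul_of_nonneg_left (G3 d wu hd hwu) (sq_nonneg τz)
    have g4 := mul_le_mul_of_nonneg_left (G4 xu wu hxu hwu) (sq_nonneg τz)
    have e3 : τz ^ 2 * (m * (6 * τh * E1 + ε / (2 * τz ^ 2)))
      = m * (6 * τz ^ 2 * τh * E1 + ε / 2) := by field_simp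
    have e4 : τz ^ 2 * (m * (4 * τx * E2 + ε / (2 * τz ^ 2)))
      = m * (4 * τz ^ 2 * τx * E2 + ε / 2) := by field_simp
    rw [e3] at g3
    rw [e4] at g4
    linarith
  have hfin : (1 / (m : ℝ)) * ∑ k, (if P k then 4 * (dotp (a k) z ^ 2 * dotp (a k) w ^ 2) else 0)
      = 4 * N ^ 2 * M ^ 2 * (A / m) := by
    simp_rw [hsum2]
    rw [← Finset.mul_sum]; ring
  have hfro : 2 * (dotp z z * dotp w w + dotp z w ^ 2) = 2 * N ^ 2 * M ^ 2 * (1 + r ^ 2) := by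
    rw [← vecNorm_sq, ← vecNorm_sq, ← hNd, ← hMd, ew, dotp_comm z wu, ez, dotp_comm wu zu, ← hr]
    ring
  rw [hfin, hfro]
  have hA1 : A / m ≤ r ^ 2 * V1 + V2 + ε := by rw [div_le_iff₀ hm']; linarith
  have hA2 : r ^ 2 * V1 + V2 - ε - (6 * τz ^ 2 * τh * E1 + 4 * τz ^ 2 * τx * E2 + ε) ≤ A / m := by
    rw [le_div_iff₀ hm']; linarith
  have hNM : 0 ≤ 4 * N ^ 2 * M ^ 2 := by positivity
  have hr0 := sq_nonneg r
  set Q := 6 * τz ^ 2 * τh * E1 + 4 * τz ^ 2 * τx * E2 + ε with hQ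
  constructor
  · have t1 : min V1 (V2 - R1 - Q) * (1 + r ^ 2) ≤ A / m := by
      have := min_le_left V1 (V2 - R1 - Q)
      have := min_le_right V1 (V2 - R1 - Q)
      nlinarith
    have := mul_le_mul_of_nonneg_left t1 hNM
    linarith
  · have t1 : 2 * (A / m) ≤ max (V1 + V2 + R1) (2 * (V2 + R1)) * (1 + r ^ 2) := by
      have b1 := mul_le_mul_of_nonneg_left (le_max_left (V1 + V2 + R1) (2 * (V2 + R1)))
        (show 0 ≤ 2 * r ^ 2 by linarith)
      have b2 := mul_le_mul_of_nonneg_left (le_max_right (V1 + V2 + R1) (2 * (V2 + R1)))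
        (show 0 ≤ 1 - r ^ 2 by linarith)
      linarith
    have := mul_le_mul_of_nonneg_left t1 (show 0 ≤ 2 * N ^ 2 * M ^ 2 by positivity)
    linarith

/-- Restricted well conditioned property of the truncated sensing operator. -/
theorem restricted_well_conditioned
    (τz τh τx : ℝ) (hτz : 2 ≤ τz) (hτh : 1 ≤ τh) (hτx : 1 ≤ τx)
    (ϑ₁ ϑ₂ : ℝ)
    (hϑ₁ : ϑ₁ = (∫ t in {s : ℝ | |s| ≤ τz}, t^4 ∂(gaussianReal 0 1))
      - ∫ t in {s : ℝ | |s| ≤ τz}, t^2 ∂(gaussianReal 0 1))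
    (hϑ₂ : ϑ₂ = ∫ t in {s : ℝ | |s| ≤ τz}, t^2 ∂(gaussianReal 0 1)) :
    ∀ ε : ℝ, ε ∈ Set.Ioo (0:ℝ) 1 →
    ∃ c C : ℝ, 0 < c ∧ 0 < C ∧
      ∀ (n : ℕ) (x : Fin n → ℝ), x ≠ 0 →
      ∀ m : ℕ, C * (n : ℝ) ≤ (m : ℝ) →
      sampleMeasure m n {a : Fin m → Fin n → ℝ |
        ∀ z : Fin n → ℝ,
          frobNorm (vecMulVec z z - vecMulVec x x) ≤ frobNorm (vecMulVec x x) / 13 →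
          ∀ W ∈ tangentSet z,
            (2 * min ϑ₁ (ϑ₂ - (10 * τz^3 * Real.exp (-(0.49 * τz^2)) + ε)
                - (6 * τz^2 * τh * Real.exp (-(0.64 * τh^2))
                   + 4 * τz^2 * τx * Real.exp (-(0.39 * τx^2)) + ε)))
                * frobNorm W ^ 2
              ≤ (1 / (m : ℝ)) * ∑ k, (truncOp a x τx τz τh z W k)^2 ∧
            (1 / (m : ℝ)) * ∑ k, (truncOp a x τx τz τh z W k)^2
              ≤ (max (ϑ₁ + ϑ₂ + (10 * τz^3 * Real.exp (-(0.49 * τz^2)) + ε))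
                    (2 * (ϑ₂ + (10 * τz^3 * Real.exp (-(0.49 * τz^2)) + ε))))
                  * frobNorm W ^ 2}
        ≥ ENNReal.ofReal (1 - Real.exp (-(c * (m : ℝ)))) := by
  rintro ε ⟨hε0, hε1⟩
  have hpos : (0 : ℝ) < (τz + 1) ^ 4 := by positivity
  have h81 : (1 : ℝ) ≤ (τz + 1) ^ 4 := one_le_pow₀ (by linarith)
  set δ := ε / (4 * (τz + 1) ^ 4) with hδd
  have hδ : 0 < δ := by positivity
  have hδ1 : δ ≤ 1 := by rw [hδd, div_le_one (by positivity)]; linarith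
  have hδε : (τz + 1) ^ 4 * (2 * δ) ≤ ε / 2 := by
    rw [hδd]; apply le_of_eq; field_simp; norm_num
  obtain ⟨c, C, hc, hC, H⟩ :=
    whp_good τx τz τh ϑ₁ ϑ₂ ε δ hτz hτh hτx hϑ₁ hϑ₂ hε0 hδ hδ1 hδε
  refine ⟨c, C, hc, hC, fun n x hx m hmC => ?_⟩
  have hn : 1 ≤ n := by
    rcases Nat.eq_zero_or_pos n with h | h
    · subst h; exact absurd (Subsingleton.elim x 0) hx
    · exact h
  have hm : 0 < m := by
    have h1 : (1 : ℝ) ≤ n := by exact_mod_cast hn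
    have : (0 : ℝ) < m := by nlinarith
    exact_mod_cast this
  have hb := H n m hn hm hmC
  have hsub : (Set.univ : Set (Fin m → Fin n → ℝ)) ⊆
      {a | Good τx τz τh ϑ₁ ϑ₂ ε δ m n a} ∪ {a | ¬ Good τx τz τh ϑ₁ ϑ₂ ε δ m n a} :=
    fun a _ => by by_cases h : Good τx τz τh ϑ₁ ϑ₂ ε δ m n a <;> [left; right] <;> exact h
  have h1 : 1 ≤ sampleMeasure m n {a | Good τx τz τh ϑ₁ ϑ₂ ε δ m n a}
      + ENNReal.ofReal (Real.exp (-(c * m))) := by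
    calc (1 : ENNReal) = sampleMeasure m n Set.univ := measure_univ.symm
      _ ≤ _ := measure_mono hsub
      _ ≤ _ := measure_union_le _ _
      _ ≤ _ := by gcongr
  have h2 : ENNReal.ofReal (1 - Real.exp (-(c * (m : ℝ))))
      ≤ sampleMeasure m n {a | Good τx τz τh ϑ₁ ϑ₂ ε δ m n a} := by
    rw [ENNReal.ofReal_sub _ (Real.exp_pos _).le, ENNReal.ofReal_one]
    exact tsub_le_iff_right.2 h1
  refine ge_iff_le.2 (h2.trans (measure_mono fun a ha z hz W hW => ?_))
  refine good_bounds τx τz τh ϑ₁ ϑ₂ ε δ _ hτz hτh hτx hδ ?_ hm a ha x hx z hz W hW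
  have : 0 ≤ 10 * τz ^ 3 * Real.exp (-(0.49 * τz ^ 2)) := by positivity
  linarith
end

section
/- Let x ∈ ℝⁿ be nonzero and X = xx⊤. Let Z be a rank-1 positive semidefinite n×n matrix, W a symmetric n×n matrix, and μ > 0, ε₀ > 0 constants such that ‖W − X‖_F ≤ μ‖Z − X‖_F and ‖Z − X‖_F ≤ ε₀‖X‖_F. Let Z⁺ be a rank-1 positive semidefinite matrix minimizing ‖·− W‖_F over all positive semidefinite matrices of rank at most 1. Then ‖Z⁺ − X‖_F ≤ μ·√(1 + 16μ²ε₀²)·‖Z − X‖_F. -/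
open Matrix

namespace RetractionAux

/-- Frobenius inner product. -/
noncomputable def ip {n : ℕ} (A B : Matrix (Fin n) (Fin n) ℝ) : ℝ := ∑ i, ∑ j, A i j * B i j

variable {n : ℕ}

lemma ip_add_left (A B C : Matrix (Fin n) (Fin n) ℝ) : ip (A + B) C = ip A C + ip B C := by
  simp [ip, add_mul, Finset.sum_add_distrib]

lemma ip_sub_left (A B C : Matrix (Fin n) (Fin n) ℝ) : ip (A - B) C = ip A C - ip B C := by
  simp [ip, sub_mul, Finset.sum_sub_distrib]

lemma ip_smul_left (c : ℝ) (A C : Matrix (Fin n) (Fin n) ℝ) : ip (c • A) C = c * ip A C := by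
  simp [ip, mul_assoc, Finset.mul_sum]

lemma ip_comm (A B : Matrix (Fin n) (Fin n) ℝ) : ip A B = ip B A := by
  simp [ip, mul_comm]

lemma ip_add_right (A B C : Matrix (Fin n) (Fin n) ℝ) : ip C (A + B) = ip C A + ip C B := by
  simp [ip, mul_add, Finset.sum_add_distrib]

lemma ip_sub_right (A B C : Matrix (Fin n) (Fin n) ℝ) : ip C (A - B) = ip C A - ip C B := by
  simp [ip, mul_sub, Finset.sum_sub_distrib]

lemma ip_smul_right (c : ℝ) (A C : Matrix (Fin n) (Fin n) ℝ) : ip C (c • A) = c * ip C A := by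
  rw [ip_comm, ip_smul_left, ip_comm]

lemma ip_vec (a b c d : Fin n → ℝ) :
    ip (vecMulVec a b) (vecMulVec c d) = (a ⬝ᵥ c) * (b ⬝ᵥ d) := by
  simp only [ip, vecMulVec_apply, dotProduct, Finset.sum_mul_sum]
  exact Finset.sum_congr rfl fun i _ => Finset.sum_congr rfl fun j _ => by ring

lemma ip_symm (W : Matrix (Fin n) (Fin n) ℝ) (hW : W.IsSymm) (a b : Fin n → ℝ) :
    ip W (vecMulVec a b) = ip W (vecMulVec b a) := by
  simp only [ip, vecMulVec_apply]
  rw [Finset.sum_comm]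
  exact Finset.sum_congr rfl fun i _ => Finset.sum_congr rfl fun j _ => by
    rw [hW.apply i j]; ring

lemma ip_self_nonneg (A : Matrix (Fin n) (Fin n) ℝ) : 0 ≤ ip A A :=
  Finset.sum_nonneg fun _ _ => Finset.sum_nonneg fun _ _ => mul_self_nonneg _

lemma frob_sq (A : Matrix (Fin n) (Fin n) ℝ) : frobNorm A ^ 2 = ip A A := by
  have h : frobNorm A = Real.sqrt (ip A A) := by simp [frobNorm, ip, sq]
  rw [h, Real.sq_sqrt (ip_self_nonneg A)]

lemma frob_nonneg (A : Matrix (Fin n) (Fin n) ℝ) : 0 ≤ frobNorm A := Real.sqrt_nonneg _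

lemma psd_vec (a : Fin n → ℝ) : (vecMulVec a a).PosSemidef := by
  simpa using posSemidef_vecMulVec_self_star a

lemma exists_vec (Z : Matrix (Fin n) (Fin n) ℝ) (hZ : Z.PosSemidef) (hr : Z.rank ≤ 1) :
    ∃ u : Fin n → ℝ, Z = vecMulVec u u := by
  have hab : ∃ a b : Fin n → ℝ, Z = vecMulVec a b := by
    rw [Matrix.rank, finrank_le_one_iff] at hr
    obtain ⟨⟨a, ha⟩, h⟩ := hr
    choose b hb using fun j => h ⟨Z.mulVecLin (Pi.single j 1), LinearMap.mem_range_self _ _⟩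
    refine ⟨a, b, ?_⟩
    ext i j
    have := congrFun (congrArg Subtype.val (hb j)) i
    simp at this
    rw [vecMulVec_apply, ← this]; ring
  obtain ⟨a, b, rfl⟩ := hab
  by_cases hb : b = 0
  · exact ⟨0, by simp [hb]⟩
  have hbb : 0 < b ⬝ᵥ b := by
    have h0 : 0 ≤ b ⬝ᵥ b := Finset.sum_nonneg fun _ _ => mul_self_nonneg _
    exact lt_of_le_of_ne h0 fun h => hb (dotProduct_self_eq_zero.1 h.symm)
  have htr : 0 ≤ a ⬝ᵥ b := by
    have := hZ.trace_nonneg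
    simpa [trace_vecMulVec] using this
  have hs : ∀ i j, a i * b j = a j * b i := by
    intro i j
    have := hZ.isHermitian.apply i j
    simp [vecMulVec_apply] at this
    linarith
  have ha : ∀ i, a i = (a ⬝ᵥ b) / (b ⬝ᵥ b) * b i := by
    intro i
    have : a i * (b ⬝ᵥ b) = (a ⬝ᵥ b) * b i := by
      simp only [dotProduct, Finset.mul_sum, Finset.sum_mul]
      exact Finset.sum_congr rfl fun j _ => by linear_combination b j * hs i j
    field_simp
    linarith
  refine ⟨Real.sqrt ((a ⬝ᵥ b) / (b ⬝ᵥ b)) • b, ?_⟩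
  ext i j
  have h := Real.mul_self_sqrt (div_nonneg htr hbb.le)
  simp only [vecMulVec_apply, Pi.smul_apply, smul_eq_mul]
  rw [ha i]
  linear_combination (-(b i * b j)) * h

lemma poly_min (p α q s β γ : ℝ)
    (h : ∀ t : ℝ, p ^ 2 - 2 * s ≤
      (p + 2 * t * α + t ^ 2 * q) ^ 2 - 2 * (s + 2 * t * β + t ^ 2 * γ)) : β = p * α := by
  have hd : HasDerivAt (fun t : ℝ => (p + 2 * t * α + t ^ 2 * q) ^ 2
      - 2 * (s + 2 * t * β + t ^ 2 * γ)) (4 * p * α - 4 * β) 0 := by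
    have h1 : ∀ c d e : ℝ, HasDerivAt (fun t : ℝ => c + 2 * t * d + t ^ 2 * e) (2 * d) 0 := by
      intro c d e
      have := ((((hasDerivAt_id (0 : ℝ)).const_mul 2).mul_const d).const_add c).add
        (((hasDerivAt_id (0 : ℝ)).pow 2).mul_const e)
      exact this.congr_deriv (by simp)
    have := ((h1 p α q).pow 2).sub ((h1 s β γ).const_mul 2)
    exact this.congr_deriv (by simp; ring)
  have hm : IsLocalMin (fun t : ℝ => (p + 2 * t * α + t ^ 2 * q) ^ 2
      - 2 * (s + 2 * t * β + t ^ 2 * γ)) 0 :=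
    Filter.Eventually.of_forall fun t => by simpa using h t
  have := hm.hasDerivAt_eq_zero hd
  linarith

/-- Squared form of the main estimate: `‖uuᵀ - X‖² ≤ e + 16 e² / ‖X‖²`. -/
lemma core (x u : Fin n → ℝ) (hx : x ≠ 0) (W : Matrix (Fin n) (Fin n) ℝ) (hW : W.IsSymm)
    (hmin : ∀ Q : Matrix (Fin n) (Fin n) ℝ, Q.PosSemidef → Q.rank ≤ 1 →
      ip (vecMulVec u u - W) (vecMulVec u u - W) ≤ ip (Q - W) (Q - W))
    (e d : ℝ) (he : e = ip (W - vecMulVec x x) (W - vecMulVec x x))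
    (hd : d = ip (vecMulVec u u - vecMulVec x x) (vecMulVec u u - vecMulVec x x)) :
    (d - e) * ip (vecMulVec x x) (vecMulVec x x) ≤ 16 * e ^ 2 := by
  have hxx : 0 < x ⬝ᵥ x := by
    have h0 : 0 ≤ x ⬝ᵥ x := Finset.sum_nonneg fun _ _ => mul_self_nonneg _
    exact lt_of_le_of_ne h0 fun h => hx (dotProduct_self_eq_zero.1 h.symm)
  have he0 : 0 ≤ e := he ▸ ip_self_nonneg _
  have hd0 : 0 ≤ d := hd ▸ ip_self_nonneg _
  have hmv : ∀ v : Fin n → ℝ, (u ⬝ᵥ u) ^ 2 - 2 * ip W (vecMulVec u u) ≤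
      (v ⬝ᵥ v) ^ 2 - 2 * ip W (vecMulVec v v) := by
    intro v
    have := hmin _ (psd_vec v) (rank_vecMulVec_le v v)
    simp only [ip_sub_left, ip_sub_right, ip_vec, ip_comm _ W] at this
    nlinarith
  have hst : ∀ h : Fin n → ℝ, ip W (vecMulVec u h) = (u ⬝ᵥ u) * (u ⬝ᵥ h) := by
    intro h
    apply poly_min _ _ (h ⬝ᵥ h) (ip W (vecMulVec u u)) _ (ip W (vecMulVec h h))
    intro t
    have := hmv (u + t • h)
    simp only [add_vecMulVec, vecMulVec_add, smul_vecMulVec, vecMulVec_smul, ip_add_right,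
      ip_smul_right, dotProduct_add, add_dotProduct, dotProduct_smul, smul_dotProduct,
      smul_eq_mul, ip_symm W hW h u, dotProduct_comm h u] at this
    convert this using 2 <;> ring
  have hd4 : d ≤ 4 * e := by
    have h1 := hmin _ (psd_vec x) (rank_vecMulVec_le x x)
    have h2 := ip_self_nonneg (vecMulVec u u - W - (W - vecMulVec x x))
    rw [he, hd]
    simp only [ip_sub_left, ip_sub_right, ip_comm _ W,
      ip_comm (vecMulVec x x) (vecMulVec u u)] at h1 h2 ⊢
    linarith
  by_cases hu : u = 0
  · subst hu
    have hneg : ip W (vecMulVec x x) ≤ 0 := by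
      by_contra! hpos
      have h1 := hmv (Real.sqrt (ip W (vecMulVec x x) / (x ⬝ᵥ x) ^ 2) • x)
      have h2 := Real.mul_self_sqrt (div_pos hpos (pow_pos hxx 2)).le
      simp only [smul_vecMulVec, vecMulVec_smul, ip_smul_right, dotProduct_smul, smul_dotProduct,
        smul_eq_mul, ← mul_assoc, h2] at h1
      have h3 : ip W 0 = 0 := by simp [ip]
      simp [h3] at h1
      field_simp at h1
      nlinarith
    have : d ≤ e := by
      rw [he, hd]
      simp only [ip_sub_left, ip_sub_right, ip_comm _ W, ip_vec]
      have := ip_self_nonneg W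
      simp
      linarith
    nlinarith [ip_self_nonneg (vecMulVec x x), sq_nonneg e]
  have hp : 0 < u ⬝ᵥ u := by
    have h0 : 0 ≤ u ⬝ᵥ u := Finset.sum_nonneg fun _ _ => mul_self_nonneg _
    exact lt_of_le_of_ne h0 fun h => hu (dotProduct_self_eq_zero.1 h.symm)
  obtain ⟨a, y, hxy, huy⟩ : ∃ (a : ℝ) (y : Fin n → ℝ), x = a • u + y ∧ u ⬝ᵥ y = 0 := by
    refine ⟨(u ⬝ᵥ x) / (u ⬝ᵥ u), x - ((u ⬝ᵥ x) / (u ⬝ᵥ u)) • u, by simp, ?_⟩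
    simp only [dotProduct_sub, dotProduct_smul, smul_eq_mul]
    field_simp
    ring
  have hyu : y ⬝ᵥ u = 0 := by rw [dotProduct_comm, huy]
  have hr : 0 ≤ y ⬝ᵥ y := Finset.sum_nonneg fun _ _ => mul_self_nonneg _
  have hWuu := hst u
  have hWuy := hst y
  rw [huy, mul_zero] at hWuy
  have hWyu : ip W (vecMulVec y u) = 0 := by rw [ip_symm W hW, hWuy]
  set p := u ⬝ᵥ u with hpdef
  set r := y ⬝ᵥ y with hrdef
  have hN : ip (vecMulVec x x) (vecMulVec x x) = (a ^ 2 * p + r) ^ 2 := by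
    rw [ip_vec, hxy]
    simp only [dotProduct_add, add_dotProduct, dotProduct_smul, smul_dotProduct, smul_eq_mul,
      huy, hyu, ← hpdef, ← hrdef]
    ring
  have hdv : d = ((1 - a ^ 2) ^ 2 * p ^ 2 + 2 * a ^ 2 * p * r) + r ^ 2 := by
    rw [hd]
    simp only [ip_sub_left, ip_sub_right, ip_vec]
    rw [hxy]
    simp only [dotProduct_add, add_dotProduct, dotProduct_smul, smul_dotProduct, smul_eq_mul,
      huy, hyu, ← hpdef, ← hrdef]
    ring
  have hAe : (1 - a ^ 2) ^ 2 * p ^ 2 + 2 * a ^ 2 * p * r ≤ e := by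
    have h2 := ip_self_nonneg (W - vecMulVec x x - ((1 - a ^ 2) • vecMulVec u u
      - a • (vecMulVec u y + vecMulVec y u)))
    have h3 : ip (W - vecMulVec x x) ((1 - a ^ 2) • vecMulVec u u
      - a • (vecMulVec u y + vecMulVec y u)) = (1 - a ^ 2) ^ 2 * p ^ 2 + 2 * a ^ 2 * p * r := by
      simp only [ip_sub_left, ip_sub_right, ip_add_right, ip_smul_right, ip_vec,
        hWuu, hWuy, hWyu]
      rw [hxy]
      simp only [dotProduct_add, add_dotProduct, dotProduct_smul, smul_dotProduct, smul_eq_mul,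
        huy, hyu, ← hpdef, ← hrdef]
      ring
    have h4 : ip ((1 - a ^ 2) • vecMulVec u u - a • (vecMulVec u y + vecMulVec y u))
      ((1 - a ^ 2) • vecMulVec u u - a • (vecMulVec u y + vecMulVec y u))
        = (1 - a ^ 2) ^ 2 * p ^ 2 + 2 * a ^ 2 * p * r := by
      simp only [ip_sub_left, ip_sub_right, ip_add_right, ip_add_left, ip_smul_left,
        ip_smul_right, ip_vec, huy, hyu, ← hpdef, ← hrdef]
      ring
    generalize (1 - a ^ 2) • vecMulVec u u - a • (vecMulVec u y + vecMulVec y u) = A at h2 h3 h4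
    generalize W - vecMulVec x x = E at h2 h3 he
    rw [ip_sub_left, ip_sub_right, ip_sub_right, ← he, ip_comm A E, h3, h4] at h2
    linarith
  have hrN : r * (a ^ 2 * p + r) ≤ d := by
    rw [hdv]
    nlinarith [sq_nonneg ((1 - a ^ 2) * p), mul_nonneg (mul_nonneg (sq_nonneg a) hp.le) hr]
  rw [hN]
  have h1 : (r * (a ^ 2 * p + r)) ^ 2 ≤ (4 * e) ^ 2 := by
    apply pow_le_pow_left₀ (by positivity)
    linarith
  have h2 : d - e ≤ r ^ 2 := by linarith
  calc (d - e) * (a ^ 2 * p + r) ^ 2 ≤ r ^ 2 * (a ^ 2 * p + r) ^ 2 := by gcongr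
    _ ≤ 16 * e ^ 2 := by nlinarith

end RetractionAux

/-- Error bound after the retraction step: if `Z⁺` is a best rank-(at most)-1 positive
semidefinite Frobenius approximation of `W`, `‖W − X‖_F ≤ μ‖Z − X‖_F` and
`‖Z − X‖_F ≤ ε₀‖X‖_F` with `X = xxᵀ`, then
`‖Z⁺ − X‖_F ≤ μ√(1 + 16μ²ε₀²)‖Z − X‖_F`. -/
theorem retraction_error_bound
    (n : ℕ) (x : Fin n → ℝ) (hx : x ≠ 0)
    (X : Matrix (Fin n) (Fin n) ℝ) (hX : X = vecMulVec x x)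
    (Z W Zp : Matrix (Fin n) (Fin n) ℝ)
    (hZpsd : Z.PosSemidef) (hZrank : Z.rank = 1)
    (hWsymm : W.IsSymm)
    (μ ε₀ : ℝ) (hμ : 0 < μ) (hε₀ : 0 < ε₀)
    (hWX : frobNorm (W - X) ≤ μ * frobNorm (Z - X))
    (hZX : frobNorm (Z - X) ≤ ε₀ * frobNorm X)
    (hZpPsd : Zp.PosSemidef) (hZpRank : Zp.rank ≤ 1)
    (hZpMin : ∀ Q : Matrix (Fin n) (Fin n) ℝ, Q.PosSemidef → Q.rank ≤ 1 →
      frobNorm (Zp - W) ≤ frobNorm (Q - W)) :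
    frobNorm (Zp - X) ≤ μ * Real.sqrt (1 + 16 * μ^2 * ε₀^2) * frobNorm (Z - X) := by
  obtain ⟨u, rfl⟩ := RetractionAux.exists_vec Zp hZpPsd hZpRank
  subst hX
  have hc := RetractionAux.core x u hx W hWsymm (fun Q h1 h2 => by
    rw [← RetractionAux.frob_sq, ← RetractionAux.frob_sq]
    exact pow_le_pow_left₀ (RetractionAux.frob_nonneg _) (hZpMin Q h1 h2) 2) _ _ rfl rfl
  simp only [← RetractionAux.frob_sq] at hc
  have hN : 0 < frobNorm (vecMulVec x x) := by
    refine lt_of_le_of_ne (RetractionAux.frob_nonneg _) fun h => hx ?_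
    have h1 := RetractionAux.frob_sq (vecMulVec x x)
    rw [← h, RetractionAux.ip_vec] at h1
    have h2 : x ⬝ᵥ x = 0 := by nlinarith
    exact dotProduct_self_eq_zero.1 h2
  have h0 := RetractionAux.frob_nonneg (W - vecMulVec x x)
  have hz0 := RetractionAux.frob_nonneg (Z - vecMulVec x x)
  generalize frobNorm (vecMulVec x x) = N at *
  generalize frobNorm (W - vecMulVec x x) = e at *
  generalize frobNorm (Z - vecMulVec x x) = z at *
  generalize frobNorm (vecMulVec u u - vecMulVec x x) = d at *
  have heN : e ^ 2 ≤ (μ * z) ^ 2 := pow_le_pow_left₀ h0 hWX 2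
  have heN2 : e ^ 2 ≤ (μ * (ε₀ * N)) ^ 2 :=
    pow_le_pow_left₀ h0 (hWX.trans (by gcongr)) 2
  have hd : d ^ 2 ≤ (1 + 16 * μ ^ 2 * ε₀ ^ 2) * e ^ 2 := by
    have : (d ^ 2 - e ^ 2) * N ^ 2 ≤ (16 * μ ^ 2 * ε₀ ^ 2 * e ^ 2) * N ^ 2 := by
      nlinarith [mul_le_mul_of_nonneg_right heN2 (sq_nonneg e)]
    have := le_of_mul_le_mul_right this (by positivity)
    linarith
  have hs : Real.sqrt (1 + 16 * μ ^ 2 * ε₀ ^ 2) ^ 2 = 1 + 16 * μ ^ 2 * ε₀ ^ 2 :=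
    Real.sq_sqrt (by positivity)
  refine abs_le_of_sq_le_sq' ?_ (by positivity) |>.2
  rw [mul_pow, mul_pow, hs]
  calc d ^ 2 ≤ (1 + 16 * μ ^ 2 * ε₀ ^ 2) * e ^ 2 := hd
    _ ≤ (1 + 16 * μ ^ 2 * ε₀ ^ 2) * (μ * z) ^ 2 := by gcongr
    _ = _ := by ring
end

section
/- Let z ∈ ℝⁿ be nonzero, x ∈ ℝⁿ be nonzero, T_z = {zw⊤ + wz⊤ : w ∈ ℝⁿ}, and P_{T_z} the orthogonal projection of symmetric n×n matrices onto T_z with respect to the Frobenius inner product. Then ‖xx⊤ − P_{T_z}(xx⊤)‖_F ≤ ‖zz⊤ − xx⊤‖_F² / ‖xx⊤‖_F. Equivalently, (I − P_{T_z})(xx⊤) = (x − (z⊤x/‖z‖²)z)(x − (z⊤x/‖z‖²)z)⊤ up to sign, and the Frobenius norm of this matrix is at most ‖zz⊤ − xx⊤‖_F² / ‖x‖². -/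
open Matrix

/-- The orthogonal projection (w.r.t. the Frobenius inner product) of symmetric matrices
onto the tangent space `T_z = {z wᵀ + w zᵀ}`: `P(W) = QW + WQ − QWQ` with `Q = zzᵀ/‖z‖²`. -/
noncomputable def projT {n : ℕ} (z : Fin n → ℝ) (W : Matrix (Fin n) (Fin n) ℝ) :
    Matrix (Fin n) (Fin n) ℝ :=
  ((vecNorm z ^ 2)⁻¹ • vecMulVec z z) * W + W * ((vecNorm z ^ 2)⁻¹ • vecMulVec z z)
    - ((vecNorm z ^ 2)⁻¹ • vecMulVec z z) * W * ((vecNorm z ^ 2)⁻¹ • vecMulVec z z)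

theorem frob_sub_sq {n : ℕ} (z x : Fin n → ℝ) :
    ∑ i, ∑ j, ((vecMulVec z z - vecMulVec x x) i j)^2
      = (∑ i, z i ^ 2)^2 - 2 * (dotp z x)^2 + (∑ i, x i ^ 2)^2 := by
  have h : ∀ i j, ((vecMulVec z z - vecMulVec x x) i j)^2
      = z i ^ 2 * z j ^ 2 - 2 * ((z i * x i) * (z j * x j)) + x i ^ 2 * x j ^ 2 := by
    intro i j
    simp only [Matrix.sub_apply, vecMulVec_apply]
    ring
  simp only [h, dotp, Finset.sum_add_distrib, Finset.sum_sub_distrib, ← Finset.mul_sum]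
  simp only [sq (Finset.sum _ _), Finset.sum_mul]

theorem frob_self {n : ℕ} (x : Fin n → ℝ) :
    frobNorm (vecMulVec x x) = ∑ i, x i ^ 2 := by
  have h : ∑ i, ∑ j, ((vecMulVec x x) i j)^2 = (∑ i, x i ^ 2)^2 := by
    simp only [vecMulVec_apply, mul_pow, sq (Finset.sum _ _), Finset.sum_mul, Finset.mul_sum]
    rw [Finset.sum_comm]
  rw [frobNorm, h]
  exact Real.sqrt_sq (Finset.sum_nonneg fun i _ => sq_nonneg _)

theorem sumsq_pos {n : ℕ} (x : Fin n → ℝ) (hx : x ≠ 0) : 0 < ∑ i, x i ^ 2 := by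
  obtain ⟨i, hi⟩ := Function.ne_iff.mp hx
  exact Finset.sum_pos' (fun i _ => sq_nonneg _) ⟨i, Finset.mem_univ _, by
    have : x i ≠ 0 := hi
    positivity⟩

/-- Tangent space approximation: `(I − P_{T_z})(xxᵀ) = vvᵀ` with
`v = x − (zᵀx/‖z‖²)z`, and `‖xxᵀ − P_{T_z}(xxᵀ)‖_F ≤ ‖zzᵀ − xxᵀ‖_F²/‖xxᵀ‖_F`. -/
theorem tangent_space_approximation
    (n : ℕ) (z x : Fin n → ℝ) (hz : z ≠ 0) (hx : x ≠ 0) :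
    vecMulVec x x - projT z (vecMulVec x x)
      = vecMulVec (x - (dotp z x / vecNorm z ^ 2) • z)
          (x - (dotp z x / vecNorm z ^ 2) • z) ∧
    frobNorm (vecMulVec x x - projT z (vecMulVec x x))
      ≤ frobNorm (vecMulVec z z - vecMulVec x x) ^ 2 / frobNorm (vecMulVec x x) := by
  have hb := sumsq_pos z hz
  have ha := sumsq_pos x hx
  have hn : vecNorm z ^ 2 = ∑ i, z i ^ 2 := Real.sq_sqrt hb.le
  have hcs : (dotp z x)^2 ≤ (∑ i, z i ^ 2) * ∑ i, x i ^ 2 :=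
    Finset.sum_mul_sq_le_sq_mul_sq _ _ _
  have hzx : z ⬝ᵥ x = dotp z x := rfl
  have hxz : x ⬝ᵥ z = dotp z x := by rw [dotProduct_comm]; rfl
  have key : vecMulVec x x - projT z (vecMulVec x x)
      = vecMulVec (x - (dotp z x / vecNorm z ^ 2) • z)
          (x - (dotp z x / vecNorm z ^ 2) • z) := by
    ext i j
    simp only [projT, Matrix.smul_mul, Matrix.mul_smul, vecMulVec_mul_vecMulVec, hzx, hxz,
      Matrix.sub_apply, Matrix.add_apply, Matrix.smul_apply, vecMulVec_apply, Pi.sub_apply,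
      Pi.smul_apply, smul_eq_mul, Matrix.vecMulVec_smul]
    ring
  refine ⟨key, ?_⟩
  have hF : frobNorm (vecMulVec z z - vecMulVec x x) ^ 2
      = (∑ i, z i ^ 2)^2 - 2 * (dotp z x)^2 + (∑ i, x i ^ 2)^2 := by
    rw [← frob_sub_sq]
    exact Real.sq_sqrt
      (Finset.sum_nonneg fun i _ => Finset.sum_nonneg fun j _ => sq_nonneg _)
  rw [key, frob_self, frob_self, hn, hF]
  have hv : ∀ t : ℝ, ∑ i, ((x - t • z) i)^2
      = (∑ i, x i ^ 2) - 2 * t * dotp z x + t^2 * ∑ i, z i ^ 2 := by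
    intro t
    rw [dotp, Finset.mul_sum, Finset.mul_sum, ← Finset.sum_sub_distrib, ← Finset.sum_add_distrib]
    refine Finset.sum_congr rfl fun i _ => ?_
    simp only [Pi.sub_apply, Pi.smul_apply, smul_eq_mul]
    ring
  rw [hv]
  generalize (∑ i, x i ^ 2) = a at *
  generalize (∑ i, z i ^ 2) = b at *
  generalize dotp z x = c at *
  obtain ⟨t, rfl⟩ : ∃ t, c = t * b := ⟨c / b, by field_simp⟩
  rw [mul_div_cancel_right₀ _ hb.ne', le_div_iff₀ ha]
  have hq : t^2 * b ≤ a := by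
    have : b * (t^2 * b) ≤ b * a := by linarith [mul_pow t b 2]
    exact le_of_mul_le_mul_left this hb
  have h0 : 0 ≤ t^2 * b := by positivity
  nlinarith [sq_nonneg (b - t^2 * b), mul_nonneg h0 (sub_nonneg.2 hq)]
end

section
/- For any vectors z, x ∈ ℝⁿ with z⊤x ≥ 0, one has ‖zz⊤ − xx⊤‖_F² ≥ (4/5)·‖z − x‖²·‖x‖². -/
open Matrix

lemma aux_scalar (s r c : ℝ) (hs : 0 ≤ s) (hr : 0 ≤ r) (hc : 0 ≤ c) (hcs : c ≤ s * r) :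
    (4/5) * (s^2 - 2*c + r^2) * r^2 ≤ s^4 - 2*c^2 + r^4 := by
  have hA : 0 ≤ s^4 + r^4/5 - 4*s^2*r^2/5 := by
    nlinarith [sq_nonneg (s^2 - 2/5*r^2), sq_nonneg (r^2)]
  have hB : 0 ≤ (s-r)^2*(s^2+2*s*r+r^2/5) := by positivity
  rcases (mul_nonneg hs hr).eq_or_lt with h0 | h0
  · have : c = 0 := by linarith
    subst this
    linarith
  · have key : 0 ≤ (s*r) * (s^4 - 2*c^2 + r^4 - (4/5) * (s^2 - 2*c + r^2) * r^2) := by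
      have e : (s*r) * (s^4 - 2*c^2 + r^4 - (4/5) * (s^2 - 2*c + r^2) * r^2)
        = (s*r-c)*(s^4 + r^4/5 - 4*s^2*r^2/5) + c*((s-r)^2*(s^2+2*s*r+r^2/5))
          + 2*(s*r)*(c*(s*r-c)) := by ring
      rw [e]
      have := sub_nonneg.2 hcs
      positivity
    have := nonneg_of_mul_nonneg_right key h0
    linarith

/-- If `zᵀx ≥ 0`, then `‖zzᵀ − xxᵀ‖_F² ≥ (4/5)‖z − x‖²‖x‖²`. -/
theorem lifted_distance_lower_bound (n : ℕ) (z x : Fin n → ℝ) (h : 0 ≤ dotp z x) :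
    (4/5) * vecNorm (z - x) ^ 2 * vecNorm x ^ 2
      ≤ frobNorm (vecMulVec z z - vecMulVec x x) ^ 2 := by
  have hv : ∀ v : Fin n → ℝ, vecNorm v ^ 2 = ∑ i, (v i)^2 := fun v =>
    Real.sq_sqrt (Finset.sum_nonneg fun i _ => sq_nonneg _)
  have h1 : vecNorm (z - x) ^ 2 = vecNorm z ^ 2 - 2 * dotp z x + vecNorm x ^ 2 := by
    rw [hv, hv, hv, dotp, Finset.mul_sum, ← Finset.sum_sub_distrib, ← Finset.sum_add_distrib]
    refine Finset.sum_congr rfl fun i _ => ?_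
    simp only [Pi.sub_apply]
    ring
  have h2 : frobNorm (vecMulVec z z - vecMulVec x x) ^ 2
      = vecNorm z ^ 4 - 2 * dotp z x ^ 2 + vecNorm x ^ 4 := by
    have e4 : ∀ v : Fin n → ℝ, vecNorm v ^ 4 = (∑ i, (v i)^2) * (∑ i, (v i)^2) := fun v => by
      rw [← hv]; ring
    have hF : ∀ A : Matrix (Fin n) (Fin n) ℝ, frobNorm A ^ 2 = ∑ i, ∑ j, (A i j)^2 := fun A =>
      Real.sq_sqrt (Finset.sum_nonneg fun i _ => Finset.sum_nonneg fun j _ => sq_nonneg _)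
    rw [hF, e4, e4, dotp, sq (∑ i, z i * x i), Finset.sum_mul_sum, Finset.sum_mul_sum,
      Finset.sum_mul_sum]
    simp only [Finset.mul_sum, ← Finset.sum_sub_distrib, ← Finset.sum_add_distrib]
    refine Finset.sum_congr rfl fun i _ => Finset.sum_congr rfl fun j _ => ?_
    simp only [Matrix.sub_apply, vecMulVec_apply]
    ring
  rw [h1, h2]
  have hz : 0 ≤ vecNorm z := Real.sqrt_nonneg _
  have hx : 0 ≤ vecNorm x := Real.sqrt_nonneg _
  refine aux_scalar _ _ _ hz hx h ?_
  refine abs_le_of_sq_le_sq' ?_ (mul_nonneg hz hx) |>.2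
  rw [mul_pow, hv, hv]
  exact Finset.sum_mul_sq_le_sq_mul_sq _ _ _
end
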